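/- Let $K$ be an algebraic number field of degree $n \geq 6$ over $\mathbb{Q}$. Then for every $\varepsilon > 0$ there exists a constant $C > 0$ (depending on $K$ and $\varepsilon$) such that for all sufficiently large real $x$, $\left| \sum_{m \leq x/e} r_K(m) \log\log\frac{x}{m} - E_1(1)\,\kappa_K\, x \right| \leq C\, x^{1 - 3/n + \varepsilon}$. -/

import Mathlib

open NumberField Filter Asymptotics Set MeasureTheory

/-- `rK K m` is the number of nonzero integral ideals of the ring of integers of `K`
with absolute norm equal to `m` (for `m ≥ 1` the nonzero condition is automatic). -/
noncomputable def rK (K : Type*) [Field K] [NumberField K] (m : ℕ) : ℕ :=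
  Nat.card {I : Ideal (𝓞 K) // Ideal.absNorm I = m}

/-- The exponential integral `E₁(X) = ∫_X^∞ e^{-t}/t dt`. -/
noncomputable def E1 (X : ℝ) : ℝ := ∫ t in Set.Ioi X, Real.exp (-t) / t

set_option linter.unusedSectionVars false

section Poisson

variable {ι : Type*}

/-- The periodization of `G` over the integer lattice. -/
noncomputable def periodization (G : (ι → ℝ) → ℂ) (x : ι → ℝ) : ℂ :=
  ∑' m : ι → ℤ, G (x + fun i ↦ (m i : ℝ))

lemma periodization_eq_sum {G : (ι → ℝ) → ℂ} {T : Finset (ι → ℤ)} {x : ι → ℝ}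
    (h : ∀ m ∉ T, G (x + fun i ↦ (m i : ℝ)) = 0) :
    periodization G x = ∑ m ∈ T, G (x + fun i ↦ (m i : ℝ)) := tsum_eq_sum h

lemma periodization_add_int (G : (ι → ℝ) → ℂ) (x : ι → ℝ) (k : ι → ℤ) :
    periodization G (x + fun i ↦ (k i : ℝ)) = periodization G x := by
  unfold periodization
  rw [← (Equiv.addLeft k).tsum_eq (fun m ↦ G (x + fun i ↦ (m i : ℝ)))]
  refine tsum_congr fun m ↦ ?_
  congr 1
  ext i
  simp [add_assoc]

lemma periodization_congr (G : (ι → ℝ) → ℂ) {x y : ι → ℝ}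
    (h : ∀ i, (x i : UnitAddCircle) = y i) : periodization G x = periodization G y := by
  have h1 : ∀ i, ∃ k : ℤ, x i = y i + k := fun i ↦ by
    obtain ⟨k, hk⟩ := AddSubgroup.mem_zmultiples_iff.mp
      ((QuotientAddGroup.eq).mp (h i).symm)
    refine ⟨k, ?_⟩
    simp at hk
    linarith
  choose k hk using h1
  rw [← periodization_add_int G y k]
  congr 1
  ext i
  simp [hk]

variable [Fintype ι]

lemma finite_int_vec_norm_le (R : ℝ) :
    {m : ι → ℤ | ‖(fun i ↦ (m i : ℝ))‖ ≤ R}.Finite := by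
  classical
  refine (Set.finite_Icc (fun _ : ι ↦ -⌈R⌉) (fun _ ↦ ⌈R⌉)).subset fun m hm ↦ ?_
  have h : ∀ i, |(m i : ℝ)| ≤ R := fun i ↦ (norm_le_pi_norm (fun i ↦ (m i : ℝ)) i).trans hm
  refine ⟨fun i ↦ ?_, fun i ↦ ?_⟩
  · have h1 : -((m i : ℤ) : ℝ) ≤ ⌈R⌉ := by
      linarith [(abs_le.mp (h i)).1, Int.le_ceil R]
    have : -(m i) ≤ ⌈R⌉ := by exact_mod_cast h1
    linarith
  · have h1 : ((m i : ℤ) : ℝ) ≤ ⌈R⌉ := by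
      linarith [(abs_le.mp (h i)).2, Int.le_ceil R]
    exact_mod_cast h1

lemma exists_finset_forall_notMem_eq_zero {G : (ι → ℝ) → ℂ} (hG : HasCompactSupport G) (R : ℝ) :
    ∃ T : Finset (ι → ℤ), ∀ x : ι → ℝ, ‖x‖ ≤ R → ∀ m ∉ T, G (x + fun i ↦ (m i : ℝ)) = 0 := by
  obtain ⟨R', hR'⟩ := hG.isCompact.isBounded.subset_closedBall (0 : ι → ℝ)
  refine ⟨(finite_int_vec_norm_le (R + R')).toFinset, fun x hx m hm ↦ ?_⟩
  by_contra h
  have h1 : x + (fun i ↦ (m i : ℝ)) ∈ Metric.closedBall 0 R' := hR' (subset_tsupport _ h)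
  apply hm
  simp only [Set.Finite.mem_toFinset, Set.mem_ofPred_eq]
  rw [mem_closedBall_zero_iff] at h1
  calc ‖(fun i ↦ (m i : ℝ))‖ = ‖(x + fun i ↦ (m i : ℝ)) - x‖ := by simp
    _ ≤ _ := norm_sub_le _ _
    _ ≤ _ := by linarith

lemma continuous_periodization {G : (ι → ℝ) → ℂ} (hc : Continuous G) (hG : HasCompactSupport G) :
    Continuous (periodization G) := by
  rw [continuous_iff_continuousAt]
  intro x
  obtain ⟨T, hT⟩ := exists_finset_forall_notMem_eq_zero hG (‖x‖ + 1)
  have : periodization G =ᶠ[nhds x] fun y ↦ ∑ m ∈ T, G (y + fun i ↦ (m i : ℝ)) := by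
    filter_upwards [Metric.ball_mem_nhds x one_pos] with y hy
    refine periodization_eq_sum (hT y ?_)
    have := norm_le_norm_add_norm_sub' y x
    rw [Metric.mem_ball, dist_eq_norm] at hy
    linarith
  refine ContinuousAt.congr ?_ this.symm
  fun_prop

/-- The periodization of `G` as a continuous function on the torus. -/
lemma exists_torus_periodization {G : (ι → ℝ) → ℂ} (hc : Continuous G)
    (hG : HasCompactSupport G) :
    ∃ P : C(UnitAddTorus ι, ℂ), ∀ x : ι → ℝ, P (fun i ↦ (x i : UnitAddCircle)) =
      periodization G x := by
  have hq : IsOpenQuotientMap (fun (x : ι → ℝ) (i : ι) ↦ (x i : UnitAddCircle)) :=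
    IsOpenQuotientMap.piMap (f := fun (_ : ι) (x : ℝ) ↦ (x : UnitAddCircle))
      fun _ ↦ QuotientAddGroup.isOpenQuotientMap_mk
  set p := Function.surjInv hq.surjective
  have hp : ∀ t, (fun i ↦ ((p t i : ℝ) : UnitAddCircle)) = t := Function.surjInv_eq hq.surjective
  have key : ∀ x : ι → ℝ, periodization G (p (fun i ↦ (x i : UnitAddCircle))) =
      periodization G x := fun x ↦ periodization_congr G fun i ↦ congr_fun (hp _) i
  refine ⟨⟨fun t ↦ periodization G (p t), ?_⟩, key⟩
  rw [hq.isQuotientMap.continuous_iff]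
  exact (continuous_periodization hc hG).congr fun x ↦ (key x).symm

lemma mFourier_coe (k : ι → ℤ) (x : ι → ℝ) :
    UnitAddTorus.mFourier k (fun i ↦ (x i : UnitAddCircle)) =
      Complex.exp (2 * Real.pi * Complex.I * (∑ i, (k i : ℝ) * x i : ℝ)) := by
  simp only [UnitAddTorus.mFourier, ContinuousMap.coe_mk, fourier_coe_apply]
  rw [← Complex.exp_sum]
  congr 1
  push_cast
  rw [Finset.mul_sum]
  refine Finset.sum_congr rfl fun i _ ↦ ?_
  ring

lemma integral_eq_integral_periodization {G : (ι → ℝ) → ℂ} (hc : Continuous G)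
    (hG : HasCompactSupport G) :
    ∫ x in {x : ι → ℝ | ∀ i, x i ∈ Ioc ((0 : ι → ℝ) i) ((0 : ι → ℝ) i + 1)}, periodization G x =
      ∫ x, G x := by
  set Q : Set (ι → ℝ) := {x : ι → ℝ | ∀ i, x i ∈ Ioc ((0 : ι → ℝ) i) ((0 : ι → ℝ) i + 1)} with hQ
  have hQm : MeasurableSet Q := MeasurableSet.univ_pi' fun i ↦ measurableSet_Ioc
  have hQn : ∀ x ∈ Q, ‖x‖ ≤ 1 := fun x hx ↦ by
    refine (pi_norm_le_iff_of_nonneg zero_le_one).mpr fun i ↦ ?_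
    have := hx i
    simp only [Pi.zero_apply, zero_add, mem_Ioc] at this
    rw [Real.norm_eq_abs, abs_le]
    constructor <;> linarith
  have hInt : Integrable G := hc.integrable_of_hasCompactSupport hG
  obtain ⟨T, hT⟩ := exists_finset_forall_notMem_eq_zero hG 1
  have h1 : ∫ x in Q, periodization G x =
      ∫ x in Q, ∑ m ∈ T, G (x + fun i ↦ (m i : ℝ)) :=
    setIntegral_congr_fun hQm fun x hx ↦ periodization_eq_sum (hT x (hQn x hx))
  rw [h1, integral_finsetSum _ fun m _ ↦ (hInt.comp_add_right _).integrableOn]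
  let s : (ι → ℤ) → Set (ι → ℝ) := fun m ↦ {x | ∀ i, x i ∈ Ioc ((m i : ℝ)) ((m i : ℝ) + 1)}
  have hs : ∀ m, ∫ x in Q, G (x + fun i ↦ (m i : ℝ)) = ∫ x in s m, G x := fun m ↦ by
    have hmp : MeasurePreserving (fun x : ι → ℝ ↦ x + fun i ↦ (m i : ℝ)) :=
      measurePreserving_add_right volume _
    have := hmp.setIntegral_preimage_emb (MeasurableEquiv.addRight _).measurableEmbedding G (s m)
    rw [← this]
    congr 2
    ext x
    simp [hQ, s, add_comm (x _)]
  have hsm : ∀ m, MeasurableSet (s m) := fun m ↦ MeasurableSet.univ_pi' fun i ↦ measurableSet_Ioc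
  have hU : ⋃ m, s m = univ := by
    refine eq_univ_of_forall fun x ↦ mem_iUnion.mpr ⟨fun i ↦ ⌈x i⌉ - 1, fun i ↦ ?_⟩
    have h1 := Int.ceil_lt_add_one (x i)
    have h2 := Int.le_ceil (x i)
    constructor <;> push_cast <;> linarith
  have hd : Pairwise (Function.onFun Disjoint s) := by
    intro m m' hne
    rw [Function.onFun, Set.disjoint_left]
    intro x hx hx'
    apply hne
    ext i
    have h1 := hx i
    have h2 := hx' i
    have h3 : (m i : ℝ) < m' i + 1 := lt_of_lt_of_le h1.1 h2.2
    have h4 : (m' i : ℝ) < m i + 1 := lt_of_lt_of_le h2.1 h1.2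
    have h5 : m i < m' i + 1 := by exact_mod_cast h3
    have h6 : m' i < m i + 1 := by exact_mod_cast h4
    omega
  rw [← setIntegral_univ, ← hU, integral_iUnion hsm hd hInt.integrableOn]
  simp_rw [hs]
  refine (tsum_eq_sum fun m hm ↦ ?_).symm
  rw [← hs]
  exact setIntegral_eq_zero_of_forall_eq_zero fun x hx ↦ hT x (hQn x hx) m hm

/-- Poisson summation over the integer lattice for continuous compactly supported functions. -/
theorem poisson_pi {G : (ι → ℝ) → ℂ} (hc : Continuous G) (hG : HasCompactSupport G)
    (hs : Summable fun k : ι → ℤ ↦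
      ∫ x, Complex.exp (-(2 * Real.pi * Complex.I * (∑ i, (k i : ℝ) * x i : ℝ))) * G x) :
    ∑' m : ι → ℤ, G (fun i ↦ (m i : ℝ)) =
      ∑' k : ι → ℤ,
        ∫ x, Complex.exp (-(2 * Real.pi * Complex.I * (∑ i, (k i : ℝ) * x i : ℝ))) * G x := by
  obtain ⟨P, hP⟩ := exists_torus_periodization hc hG
  have hcoeff : ∀ k : ι → ℤ, UnitAddTorus.mFourierCoeff P k =
      ∫ x, Complex.exp (-(2 * Real.pi * Complex.I * (∑ i, (k i : ℝ) * x i : ℝ))) * G x := by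
    intro k
    rw [UnitAddTorus.mFourierCoeff_eq_integral _ k 0]
    rw [← integral_eq_integral_periodization
      (G := fun x ↦ Complex.exp (-(2 * Real.pi * Complex.I * (∑ i, (k i : ℝ) * x i : ℝ))) * G x)
      (by fun_prop) (hG.mul_left)]
    congr 1
    ext x
    rw [hP, mFourier_coe, smul_eq_mul, periodization, periodization, ← tsum_mul_left]
    refine tsum_congr fun m ↦ ?_
    congr 1
    rw [Complex.exp_eq_exp_iff_exists_int]
    refine ⟨∑ i, k i * m i, ?_⟩
    simp only [Pi.neg_apply, Pi.add_apply]
    push_cast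
    simp only [mul_add, Finset.sum_add_distrib, neg_mul, Finset.sum_neg_distrib]
    ring
  have hsum : Summable (UnitAddTorus.mFourierCoeff P) := hs.congr fun k ↦ (hcoeff k).symm
  have h0 := (UnitAddTorus.hasSum_mFourier_series_apply_of_summable hsum
    (fun _ ↦ ((0 : ℝ) : UnitAddCircle))).tsum_eq
  rw [hP (fun _ ↦ 0)] at h0
  rw [periodization] at h0
  have h2 : ∀ k, UnitAddTorus.mFourier k (fun _ ↦ ((0 : ℝ) : UnitAddCircle) : ι → UnitAddCircle) = 1 := fun k ↦ by
    rw [mFourier_coe k (fun _ ↦ 0)]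
    simp
  simp only [hcoeff] at h0
  rw [show (∑' m : ι → ℤ, G (fun i ↦ (m i : ℝ))) = ∑' m : ι → ℤ, G ((fun _ ↦ 0) + fun i ↦ (m i : ℝ)) by
    refine tsum_congr fun m ↦ ?_
    congr 1
    ext i
    simp, ← h0]
  refine tsum_congr fun k ↦ ?_
  rw [h2]
  simp

end Poisson

section PoissonLattice

open scoped FourierTransform RealInnerProductSpace

variable {ι : Type*}

/-- The point of Euclidean space with prescribed integer coordinates. -/
noncomputable def intVec (m : ι → ℤ) : EuclideanSpace ℝ ι := WithLp.toLp 2 fun i ↦ (m i : ℝ)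

@[simp] lemma intVec_apply (m : ι → ℤ) (i : ι) : intVec m i = m i := rfl

lemma intVec_injective : Function.Injective (intVec : (ι → ℤ) → EuclideanSpace ℝ ι) := by
  intro m m' h
  ext i
  have := congr_arg (fun y : EuclideanSpace ℝ ι ↦ y i) h
  simpa using this

lemma intVec_zero : intVec (0 : ι → ℤ) = 0 := by
  ext i
  simp

lemma intVec_ne_zero {m : ι → ℤ} (hm : m ≠ 0) : intVec m ≠ 0 := fun h ↦
  hm (intVec_injective (h.trans intVec_zero.symm))

variable [Fintype ι]

lemma summable_norm_intVec_rpow (A : EuclideanSpace ℝ ι ≃L[ℝ] EuclideanSpace ℝ ι) {r : ℝ}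
    (hr : r < -Fintype.card ι) : Summable fun m : ι → ℤ ↦ ‖A (intVec m)‖ ^ r := by
  classical
  let b : Module.Basis ι ℝ (EuclideanSpace ℝ ι) :=
    (EuclideanSpace.basisFun ι ℝ).toBasis.map A.toLinearEquiv
  let L : Submodule ℤ (EuclideanSpace ℝ ι) := Submodule.span ℤ (Set.range b)
  have hA : ∀ m : ι → ℤ, A (intVec m) = ∑ i, m i • b i := fun m ↦ by
    have h : intVec m = ∑ i, m i • (EuclideanSpace.basisFun ι ℝ i) := by
      ext j
      simp [Pi.single_apply]
    rw [h, map_sum]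
    simp [b]
  have hmem : ∀ m : ι → ℤ, A (intVec m) ∈ L := fun m ↦ by
    rw [hA]
    exact Submodule.sum_mem _ fun i _ ↦ Submodule.smul_mem _ _ (Submodule.subset_span ⟨i, rfl⟩)
  have hrank : Module.finrank ℤ L = Fintype.card ι := by
    rw [ZLattice.rank ℝ L]
    simp
  have hsum : Summable fun z : L ↦ ‖(z : EuclideanSpace ℝ ι)‖ ^ r :=
    ZLattice.summable_norm_rpow L r (by rw [hrank]; exact hr)
  have hinj : Function.Injective fun m : ι → ℤ ↦ (⟨A (intVec m), hmem m⟩ : L) := fun m m' h ↦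
    intVec_injective (A.injective (congr_arg (Subtype.val (p := fun x ↦ x ∈ L)) h))
  exact hsum.comp_injective (i := fun m : ι → ℤ ↦ (⟨A (intVec m), hmem m⟩ : L)) hinj

lemma SchwartzMap.summable_intVec (F : SchwartzMap (EuclideanSpace ℝ ι) ℂ)
    (A : EuclideanSpace ℝ ι ≃L[ℝ] EuclideanSpace ℝ ι) :
    Summable fun m : ι → ℤ ↦ F (A (intVec m)) := by
  classical
  obtain ⟨C, hC⟩ := F.decay (Fintype.card ι + 1) 0
  have hs := (summable_norm_intVec_rpow A (r := -((Fintype.card ι + 1 : ℕ) : ℝ))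
    (by push_cast; linarith)).mul_left C
  refine Summable.of_norm_bounded_eventually hs ?_
  rw [Filter.eventually_cofinite]
  refine (Set.finite_singleton (0 : ι → ℤ)).subset fun m hm ↦ ?_
  by_contra h0
  apply hm
  have hpos : 0 < ‖A (intVec m)‖ := norm_pos_iff.mpr
    ((map_ne_zero_iff _ A.injective).mpr (intVec_ne_zero h0))
  have := hC.2 (A (intVec m))
  rw [norm_iteratedFDeriv_zero] at this
  rw [Real.rpow_neg hpos.le, Real.rpow_natCast, ← div_eq_mul_inv, le_div_iff₀ (by positivity),
    mul_comm]
  exact this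

lemma integral_comp_equiv (A : EuclideanSpace ℝ ι ≃L[ℝ] EuclideanSpace ℝ ι)
    {G : Type*} [NormedAddCommGroup G] [NormedSpace ℝ G] (f : EuclideanSpace ℝ ι → G) :
    ∫ x, f (A x) = |(LinearMap.det (A : EuclideanSpace ℝ ι →ₗ[ℝ] EuclideanSpace ℝ ι))|⁻¹ •
      ∫ x, f x := by
  have hdet : LinearMap.det (A : EuclideanSpace ℝ ι →ₗ[ℝ] EuclideanSpace ℝ ι) ≠ 0 :=
    (LinearEquiv.isUnit_det' A.toLinearEquiv).ne_zero
  have hmap := Measure.map_linearMap_addHaar_eq_smul_addHaar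
    (volume : Measure (EuclideanSpace ℝ ι)) hdet
  have := A.toHomeomorph.toMeasurableEquiv.measurableEmbedding.integral_map (μ := volume) f
  change ∫ y, f y ∂(Measure.map (A : EuclideanSpace ℝ ι →ₗ[ℝ] EuclideanSpace ℝ ι) volume) =
    ∫ x, f (A x) at this
  rw [← this, hmap, integral_smul_measure, ENNReal.toReal_ofReal (abs_nonneg _), abs_inv]

/-- Poisson summation over the lattice `A ℤ^ι`. -/
theorem poisson_lattice (F : SchwartzMap (EuclideanSpace ℝ ι) ℂ) (hF : HasCompactSupport F)
    (A A' : EuclideanSpace ℝ ι ≃L[ℝ] EuclideanSpace ℝ ι)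
    (hAA' : ∀ x y, ⟪A' x, A y⟫ = ⟪x, y⟫) :
    ∑' m : ι → ℤ, F (A (intVec m)) =
      (|(LinearMap.det (A : EuclideanSpace ℝ ι →ₗ[ℝ] EuclideanSpace ℝ ι))|⁻¹ : ℝ) *
        ∑' m : ι → ℤ, 𝓕 F (A' (intVec m)) := by
  set D := (|(LinearMap.det (A : EuclideanSpace ℝ ι →ₗ[ℝ] EuclideanSpace ℝ ι))|⁻¹ : ℝ)
  let G : (ι → ℝ) → ℂ := fun x ↦ F (A (WithLp.toLp 2 x))
  have hGc : Continuous G := by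
    have := F.continuous
    fun_prop
  have hGs : HasCompactSupport G :=
    hF.comp_homeomorph ((PiLp.homeomorph 2 (fun _ : ι ↦ ℝ)).symm.trans A.toHomeomorph)
  have hInt : ∀ k : ι → ℤ,
      ∫ x, Complex.exp (-(2 * Real.pi * Complex.I * (∑ i, (k i : ℝ) * x i : ℝ))) * G x =
        D * 𝓕 F (A' (intVec k)) := fun k ↦ by
    rw [SchwartzMap.fourier_coe, Real.fourier_eq']
    have h1 := integral_comp_equiv A fun v : EuclideanSpace ℝ ι ↦
      Complex.exp ((↑(-2 * Real.pi * ⟪v, A' (intVec k)⟫) * Complex.I)) • F v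
    rw [Complex.real_smul] at h1
    rw [← h1]
    have h2 := (PiLp.volume_preserving_toLp ι).integral_comp
      (MeasurableEquiv.toLp 2 (ι → ℝ)).measurableEmbedding
      fun x : EuclideanSpace ℝ ι ↦
        Complex.exp ((↑(-2 * Real.pi * ⟪A x, A' (intVec k)⟫) * Complex.I)) • F (A x)
    rw [← h2]
    congr 1
    ext x
    simp only [smul_eq_mul, G]
    congr 2
    rw [real_inner_comm, hAA']
    simp only [PiLp.inner_apply, intVec_apply, RCLike.inner_apply, conj_trivial]
    push_cast
    simp_rw [mul_comm (x _ : ℂ)]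
    ring
  have hsum := (SchwartzMap.summable_intVec (𝓕 F) A').mul_left (D : ℂ)
  have := poisson_pi hGc hGs (hsum.congr fun k ↦ (hInt k).symm)
  simp_rw [hInt] at this
  rw [tsum_mul_left] at this
  exact this

end PoissonLattice

section Blocks

open scoped RealInnerProductSpace

variable {ι V : Type*} [Fintype ι] [Fintype V] [DecidableEq V] (π : ι → V)

/-- The number of coordinates in the block `v`. -/
def blockDim (v : V) : ℕ := (Finset.univ.filter fun i ↦ π i = v).card

/-- The Euclidean norm of the block `v` of `y`. -/
noncomputable def blockNorm (v : V) (y : EuclideanSpace ℝ ι) : ℝ :=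
  √(∑ i with π i = v, y i ^ 2)

/-- The product of the block norms, weighted by the block dimensions. -/
noncomputable def blockProd (y : EuclideanSpace ℝ ι) : ℝ :=
  ∏ v, blockNorm π v y ^ blockDim π v

variable {π}

lemma blockNorm_nonneg (v : V) (y : EuclideanSpace ℝ ι) : 0 ≤ blockNorm π v y := Real.sqrt_nonneg _

lemma blockProd_nonneg (y : EuclideanSpace ℝ ι) : 0 ≤ blockProd π y :=
  Finset.prod_nonneg fun v _ ↦ pow_nonneg (blockNorm_nonneg v y) _

lemma blockNorm_sq (v : V) (y : EuclideanSpace ℝ ι) :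
    blockNorm π v y ^ 2 = ∑ i with π i = v, y i ^ 2 :=
  Real.sq_sqrt (Finset.sum_nonneg fun _ _ ↦ sq_nonneg _)

lemma sum_blockNorm_sq (y : EuclideanSpace ℝ ι) : ∑ v, blockNorm π v y ^ 2 = ‖y‖ ^ 2 := by
  simp_rw [blockNorm_sq]
  rw [Finset.sum_fiberwise, EuclideanSpace.real_norm_sq_eq]

lemma blockNorm_le_norm (v : V) (y : EuclideanSpace ℝ ι) : blockNorm π v y ≤ ‖y‖ := by
  refine le_of_sq_le_sq ?_ (norm_nonneg y)
  rw [← sum_blockNorm_sq (π := π)]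
  exact Finset.single_le_sum (f := fun v ↦ blockNorm π v y ^ 2) (fun _ _ ↦ sq_nonneg _)
    (Finset.mem_univ v)

lemma norm_le_sum_blockNorm (y : EuclideanSpace ℝ ι) : ‖y‖ ≤ ∑ v, blockNorm π v y := by
  refine le_of_sq_le_sq ?_ (Finset.sum_nonneg fun v _ ↦ blockNorm_nonneg v y)
  rw [← sum_blockNorm_sq (π := π)]
  exact Finset.sum_sq_le_sq_sum_of_nonneg fun v _ ↦ blockNorm_nonneg v y

lemma sum_blockDim_mul (x : V → ℝ) : ∑ v, (blockDim π v : ℝ) * x v = ∑ i, x (π i) := by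
  rw [← Finset.sum_fiberwise (s := Finset.univ) (g := π)]
  refine Finset.sum_congr rfl fun v _ ↦ ?_
  rw [Finset.sum_congr rfl (g := fun _ ↦ x v) fun i hi ↦ by rw [(Finset.mem_filter.mp hi).2]]
  simp [blockDim]

lemma sum_blockDim : ∑ v, blockDim π v = Fintype.card ι := by
  have := sum_blockDim_mul (π := π) fun _ ↦ 1
  simp only [mul_one, Finset.sum_const, Finset.card_univ, nsmul_eq_mul] at this
  exact_mod_cast this

lemma blockDim_pos (hπ : Function.Surjective π) (v : V) : 0 < blockDim π v := by
  obtain ⟨i, hi⟩ := hπ v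
  exact Finset.card_pos.mpr ⟨i, by simp [hi]⟩

lemma blockProd_le_norm_pow (y : EuclideanSpace ℝ ι) :
    blockProd π y ≤ ‖y‖ ^ Fintype.card ι := by
  rw [← sum_blockDim (π := π), ← Finset.prod_pow_eq_pow_sum]
  exact Finset.prod_le_prod (fun v _ ↦ pow_nonneg (blockNorm_nonneg v y) _)
    fun v _ ↦ pow_le_pow_left₀ (blockNorm_nonneg v y) (blockNorm_le_norm v y) _

lemma continuous_blockNorm (v : V) : Continuous (blockNorm π v) := by
  unfold blockNorm
  fun_prop

lemma continuous_blockProd : Continuous (blockProd π) :=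
  continuous_finsetProd _ fun v _ ↦ (continuous_blockNorm v).pow _

lemma blockNorm_pos (hπ : Function.Surjective π) {y : EuclideanSpace ℝ ι} (hy : blockProd π y ≠ 0)
    (v : V) : 0 < blockNorm π v y := by
  refine lt_of_le_of_ne (blockNorm_nonneg v y) fun h ↦ hy ?_
  exact Finset.prod_eq_zero (Finset.mem_univ v) (by rw [← h, zero_pow (blockDim_pos hπ v).ne'])

lemma log_blockProd (hπ : Function.Surjective π) {y : EuclideanSpace ℝ ι}
    (hy : blockProd π y ≠ 0) :
    Real.log (blockProd π y) = ∑ v, blockDim π v * Real.log (blockNorm π v y) := by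
  rw [blockProd, Real.log_prod fun v _ ↦ pow_ne_zero _ (blockNorm_pos hπ hy v).ne']
  simp

variable (π) in
/-- Blockwise dilation by `exp (x v)`. -/
noncomputable def blockScale (x : V → ℝ) : EuclideanSpace ℝ ι ≃L[ℝ] EuclideanSpace ℝ ι :=
  LinearEquiv.toContinuousLinearEquiv
    { toFun := fun y ↦ WithLp.toLp 2 fun i ↦ Real.exp (x (π i)) * y i
      invFun := fun y ↦ WithLp.toLp 2 fun i ↦ Real.exp (-x (π i)) * y i
      map_add' := fun y y' ↦ by ext i; simp [mul_add]
      map_smul' := fun a y ↦ by ext i; simp; ring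
      left_inv := fun y ↦ by ext i; simp [← mul_assoc, ← Real.exp_add]
      right_inv := fun y ↦ by ext i; simp [← mul_assoc, ← Real.exp_add] }

@[simp] lemma blockScale_apply (x : V → ℝ) (y : EuclideanSpace ℝ ι) (i : ι) :
    blockScale π x y i = Real.exp (x (π i)) * y i := rfl

lemma inner_blockScale (x : V → ℝ) (y y' : EuclideanSpace ℝ ι) :
    ⟪blockScale π (-x) y, blockScale π x y'⟫ = ⟪y, y'⟫ := by
  simp only [PiLp.inner_apply, blockScale_apply, RCLike.inner_apply, conj_trivial]
  refine Finset.sum_congr rfl fun i _ ↦ ?_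
  rw [show ∀ a b c d : ℝ, a * b * (c * d) = (a * c) * (b * d) by intros; ring, ← Real.exp_add]
  simp

lemma blockNorm_blockScale (x : V → ℝ) (v : V) (y : EuclideanSpace ℝ ι) :
    blockNorm π v (blockScale π x y) = Real.exp (x v) * blockNorm π v y := by
  rw [blockNorm, blockNorm, ← Real.sqrt_sq (Real.exp_pos (x v)).le,
    ← Real.sqrt_mul (sq_nonneg _), Finset.mul_sum]
  congr 1
  refine Finset.sum_congr rfl fun i hi ↦ ?_
  rw [blockScale_apply, (Finset.mem_filter.mp hi).2, mul_pow]

lemma blockProd_blockScale (x : V → ℝ) (y : EuclideanSpace ℝ ι) :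
    blockProd π (blockScale π x y) =
      Real.exp (∑ v, blockDim π v * x v) * blockProd π y := by
  simp_rw [blockProd, blockNorm_blockScale, mul_pow, Finset.prod_mul_distrib, Real.exp_sum,
    ← Real.exp_nat_mul]

lemma det_blockScale (x : V → ℝ) :
    LinearMap.det (blockScale π x : EuclideanSpace ℝ ι →ₗ[ℝ] EuclideanSpace ℝ ι) =
      Real.exp (∑ v, blockDim π v * x v) := by
  classical
  rw [← LinearMap.det_toMatrix (EuclideanSpace.basisFun ι ℝ).toBasis]
  have : LinearMap.toMatrix (EuclideanSpace.basisFun ι ℝ).toBasis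
      (EuclideanSpace.basisFun ι ℝ).toBasis
      (blockScale π x : EuclideanSpace ℝ ι →ₗ[ℝ] EuclideanSpace ℝ ι) =
      Matrix.diagonal fun i ↦ Real.exp (x (π i)) := by
    ext i j
    rw [LinearMap.toMatrix_apply]
    rcases eq_or_ne i j with rfl | h
    · simp
    · simp [h]
  rw [this, Matrix.det_diagonal, sum_blockDim_mul, Real.exp_sum]

lemma le_norm_blockScale (x : V → ℝ) {R : ℝ} (hx : ∀ v, R ≤ x v) (y : EuclideanSpace ℝ ι) :
    Real.exp R * ‖y‖ ≤ ‖blockScale π x y‖ := by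
  refine le_of_sq_le_sq ?_ (by positivity)
  rw [mul_pow, ← sum_blockNorm_sq (π := π) y, ← sum_blockNorm_sq (π := π) (blockScale π x y),
    Finset.mul_sum]
  refine Finset.sum_le_sum fun v _ ↦ ?_
  rw [blockNorm_blockScale, mul_pow]
  have := hx v
  gcongr

/-- Vectors with the same block norms are related by an isometry preserving all block norms. -/
lemma exists_isometry_of_blockNorm_eq {y y' : EuclideanSpace ℝ ι}
    (h : ∀ v, blockNorm π v y = blockNorm π v y') :
    ∃ R : EuclideanSpace ℝ ι ≃ₗᵢ[ℝ] EuclideanSpace ℝ ι,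
      (∀ v x, blockNorm π v (R x) = blockNorm π v x) ∧ R y = y' := by
  let b : V → EuclideanSpace ℝ ι → EuclideanSpace ℝ ι :=
    fun v x ↦ WithLp.toLp 2 fun i ↦ if π i = v then x i else 0
  have hb : ∀ v x, ‖b v x‖ = blockNorm π v x := fun v x ↦ by
    rw [EuclideanSpace.norm_eq, blockNorm, Finset.sum_filter]
    congr 1
    refine Finset.sum_congr rfl fun i _ ↦ ?_
    by_cases hi : π i = v <;> simp [b, hi]
  let ρ : V → EuclideanSpace ℝ ι ≃ₗᵢ[ℝ] EuclideanSpace ℝ ι :=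
    fun v ↦ (Submodule.span ℝ {b v y - b v y'})ᗮ.reflection
  have hρ : ∀ v x, ρ v x = x - (2 * (⟪b v y - b v y', x⟫ / ‖b v y - b v y'‖ ^ 2)) •
      (b v y - b v y') := fun v x ↦ by
    simp only [ρ, Submodule.reflection_orthogonal_apply, Submodule.reflection_singleton_apply]
    simp only [RCLike.ofReal_real_eq_id, id_eq]
    rw [neg_sub, two_smul, ← add_smul, two_mul]
  have hρ1 : ∀ v x i, π i ≠ v → ρ v x i = x i := fun v x i hi ↦ by
    rw [hρ]
    simp [b, hi]
  have hρ2 : ∀ v, ρ v (b v y) = b v y' := fun v ↦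
    Submodule.reflection_sub (by rw [hb, hb, h])
  have hρ3 : ∀ v x w, blockNorm π w (ρ v x) = blockNorm π w x := fun v x w ↦ by
    have hne : ∀ w ≠ v, blockNorm π w (ρ v x) = blockNorm π w x := fun w hw ↦ by
      rw [blockNorm, blockNorm]
      congr 1
      refine Finset.sum_congr rfl fun i hi ↦ ?_
      rw [hρ1 v x i (by rw [(Finset.mem_filter.mp hi).2]; exact hw)]
    by_cases hw : w = v
    · subst hw
      have h1 : ∑ v, blockNorm π v (ρ w x) ^ 2 = ∑ v, blockNorm π v x ^ 2 := by
        rw [sum_blockNorm_sq, sum_blockNorm_sq, LinearIsometryEquiv.norm_map]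
      rw [← Finset.add_sum_erase _ _ (Finset.mem_univ w),
        ← Finset.add_sum_erase _ _ (Finset.mem_univ w),
        Finset.sum_congr rfl fun u hu ↦ by rw [hne u (Finset.ne_of_mem_erase hu)]] at h1
      exact (pow_left_inj₀ (blockNorm_nonneg _ _) (blockNorm_nonneg _ _) two_ne_zero).mp
        (by linarith)
    · exact hne w hw
  have hρ4 : ∀ v x i, (∀ j, π j = v → x j = y j) → π i = v → ρ v x i = y' i := by
    intro v x i hx hi
    have hxb : b v x = b v y := by
      ext j
      by_cases hj : π j = v
      · simp [b, hj, hx j hj]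
      · simp [b, hj]
    have h1 : ρ v x = ρ v (b v x) + ρ v (x - b v x) := by
      rw [← map_add]
      congr 1
      abel
    have h2 : ⟪b v y - b v y', x - b v x⟫ = 0 := by
      rw [PiLp.inner_apply]
      refine Finset.sum_eq_zero fun j _ ↦ ?_
      by_cases hj : π j = v <;> simp [b, hj]
    rw [h1, hρ v (x - b v x), h2, hxb, hρ2]
    simp [b, hi, hx i hi]
  have key : ∀ s : Finset V, ∃ R : EuclideanSpace ℝ ι ≃ₗᵢ[ℝ] EuclideanSpace ℝ ι,
      (∀ v x, blockNorm π v (R x) = blockNorm π v x) ∧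
      ∀ i, R y i = if π i ∈ s then y' i else y i := by
    intro s
    induction s using Finset.induction_on with
    | empty => exact ⟨LinearIsometryEquiv.refl ℝ _, fun _ _ ↦ rfl, fun i ↦ by simp⟩
    | insert v s hv ih =>
      obtain ⟨R, hR, hRy⟩ := ih
      refine ⟨R.trans (ρ v), fun w x ↦ by simp [hρ3, hR], fun i ↦ ?_⟩
      rw [LinearIsometryEquiv.trans_apply]
      by_cases hi : π i = v
      · rw [hρ4 v (R y) i (fun j hj ↦ by rw [hRy, hj, if_neg hv]) hi]
        simp [hi]
      · rw [hρ1 v _ i hi, hRy]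
        simp [hi]
  obtain ⟨R, hR, hRy⟩ := key Finset.univ
  refine ⟨R, hR, ?_⟩
  ext i
  simp [hRy]

end Blocks

section PolarCoordinates

open scoped ENNReal NNReal

variable {ι V : Type*} [Fintype ι] [Fintype V] [DecidableEq V] (π : ι → V) (v₀ : V)

/-- The logarithmic block sizes attached to logarithmic polar coordinates. -/
noncomputable def polarExp (p : ({v : V // v ≠ v₀} → ℝ) × ℝ) (v : V) : ℝ :=
  if h : v ≠ v₀ then p.1 ⟨v, h⟩ / blockDim π v + p.2 / Fintype.card ι
  else p.2 / Fintype.card ι - (∑ w, p.1 w) / blockDim π v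

/-- Logarithmic polar coordinates. -/
noncomputable def polarLog (y : EuclideanSpace ℝ ι) : ({v : V // v ≠ v₀} → ℝ) × ℝ :=
  (fun w ↦ blockDim π w *
    (Real.log (blockNorm π w y) - Real.log (blockProd π y) / Fintype.card ι),
    Real.log (blockProd π y))

variable {π v₀}

lemma polarExp_add (p q : ({v : V // v ≠ v₀} → ℝ) × ℝ) :
    polarExp π v₀ (p + q) = polarExp π v₀ p + polarExp π v₀ q := by
  ext v
  by_cases h : v ≠ v₀
  · simp [polarExp, h]; ring
  · simp [polarExp, h, Finset.sum_add_distrib]; ring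

lemma polarExp_neg (p : ({v : V // v ≠ v₀} → ℝ) × ℝ) :
    polarExp π v₀ (-p) = -polarExp π v₀ p := by
  ext v
  by_cases h : v ≠ v₀
  · simp [polarExp, h]; ring
  · simp [polarExp, h]; ring

lemma continuous_polarExp (v : V) :
    Continuous fun p : ({v : V // v ≠ v₀} → ℝ) × ℝ ↦ polarExp π v₀ p v := by
  by_cases h : v ≠ v₀
  · simp only [polarExp, h, ne_eq, not_false_eq_true, dite_true]
    fun_prop
  · simp only [polarExp, h, dite_false]
    fun_prop

lemma card_pos_of_surjective (hπ : Function.Surjective π) (v : V) : 0 < Fintype.card ι :=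
  Fintype.card_pos_iff.mpr ⟨(hπ v).choose⟩

lemma sum_eq_add_sum_subtype_ne (f : V → ℝ) :
    ∑ v, f v = f v₀ + ∑ w : {v : V // v ≠ v₀}, f w := by
  rw [← Finset.add_sum_erase _ _ (Finset.mem_univ v₀)]
  congr 1
  exact (Finset.sum_subtype _ (fun v ↦ by simp) f)

lemma sum_blockDim_mul_polarExp (hπ : Function.Surjective π)
    (p : ({v : V // v ≠ v₀} → ℝ) × ℝ) :
    ∑ v, blockDim π v * polarExp π v₀ p v = p.2 := by
  have hd : ∀ v, (blockDim π v : ℝ) ≠ 0 := fun v ↦ by exact_mod_cast (blockDim_pos hπ v).ne'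
  have hn : (Fintype.card ι : ℝ) ≠ 0 := by exact_mod_cast (card_pos_of_surjective hπ v₀).ne'
  have h1 : ∀ v, blockDim π v * polarExp π v₀ p v = blockDim π v * (p.2 / Fintype.card ι) +
      if h : v ≠ v₀ then p.1 ⟨v, h⟩ else - ∑ w, p.1 w := fun v ↦ by
    have := hd v
    by_cases h : v ≠ v₀
    · simp only [polarExp, h, ne_eq, not_false_eq_true, dite_true]
      field_simp
      ring
    · simp only [polarExp, h, dite_false]
      field_simp
      ring
  simp_rw [h1]
  rw [Finset.sum_add_distrib, ← Finset.sum_mul, sum_eq_add_sum_subtype_ne (v₀ := v₀) fun v ↦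
    if h : v ≠ v₀ then p.1 ⟨v, h⟩ else - ∑ w, p.1 w]
  have h2 : ∑ w : {v : V // v ≠ v₀}, (if h : (w : V) ≠ v₀ then p.1 ⟨w, h⟩ else - ∑ w, p.1 w) =
      ∑ w, p.1 w := Finset.sum_congr rfl fun w _ ↦ by simp [w.2]
  rw [h2]
  have h3 : ∑ v, (blockDim π v : ℝ) = Fintype.card ι := by exact_mod_cast sum_blockDim (π := π)
  rw [h3]
  simp
  field_simp

lemma abs_polarExp_le (hπ : Function.Surjective π) (p : ({v : V // v ≠ v₀} → ℝ) × ℝ) (v : V) :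
    |polarExp π v₀ p v| ≤ (Fintype.card V + 1) * ‖p‖ := by
  have hd : (1 : ℝ) ≤ blockDim π v := by exact_mod_cast blockDim_pos hπ v
  have hn : (1 : ℝ) ≤ Fintype.card ι := by exact_mod_cast card_pos_of_surjective hπ v₀
  have hV : (1 : ℝ) ≤ Fintype.card V := by
    exact_mod_cast Fintype.card_pos_iff.mpr ⟨v₀⟩
  have h1 : ∀ w, |p.1 w| ≤ ‖p‖ := fun w ↦ (norm_le_pi_norm p.1 w).trans (norm_fst_le p)
  have h2 : |p.2 / Fintype.card ι| ≤ ‖p‖ := by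
    rw [abs_div, abs_of_nonneg (a := (Fintype.card ι : ℝ)) (by positivity)]
    exact (div_le_self (abs_nonneg _) hn).trans (norm_snd_le p)
  have h0 := norm_nonneg p
  by_cases h : v ≠ v₀
  · simp only [polarExp, h, ne_eq, not_false_eq_true, dite_true]
    have h3 : |p.1 ⟨v, h⟩ / blockDim π v| ≤ ‖p‖ := by
      rw [abs_div, abs_of_nonneg (a := (blockDim π v : ℝ)) (by positivity)]
      exact (div_le_self (abs_nonneg _) hd).trans (h1 _)
    refine (abs_add_le _ _).trans ?_
    nlinarith
  · simp only [polarExp, h, dite_false]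
    have h3 : |(∑ w, p.1 w) / blockDim π v| ≤ Fintype.card V * ‖p‖ := by
      rw [abs_div, abs_of_nonneg (a := (blockDim π v : ℝ)) (by positivity)]
      refine (div_le_self (abs_nonneg _) hd).trans ((Finset.abs_sum_le_sum_abs _ _).trans ?_)
      refine (Finset.sum_le_card_nsmul _ _ _ fun w _ ↦ h1 w).trans ?_
      rw [nsmul_eq_mul, Finset.card_univ]
      gcongr
      exact Fintype.card_subtype_le _
    refine (abs_sub _ _).trans ?_
    linarith

lemma polarLog_blockScale (hπ : Function.Surjective π) (p : ({v : V // v ≠ v₀} → ℝ) × ℝ)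
    {y : EuclideanSpace ℝ ι} (hy : blockProd π y ≠ 0) :
    polarLog π v₀ (blockScale π (polarExp π v₀ p) y) = polarLog π v₀ y + p := by
  have hN : Real.log (blockProd π (blockScale π (polarExp π v₀ p) y)) =
      Real.log (blockProd π y) + p.2 := by
    rw [blockProd_blockScale, sum_blockDim_mul_polarExp hπ,
      Real.log_mul (Real.exp_pos _).ne' hy, Real.log_exp, add_comm]
  have hd : ∀ v, (blockDim π v : ℝ) ≠ 0 := fun v ↦ by exact_mod_cast (blockDim_pos hπ v).ne'
  ext w
  · simp only [polarLog, hN, Prod.fst_add, Pi.add_apply]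
    rw [blockNorm_blockScale, Real.log_mul (Real.exp_pos _).ne' (blockNorm_pos hπ hy _).ne',
      Real.log_exp]
    have := hd w
    simp only [polarExp, w.2, ne_eq, not_false_eq_true, dite_true]
    field_simp
    ring
  · simp only [polarLog, hN, Prod.snd_add]

lemma polarExp_polarLog (hπ : Function.Surjective π) {y : EuclideanSpace ℝ ι}
    (hy : blockProd π y ≠ 0) (v : V) :
    polarExp π v₀ (polarLog π v₀ y) v = Real.log (blockNorm π v y) := by
  have hd : ∀ v, (blockDim π v : ℝ) ≠ 0 := fun v ↦ by exact_mod_cast (blockDim_pos hπ v).ne'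
  have hn : (Fintype.card ι : ℝ) ≠ 0 := by exact_mod_cast (card_pos_of_surjective hπ v₀).ne'
  by_cases h : v ≠ v₀
  · simp only [polarExp, polarLog, h, ne_eq, not_false_eq_true, dite_true]
    have := hd v
    field_simp
    ring
  · push Not at h
    subst h
    have h1 := sum_blockDim_mul_polarExp hπ (polarLog π v y)
    rw [show (polarLog π v y).2 = Real.log (blockProd π y) from rfl, log_blockProd hπ hy,
      sum_eq_add_sum_subtype_ne (v₀ := v),
      sum_eq_add_sum_subtype_ne (v₀ := v) fun u ↦ blockDim π u * Real.log (blockNorm π u y)] at h1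
    have h2 : ∀ w : {u : V // u ≠ v}, blockDim π w * polarExp π v (polarLog π v y) w =
        blockDim π w * Real.log (blockNorm π w y) := fun w ↦ by
      simp only [polarExp, polarLog, w.2, ne_eq, not_false_eq_true, dite_true]
      have := hd w
      field_simp
      ring
    rw [Finset.sum_congr rfl fun w _ ↦ h2 w] at h1
    exact mul_left_cancel₀ (hd v) (add_right_cancel h1)

lemma blockNorm_eq_exp_polarExp (hπ : Function.Surjective π) {y : EuclideanSpace ℝ ι}
    (hy : blockProd π y ≠ 0) (v : V) :
    blockNorm π v y = Real.exp (polarExp π v₀ (polarLog π v₀ y) v) := by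
  rw [polarExp_polarLog hπ hy, Real.exp_log (blockNorm_pos hπ hy v)]

lemma blockNorm_blockScale_polarLog_sub (hπ : Function.Surjective π) {y ξ : EuclideanSpace ℝ ι}
    (hy : blockProd π y ≠ 0) (hξ : blockProd π ξ ≠ 0) (v : V) :
    blockNorm π v (blockScale π (polarExp π v₀ (polarLog π v₀ y - polarLog π v₀ ξ)) ξ) =
      blockNorm π v y := by
  rw [blockNorm_blockScale, sub_eq_add_neg, polarExp_add, polarExp_neg, Pi.add_apply, Pi.neg_apply,
    Real.exp_add, Real.exp_neg, ← blockNorm_eq_exp_polarExp hπ hy,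
    ← blockNorm_eq_exp_polarExp hπ hξ]
  have := (blockNorm_pos hπ hξ v).ne'
  field_simp

lemma measurable_polarLog : Measurable (polarLog π v₀) := by
  have h1 : Measurable (blockProd π) := continuous_blockProd.measurable
  have h2 : ∀ v, Measurable (blockNorm π v) := fun v ↦ (continuous_blockNorm v).measurable
  unfold polarLog
  refine Measurable.prodMk (measurable_pi_lambda _ fun w ↦ ?_) (Real.measurable_log.comp h1)
  exact measurable_const.mul (((Real.measurable_log.comp (h2 _))).sub
    ((Real.measurable_log.comp h1).div_const _))

variable (π) in
/-- The scale-invariant measure. -/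
noncomputable def scaleMeasure : Measure (EuclideanSpace ℝ ι) :=
  volume.withDensity fun y ↦ ENNReal.ofReal (blockProd π y)⁻¹

lemma measurable_inv_blockProd :
    Measurable fun y : EuclideanSpace ℝ ι ↦ ENNReal.ofReal (blockProd π y)⁻¹ :=
  (continuous_blockProd.measurable.inv).ennreal_ofReal

lemma scaleMeasure_ae_ne_zero : ∀ᵐ y ∂scaleMeasure π, blockProd π y ≠ 0 := by
  rw [scaleMeasure, ae_withDensity_iff measurable_inv_blockProd]
  refine Eventually.of_forall fun y hy h ↦ hy ?_
  simp [h]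

lemma map_blockScale_scaleMeasure (x : V → ℝ) :
    Measure.map (blockScale π x) (scaleMeasure π) = scaleMeasure π := by
  have hm : Measurable (blockScale π x) := (blockScale π x).continuous.measurable
  have hdet : LinearMap.det
      (blockScale π x : EuclideanSpace ℝ ι →ₗ[ℝ] EuclideanSpace ℝ ι) ≠ 0 := by
    rw [det_blockScale]; exact (Real.exp_pos _).ne'
  have hmap : Measure.map (blockScale π x) (volume : Measure (EuclideanSpace ℝ ι)) =
      ENNReal.ofReal |(LinearMap.det
        (blockScale π x : EuclideanSpace ℝ ι →ₗ[ℝ] EuclideanSpace ℝ ι))⁻¹| • volume :=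
    Measure.map_linearMap_addHaar_eq_smul_addHaar volume hdet
  ext s hs
  have hmi := measurable_inv_blockProd (π := π)
  rw [Measure.map_apply hm hs, scaleMeasure, withDensity_apply _ (hm hs), withDensity_apply _ hs,
    ← lintegral_indicator (hm hs), ← lintegral_indicator hs]
  set S := ∑ v, blockDim π v * x v
  set H : EuclideanSpace ℝ ι → ℝ≥0∞ := s.indicator fun y ↦ ENNReal.ofReal (blockProd π y)⁻¹
    with hH
  have hHm : Measurable H := hmi.indicator hs
  have h1 : ∀ y, ((blockScale π x) ⁻¹' s).indicator
      (fun y ↦ ENNReal.ofReal (blockProd π y)⁻¹) y =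
      ENNReal.ofReal (Real.exp S) * H (blockScale π x y) := fun y ↦ by
    by_cases hy : blockScale π x y ∈ s
    · rw [indicator_of_mem (by exact hy), hH, indicator_of_mem hy,
        ← ENNReal.ofReal_mul (Real.exp_pos _).le, blockProd_blockScale, mul_inv, ← mul_assoc,
        mul_inv_cancel₀ (Real.exp_pos _).ne', one_mul]
    · rw [indicator_of_notMem (by exact hy), hH, indicator_of_notMem hy, mul_zero]
  simp_rw [h1]
  rw [lintegral_const_mul _
      (show Measurable fun y ↦ H (blockScale π x y) from hHm.comp hm), ← lintegral_map hHm hm, hmap, lintegral_smul_measure,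
    det_blockScale, smul_eq_mul, ← mul_assoc, ← ENNReal.ofReal_mul (Real.exp_pos _).le,
    abs_of_nonneg (inv_nonneg.mpr (Real.exp_pos _).le), mul_inv_cancel₀ (Real.exp_pos _).ne']
  simp

lemma map_polarLog_invariant (hπ : Function.Surjective π) :
    (Measure.map (polarLog π v₀) (scaleMeasure π)).IsAddLeftInvariant := by
  refine ⟨fun p ↦ ?_⟩
  have hm : Measurable (blockScale π (polarExp π v₀ p)) :=
    (blockScale π (polarExp π v₀ p)).continuous.measurable
  rw [Measure.map_map (measurable_const_add p) measurable_polarLog]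
  nth_rw 2 [← map_blockScale_scaleMeasure (polarExp π v₀ p)]
  rw [Measure.map_map measurable_polarLog hm]
  refine Measure.map_congr ?_
  filter_upwards [scaleMeasure_ae_ne_zero] with y hy
  simp only [Function.comp_apply]
  rw [polarLog_blockScale hπ p hy, add_comm]

lemma norm_le_of_norm_polarLog_le (hπ : Function.Surjective π) {y : EuclideanSpace ℝ ι}
    (hy : blockProd π y ≠ 0) {R : ℝ} (h : ‖polarLog π v₀ y‖ ≤ R) :
    ‖y‖ ≤ Fintype.card V * Real.exp ((Fintype.card V + 1) * R) := by
  refine (norm_le_sum_blockNorm (π := π) y).trans ?_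
  have h1 := Finset.sum_le_card_nsmul Finset.univ (fun v ↦ blockNorm π v y)
    (Real.exp ((Fintype.card V + 1) * R)) fun v _ ↦ ?_
  · rwa [nsmul_eq_mul, Finset.card_univ] at h1
  rw [blockNorm_eq_exp_polarExp (v₀ := v₀) hπ hy]
  refine Real.exp_le_exp.mpr ((le_abs_self _).trans ((abs_polarExp_le hπ _ v).trans ?_))
  gcongr

lemma map_polarLog_finite (hπ : Function.Surjective π) :
    IsFiniteMeasureOnCompacts (Measure.map (polarLog π v₀) (scaleMeasure π)) := by
  refine ⟨fun K hK ↦ ?_⟩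
  obtain ⟨R, hR⟩ := hK.isBounded.subset_closedBall 0
  set r := (Fintype.card V : ℝ) * Real.exp ((Fintype.card V + 1) * R)
  have hKm := hK.measurableSet
  rw [Measure.map_apply measurable_polarLog hKm, scaleMeasure,
    withDensity_apply _ (measurable_polarLog hKm)]
  have hle : ∫⁻ y in polarLog π v₀ ⁻¹' K, ENNReal.ofReal (blockProd π y)⁻¹ ≤
      ∫⁻ _y in Metric.closedBall (0 : EuclideanSpace ℝ ι) r, ENNReal.ofReal (Real.exp R) := by
    rw [← lintegral_indicator (measurable_polarLog hKm),
      ← lintegral_indicator Metric.isClosed_closedBall.measurableSet]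
    refine lintegral_mono fun y ↦ ?_
    by_cases hy0 : blockProd π y = 0
    · refine le_trans (le_of_eq ?_) zero_le
      rw [indicator_apply_eq_zero]
      simp [hy0]
    by_cases hyK : y ∈ polarLog π v₀ ⁻¹' K
    · have h1 : ‖polarLog π v₀ y‖ ≤ R := mem_closedBall_zero_iff.mp (hR hyK)
      have h2 : y ∈ Metric.closedBall 0 r :=
        mem_closedBall_zero_iff.mpr (norm_le_of_norm_polarLog_le hπ hy0 h1)
      rw [indicator_of_mem hyK, indicator_of_mem h2]
      refine ENNReal.ofReal_le_ofReal ?_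
      have hpos := lt_of_le_of_ne (blockProd_nonneg y) (Ne.symm hy0)
      rw [← Real.exp_log hpos, ← Real.exp_neg]
      refine Real.exp_le_exp.mpr ?_
      have h3 : ‖(polarLog π v₀ y).2‖ ≤ R := (norm_snd_le _).trans h1
      rw [Real.norm_eq_abs] at h3
      exact (neg_le_abs _).trans h3
    · rw [indicator_of_notMem hyK]
      exact zero_le
  refine lt_of_le_of_lt hle ?_
  rw [lintegral_const, Measure.restrict_apply MeasurableSet.univ, univ_inter]
  exact ENNReal.mul_lt_top ENNReal.ofReal_lt_top
    (isCompact_closedBall _ _).measure_lt_top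

lemma scaleMeasure_ne_zero : scaleMeasure π ≠ 0 := by
  intro h
  have h1 : blockProd π (WithLp.toLp 2 fun _ ↦ 1 : EuclideanSpace ℝ ι) ≠ 0 := by
    refine Finset.prod_ne_zero_iff.mpr fun v _ ↦ ?_
    by_cases hv : blockDim π v = 0
    · simp [hv]
    · refine pow_ne_zero _ ?_
      rw [blockNorm]
      simp only [one_pow, Finset.sum_const, nsmul_eq_mul, mul_one]
      exact (Real.sqrt_pos.mpr (by exact_mod_cast Nat.pos_of_ne_zero hv)).ne'
  have hU : IsOpen {y : EuclideanSpace ℝ ι | blockProd π y ≠ 0} :=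
    isOpen_ne_fun continuous_blockProd continuous_const
  have h2 := (withDensity_eq_zero measurable_inv_blockProd.aemeasurable h)
  have h3 : volume {y : EuclideanSpace ℝ ι | blockProd π y ≠ 0} = 0 := by
    refine measure_mono_null (fun y hy ↦ ?_) (ae_iff.mp h2)
    have : 0 < blockProd π y := lt_of_le_of_ne (blockProd_nonneg y) (Ne.symm hy)
    simpa using this
  exact (hU.measure_pos volume ⟨_, h1⟩).ne' h3

/-- Integration in logarithmic polar coordinates. -/
theorem exists_map_polarLog_eq (hπ : Function.Surjective π) (v₀ : V) :
    ∃ c : ℝ≥0, c ≠ 0 ∧ Measure.map (polarLog π v₀) (scaleMeasure π) = c • volume := by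
  have h1 := map_polarLog_invariant (v₀ := v₀) hπ
  have h2 := map_polarLog_finite (v₀ := v₀) hπ
  have h3 : (volume : Measure (({v : V // v ≠ v₀} → ℝ) × ℝ)).IsAddHaarMeasure :=
    inferInstanceAs ((volume : Measure ({v : V // v ≠ v₀} → ℝ)).prod
      (volume : Measure ℝ)).IsAddHaarMeasure
  have h4 := Measure.isAddLeftInvariant_eq_smul
    (Measure.map (polarLog π v₀) (scaleMeasure π)) volume
  refine ⟨_, fun h0 ↦ ?_, h4⟩
  rw [h0, zero_smul] at h4
  exact scaleMeasure_ne_zero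
    ((Measure.map_eq_zero_iff measurable_polarLog.aemeasurable).mp h4)

end PolarCoordinates

section Energy

open scoped ENNReal FourierTransform SchwartzMap LineDeriv

variable {ι : Type*} [Fintype ι] [DecidableEq ι]

lemma norm_fourier_iteratedLineDeriv (F : 𝓢(EuclideanSpace ℝ ι, ℂ)) (i : ι) (j : ℕ)
    (η : EuclideanSpace ℝ ι) :
    ‖𝓕 (∂^{fun _ : Fin j ↦ EuclideanSpace.single i (1 : ℝ)} F) η‖ =
      (2 * Real.pi * |η i|) ^ j * ‖𝓕 F η‖ := by
  induction j with
  | zero => simp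
  | succ j ih =>
    rw [LineDeriv.iteratedLineDerivOp_succ_left, SchwartzMap.fourier_lineDerivOp_eq]
    have hg : (inner ℝ · (EuclideanSpace.single i (1 : ℝ)) :
        EuclideanSpace ℝ ι → ℝ).HasTemperateGrowth := by fun_prop
    rw [smul_apply, SchwartzMap.smulLeftCLM_apply_apply hg, norm_smul, norm_smul]
    have ht : (Fin.tail fun _ : Fin (j + 1) ↦ EuclideanSpace.single i (1 : ℝ)) =
      fun _ ↦ EuclideanSpace.single i (1 : ℝ) := rfl
    rw [ht, ih, EuclideanSpace.inner_single_right]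
    simp [abs_of_pos Real.pi_pos]
    ring

lemma enorm_iteratedLineDeriv_le (F : 𝓢(EuclideanSpace ℝ ι, ℂ)) (i : ι) (j : ℕ)
    (x : EuclideanSpace ℝ ι) :
    ‖(∂^{fun _ : Fin j ↦ EuclideanSpace.single i (1 : ℝ)} F) x‖ₑ ≤ ‖iteratedFDeriv ℝ j F x‖ₑ := by
  rw [SchwartzMap.iteratedLineDerivOp_eq_iteratedFDeriv, ← ofReal_norm, ← ofReal_norm]
  refine ENNReal.ofReal_le_ofReal ?_
  simpa using (iteratedFDeriv ℝ j F x).le_opNorm fun _ : Fin j ↦ EuclideanSpace.single i (1 : ℝ)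

lemma SchwartzMap.lintegral_enorm_sq_fourier (F : 𝓢(EuclideanSpace ℝ ι, ℂ)) :
    ∫⁻ η, ‖𝓕 F η‖ₑ ^ 2 = ∫⁻ x, ‖F x‖ₑ ^ 2 := by
  have h : ∀ G : 𝓢(EuclideanSpace ℝ ι, ℂ),
      ∫⁻ x, ‖G x‖ₑ ^ 2 = ENNReal.ofReal (∫ x, ‖G x‖ ^ 2) := fun G ↦ by
    rw [ofReal_integral_eq_lintegral_ofReal ((G.memLp 2 volume).integrable_norm_pow two_ne_zero)
      (Eventually.of_forall fun _ ↦ by positivity)]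
    refine lintegral_congr fun x ↦ ?_
    rw [ENNReal.ofReal_pow (norm_nonneg _), ofReal_norm]
  rw [h, h, SchwartzMap.integral_norm_sq_fourier]

lemma norm_pow_le_sum_abs_pow (η : EuclideanSpace ℝ ι) (j : ℕ) :
    ‖η‖ ^ (2 * (j + 1)) ≤ Fintype.card ι ^ j * ∑ i, |η i| ^ (2 * (j + 1)) := by
  rcases isEmpty_or_nonempty ι with h | h
  · rw [Subsingleton.elim η 0]; simp
  have h1 := pow_sum_div_card_le_sum_pow (s := Finset.univ) (f := fun i ↦ η i ^ 2) (n := j)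
    fun i _ ↦ sq_nonneg _
  rw [div_le_iff₀ (by simp [Finset.card_univ, Fintype.card_pos]), ← EuclideanSpace.real_norm_sq_eq,
    Finset.card_univ] at h1
  rw [pow_mul, mul_comm (_ ^ j : ℝ)]
  simpa [pow_mul, sq_abs] using h1

theorem SchwartzMap.lintegral_fourier_mul_norm_pow_le (F : 𝓢(EuclideanSpace ℝ ι, ℂ)) (j : ℕ) :
    ∫⁻ η, ‖𝓕 F η‖ₑ ^ 2 * ‖η‖ₑ ^ (2 * (j + 1)) ≤
      Fintype.card ι ^ (j + 1) * ∫⁻ x, ‖iteratedFDeriv ℝ (j + 1) F x‖ₑ ^ 2 := by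
  set n := Fintype.card ι
  have h1 : ∀ η, ‖𝓕 F η‖ₑ ^ 2 * ‖η‖ₑ ^ (2 * (j + 1)) ≤
      n ^ j * ∑ i : ι, ‖𝓕 (∂^{fun _ : Fin (j + 1) ↦ EuclideanSpace.single i (1 : ℝ)} F) η‖ₑ ^ 2 :=
    fun η ↦ by
    have h2 : ‖𝓕 F η‖ ^ 2 * ‖η‖ ^ (2 * (j + 1)) ≤ n ^ j * ∑ i : ι,
        ‖𝓕 (∂^{fun _ : Fin (j + 1) ↦ EuclideanSpace.single i (1 : ℝ)} F) η‖ ^ 2 := by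
      calc ‖𝓕 F η‖ ^ 2 * ‖η‖ ^ (2 * (j + 1))
          ≤ ‖𝓕 F η‖ ^ 2 * (n ^ j * ∑ i, |η i| ^ (2 * (j + 1))) := by
            gcongr; exact norm_pow_le_sum_abs_pow η j
        _ = n ^ j * ∑ i : ι, ‖𝓕 F η‖ ^ 2 * |η i| ^ (2 * (j + 1)) := by
            rw [Finset.mul_sum, Finset.mul_sum, Finset.mul_sum]
            refine Finset.sum_congr rfl fun i _ ↦ by ring
        _ ≤ _ := by
            gcongr with i
            rw [norm_fourier_iteratedLineDeriv, mul_pow, ← pow_mul, mul_comm (j + 1) 2, mul_comm]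
            gcongr
            have := Real.pi_gt_three
            nlinarith [abs_nonneg (η i)]
    have h3 := ENNReal.ofReal_le_ofReal h2
    rw [ENNReal.ofReal_mul (by positivity), ENNReal.ofReal_mul (by positivity),
      ENNReal.ofReal_sum_of_nonneg (fun _ _ ↦ by positivity)] at h3
    simpa only [ENNReal.ofReal_pow (norm_nonneg _), ofReal_norm,
      ENNReal.ofReal_pow (Nat.cast_nonneg n), ENNReal.ofReal_natCast] using h3
  refine (lintegral_mono h1).trans ?_
  have hm : ∀ G : 𝓢(EuclideanSpace ℝ ι, ℂ), Measurable fun x ↦ ‖G x‖ₑ ^ 2 := fun G ↦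
    G.continuous.measurable.enorm.pow_const 2
  rw [lintegral_const_mul _ (Finset.measurable_fun_sum _ fun i _ ↦ hm _),
    lintegral_finsetSum _ (fun i _ ↦ hm _), pow_succ, mul_assoc]
  gcongr
  have h4 : ∀ i ∈ (Finset.univ : Finset ι),
      ∫⁻ η, ‖𝓕 (∂^{fun _ : Fin (j + 1) ↦ EuclideanSpace.single i (1 : ℝ)} F) η‖ₑ ^ 2 ≤
      ∫⁻ x, ‖iteratedFDeriv ℝ (j + 1) F x‖ₑ ^ 2 := fun i _ ↦ by
    rw [SchwartzMap.lintegral_enorm_sq_fourier]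
    exact lintegral_mono fun x ↦ pow_le_pow_left₀ zero_le (enorm_iteratedLineDeriv_le F i _ x) 2
  refine (Finset.sum_le_card_nsmul _ _ _ h4).trans ?_
  simp [n]

end Energy

section PolarFunctions

open scoped ENNReal NNReal ContDiff Nat

variable {ι V : Type*} [Fintype ι] [Fintype V] [DecidableEq V] (π : ι → V) (v₀ : V)

/-- The function with radial profile `f` and angular profile `b`. -/
noncomputable def polarFun (f : ℝ → ℝ) (b : ({v : V // v ≠ v₀} → ℝ) → ℝ)
    (y : EuclideanSpace ℝ ι) : ℝ :=
  f (blockProd π y) * b (polarLog π v₀ y).1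

/-- The shell containing the support of `polarFun`. -/
def polarShell (α β : ℝ) (b : ({v : V // v ≠ v₀} → ℝ) → ℝ) : Set (EuclideanSpace ℝ ι) :=
  {y | blockProd π y ∈ Icc α β ∧ (polarLog π v₀ y).1 ∈ tsupport b}

variable {π v₀}

lemma isOpen_blockProd_ne_zero : IsOpen {y : EuclideanSpace ℝ ι | blockProd π y ≠ 0} :=
  isOpen_ne_fun continuous_blockProd continuous_const

lemma contDiffOn_blockNorm (hπ : Function.Surjective π) (v : V) :
    ContDiffOn ℝ ∞ (blockNorm π v) {y | blockProd π y ≠ 0} := fun y hy ↦ by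
  refine ContDiffAt.contDiffWithinAt ?_
  unfold blockNorm
  refine ContDiffAt.sqrt (by fun_prop) ?_
  rw [← blockNorm_sq]
  exact pow_ne_zero _ (blockNorm_pos hπ hy v).ne'

lemma contDiffOn_blockProd (hπ : Function.Surjective π) :
    ContDiffOn ℝ ∞ (blockProd π) {y | blockProd π y ≠ 0} := by
  unfold blockProd
  exact contDiffOn_prod fun v _ ↦ (contDiffOn_blockNorm hπ v).pow _

lemma contDiffOn_polarLog_fst (hπ : Function.Surjective π) :
    ContDiffOn ℝ ∞ (fun y ↦ (polarLog π v₀ y).1) {y | blockProd π y ≠ 0} := by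
  refine contDiffOn_pi.mpr fun w ↦ ?_
  simp only [polarLog]
  refine contDiffOn_const.mul ((ContDiffOn.log (contDiffOn_blockNorm hπ _) fun y hy ↦
    (blockNorm_pos hπ hy _).ne').sub ((ContDiffOn.log (contDiffOn_blockProd hπ)
      fun _ hy ↦ hy).div_const _))

lemma polarShell_subset {α β : ℝ} (hα : 0 < α) {b : ({v : V // v ≠ v₀} → ℝ) → ℝ} :
    polarShell π v₀ α β b ⊆ {y | blockProd π y ≠ 0} := fun _ hy ↦ (hα.trans_le hy.1.1).ne'

lemma exists_norm_polarLog_le {α β : ℝ} (hα : 0 < α) {b : ({v : V // v ≠ v₀} → ℝ) → ℝ}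
    (hb : HasCompactSupport b) :
    ∃ R, ∀ y ∈ polarShell π v₀ α β b, ‖polarLog π v₀ y‖ ≤ R := by
  obtain ⟨R, hR⟩ := hb.isBounded.subset_closedBall 0
  refine ⟨max R (max |Real.log α| |Real.log β|), fun y hy ↦ ?_⟩
  rw [Prod.norm_def]
  refine max_le_max (mem_closedBall_zero_iff.mp (hR hy.2)) ?_
  exact abs_le_max_abs_abs (Real.log_le_log hα hy.1.1)
    (Real.log_le_log (hα.trans_le hy.1.1) hy.1.2)

lemma isCompact_polarShell (hπ : Function.Surjective π) {α β : ℝ} (hα : 0 < α)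
    {b : ({v : V // v ≠ v₀} → ℝ) → ℝ} (hb : HasCompactSupport b) :
    IsCompact (polarShell π v₀ α β b) := by
  obtain ⟨R, hR⟩ := exists_norm_polarLog_le (π := π) (β := β) hα hb
  refine Metric.isCompact_of_isClosed_isBounded ?_ ?_
  · have h1 : IsClosed (blockProd π ⁻¹' Icc α β) := isClosed_Icc.preimage continuous_blockProd
    have h2 : ContinuousOn (fun y ↦ (polarLog π v₀ y).1) (blockProd π ⁻¹' Icc α β) :=
      (contDiffOn_polarLog_fst hπ).continuousOn.mono fun _ hy ↦ (hα.trans_le hy.1).ne'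
    exact h2.preimage_isClosed_of_isClosed h1 (isClosed_tsupport b)
  · refine (Metric.isBounded_closedBall (x := (0 : EuclideanSpace ℝ ι))
      (r := Fintype.card V * Real.exp ((Fintype.card V + 1) * R))).subset fun y hy ↦ ?_
    exact mem_closedBall_zero_iff.mpr
      (norm_le_of_norm_polarLog_le hπ (polarShell_subset hα hy) (hR y hy))

lemma support_polarFun_subset {α β : ℝ} {f : ℝ → ℝ} (hf : ∀ v, f v ≠ 0 → v ∈ Icc α β)
    (b : ({v : V // v ≠ v₀} → ℝ) → ℝ) :
    Function.support (polarFun π v₀ f b) ⊆ polarShell π v₀ α β b := fun _ hy ↦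
  ⟨hf _ (left_ne_zero_of_mul hy), subset_tsupport _ (right_ne_zero_of_mul hy)⟩

lemma tsupport_polarFun_subset (hπ : Function.Surjective π) {α β : ℝ} (hα : 0 < α) {f : ℝ → ℝ}
    (hf : ∀ v, f v ≠ 0 → v ∈ Icc α β) {b : ({v : V // v ≠ v₀} → ℝ) → ℝ}
    (hb : HasCompactSupport b) :
    tsupport (polarFun π v₀ f b) ⊆ polarShell π v₀ α β b :=
  closure_minimal (support_polarFun_subset hf b) (isCompact_polarShell hπ hα hb).isClosed

lemma hasCompactSupport_polarFun (hπ : Function.Surjective π) {α β : ℝ} (hα : 0 < α) {f : ℝ → ℝ}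
    (hf : ∀ v, f v ≠ 0 → v ∈ Icc α β) {b : ({v : V // v ≠ v₀} → ℝ) → ℝ}
    (hb : HasCompactSupport b) : HasCompactSupport (polarFun π v₀ f b) :=
  (isCompact_polarShell hπ hα hb).of_isClosed_subset (isClosed_tsupport _)
    (tsupport_polarFun_subset hπ hα hf hb)

lemma contDiffOn_polarFun (hπ : Function.Surjective π) {f : ℝ → ℝ} (hfs : ContDiff ℝ ∞ f)
    {b : ({v : V // v ≠ v₀} → ℝ) → ℝ} (hbs : ContDiff ℝ ∞ b) :
    ContDiffOn ℝ ∞ (polarFun π v₀ f b) {y | blockProd π y ≠ 0} :=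
  (hfs.comp_contDiffOn (contDiffOn_blockProd hπ)).mul
    (hbs.comp_contDiffOn (contDiffOn_polarLog_fst hπ))

lemma contDiff_polarFun (hπ : Function.Surjective π) {α β : ℝ} (hα : 0 < α) {f : ℝ → ℝ}
    (hfs : ContDiff ℝ ∞ f) (hf : ∀ v, f v ≠ 0 → v ∈ Icc α β)
    {b : ({v : V // v ≠ v₀} → ℝ) → ℝ} (hbs : ContDiff ℝ ∞ b) (hb : HasCompactSupport b) :
    ContDiff ℝ ∞ (polarFun π v₀ f b) := by
  refine contDiff_iff_contDiffAt.mpr fun y ↦ ?_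
  by_cases hy : blockProd π y = 0
  · have h1 : y ∉ tsupport (polarFun π v₀ f b) := fun h ↦
      polarShell_subset hα (tsupport_polarFun_subset hπ hα hf hb h) hy
    exact contDiffAt_const.congr_of_eventuallyEq (notMem_tsupport_iff_eventuallyEq.mp h1)
  · exact (contDiffOn_polarFun hπ hfs hbs).contDiffAt (isOpen_blockProd_ne_zero.mem_nhds hy)

lemma exists_norm_iteratedFDerivWithin_le {E F : Type*} [NormedAddCommGroup E] [NormedSpace ℝ E]
    [NormedAddCommGroup F] [NormedSpace ℝ F] {g : E → F} {U K : Set E} (hU : IsOpen U)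
    (hK : IsCompact K) (hKU : K ⊆ U) (hg : ContDiffOn ℝ ∞ g U) (j : ℕ) :
    ∃ D, 1 ≤ D ∧ ∀ i ≤ j, ∀ y ∈ K, ‖iteratedFDerivWithin ℝ i g U y‖ ≤ D := by
  have h1 : ∀ i : ℕ, ∃ D, ∀ y ∈ K, ‖iteratedFDerivWithin ℝ i g U y‖ ≤ D := fun i ↦
    hK.exists_bound_of_continuousOn
      ((hg.continuousOn_iteratedFDerivWithin (mod_cast le_top) hU.uniqueDiffOn).mono hKU)
  choose D hD using h1
  refine ⟨1 + ∑ i ∈ Finset.range (j + 1), |D i|,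
    le_add_of_nonneg_right (Finset.sum_nonneg fun _ _ ↦ abs_nonneg _), fun i hi y hy ↦ ?_⟩
  have h2 := Finset.single_le_sum (f := fun i ↦ |D i|) (fun _ _ ↦ abs_nonneg _)
    (Finset.mem_range.mpr (Nat.lt_succ_of_le hi))
  have := hD i y hy
  have := le_abs_self (D i)
  linarith

theorem exists_norm_iteratedFDeriv_polarFun_le (hπ : Function.Surjective π) {α β : ℝ} (hα : 0 < α)
    {b : ({v : V // v ≠ v₀} → ℝ) → ℝ} (hbs : ContDiff ℝ ∞ b) (hb : HasCompactSupport b) (j : ℕ) :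
    ∃ C, 0 ≤ C ∧ ∀ f : ℝ → ℝ, ContDiff ℝ ∞ f → ∀ y ∈ polarShell π v₀ α β b,
      ‖iteratedFDeriv ℝ j (polarFun π v₀ f b) y‖ ≤
        C * ∑ k ∈ Finset.range (j + 1), |iteratedDeriv k f (blockProd π y)| := by
  set U := {y : EuclideanSpace ℝ ι | blockProd π y ≠ 0}
  have hU : IsOpen U := isOpen_blockProd_ne_zero
  have hK := isCompact_polarShell (β := β) hπ hα hb
  have hKU : polarShell π v₀ α β b ⊆ U := polarShell_subset hα
  obtain ⟨D, hD1, hD⟩ := exists_norm_iteratedFDerivWithin_le hU hK hKU (contDiffOn_blockProd hπ) j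
  have hbz : ContDiffOn ℝ ∞ (fun y ↦ b (polarLog π v₀ y).1) U :=
    hbs.comp_contDiffOn (contDiffOn_polarLog_fst hπ)
  obtain ⟨D', hD1', hD'⟩ := exists_norm_iteratedFDerivWithin_le hU hK hKU hbz j
  refine ⟨∑ i ∈ Finset.range (j + 1), (j.choose i : ℝ) * (i ! * D ^ i) * D', by positivity,
    fun f hf y hy ↦ ?_⟩
  set A := ∑ k ∈ Finset.range (j + 1), |iteratedDeriv k f (blockProd π y)|
  have hA : 0 ≤ A := Finset.sum_nonneg fun _ _ ↦ abs_nonneg _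
  rw [← iteratedFDerivWithin_of_isOpen j hU (hKU hy)]
  have hfN : ContDiffOn ℝ ∞ (fun y ↦ f (blockProd π y)) U :=
    hf.comp_contDiffOn (contDiffOn_blockProd hπ)
  refine (norm_iteratedFDerivWithin_mul_le hfN hbz hU.uniqueDiffOn (hKU hy)
    (mod_cast le_top)).trans ?_
  rw [Finset.sum_mul]
  refine Finset.sum_le_sum fun i hi ↦ ?_
  have hij : i ≤ j := Nat.le_of_lt_succ (Finset.mem_range.mp hi)
  have h1 : ‖iteratedFDerivWithin ℝ i (fun y ↦ f (blockProd π y)) U y‖ ≤ i ! * A * D ^ i := by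
    refine norm_iteratedFDerivWithin_comp_le (t := univ) (N := ∞) hf.contDiffOn
      (contDiffOn_blockProd hπ) (mod_cast le_top) uniqueDiffOn_univ hU.uniqueDiffOn
      (mapsTo_univ _ _) (hKU hy) (fun k hk ↦ ?_) fun k hk1 hk ↦ ?_
    · rw [iteratedFDerivWithin_univ, norm_iteratedFDeriv_eq_norm_iteratedDeriv, Real.norm_eq_abs]
      exact Finset.single_le_sum (f := fun k ↦ |iteratedDeriv k f (blockProd π y)|)
        (fun _ _ ↦ abs_nonneg _) (Finset.mem_range.mpr (by omega))
    · exact (hD k (hk.trans hij) y hy).trans (le_self_pow₀ hD1 (by omega))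
  have h2 := hD' (j - i) (Nat.sub_le _ _) y hy
  calc _ ≤ (j.choose i : ℝ) * (i ! * A * D ^ i) * D' := by gcongr
    _ = _ := by ring

end PolarFunctions

section PolarEnergy

open scoped ENNReal NNReal ContDiff Nat FourierTransform SchwartzMap

variable {ι V : Type*} [Fintype ι] [Fintype V] [DecidableEq V] {π : ι → V} {v₀ : V}

lemma volume_exp_mem_Icc_le {α β a R : ℝ} (hα : 0 < α) :
    volume {s : ℝ | Real.exp s ∈ Icc α β ∧ |Real.exp s - a| ≤ R} ≤ ENNReal.ofReal (2 * R / α) := by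
  refine (Real.volume_le_diam _).trans (Metric.ediam_le fun s hs s' hs' ↦ ?_)
  rw [edist_dist, Real.dist_eq]
  refine ENNReal.ofReal_le_ofReal ?_
  have key : ∀ s s' : ℝ, Real.exp s' ∈ Icc α β → |Real.exp s - a| ≤ R → |Real.exp s' - a| ≤ R →
      s - s' ≤ 2 * R / α := fun s s' h1 h2 h3 ↦ by
    rw [le_div_iff₀ hα]
    by_cases hss : s - s' ≤ 0
    · have := (abs_nonneg _).trans h2
      nlinarith
    · have h4 := Real.add_one_le_exp (s - s')
      have h5 : Real.exp (s - s') * Real.exp s' = Real.exp s := by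
        rw [← Real.exp_add, sub_add_cancel]
      have h6 := Real.exp_pos s'
      have := abs_le.mp h2
      have := abs_le.mp h3
      have := h1.1
      nlinarith
  exact abs_sub_le_iff.mpr ⟨key s s' hs'.1 hs.2 hs'.2, key s' s hs.1 hs'.2 hs.2⟩

lemma exists_volume_polarShell_inter_le (hπ : Function.Surjective π) {α β : ℝ} (hα : 0 < α)
    {b : ({v : V // v ≠ v₀} → ℝ) → ℝ} (hb : HasCompactSupport b) :
    ∃ C : ℝ≥0, ∀ a R : ℝ, volume (polarShell π v₀ α β b ∩ {y | |blockProd π y - a| ≤ R}) ≤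
      C * ENNReal.ofReal R := by
  obtain ⟨c, -, hc⟩ := exists_map_polarLog_eq hπ v₀
  have hfin : volume (tsupport b) ≠ ⊤ := hb.measure_lt_top.ne
  refine ⟨β.toNNReal * (c * ((volume (tsupport b)).toNNReal * (2 / α).toNNReal)), fun a R ↦ ?_⟩
  set S := polarShell π v₀ α β b ∩ {y | |blockProd π y - a| ≤ R}
  set L := {s : ℝ | Real.exp s ∈ Icc α β ∧ |Real.exp s - a| ≤ R}
  have hS : MeasurableSet S := (isCompact_polarShell hπ hα hb).isClosed.measurableSet.inter
    (isClosed_le (continuous_blockProd.sub continuous_const).abs continuous_const).measurableSet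
  have hL : MeasurableSet L := ((isClosed_Icc.preimage Real.continuous_exp).inter
    (isClosed_le (Real.continuous_exp.sub continuous_const).abs continuous_const)).measurableSet
  have h1 : volume S ≤ ENNReal.ofReal β * scaleMeasure π S := by
    rw [scaleMeasure, withDensity_apply _ hS, ← lintegral_const_mul _ measurable_inv_blockProd,
      ← setLIntegral_one]
    refine setLIntegral_mono (measurable_const.mul measurable_inv_blockProd) fun y hy ↦ ?_
    have hpos := hα.trans_le hy.1.1.1
    rw [← ENNReal.ofReal_mul' (inv_nonneg.mpr hpos.le), ENNReal.one_le_ofReal,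
      ← div_eq_mul_inv, one_le_div hpos]
    exact hy.1.1.2
  have h2 : scaleMeasure π S ≤ c * (volume (tsupport b) * volume L) := by
    have h3 : S ⊆ polarLog π v₀ ⁻¹' (tsupport b ×ˢ L) := fun y hy ↦ by
      have hexp : Real.exp (polarLog π v₀ y).2 = blockProd π y :=
        Real.exp_log (hα.trans_le hy.1.1.1)
      refine ⟨hy.1.2, ?_⟩
      simp only [L, mem_ofPred_eq, hexp]
      exact ⟨hy.1.1, hy.2⟩
    refine (measure_mono h3).trans (le_of_eq ?_)
    rw [← Measure.map_apply measurable_polarLog ((isClosed_tsupport b).measurableSet.prod hL), hc,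
      Measure.smul_apply, Measure.volume_eq_prod, Measure.prod_prod]
    rfl
  calc volume S ≤ ENNReal.ofReal β * (c * (volume (tsupport b) * ENNReal.ofReal (2 * R / α))) := by
        refine h1.trans ?_
        gcongr
        refine h2.trans ?_
        gcongr
        exact volume_exp_mem_Icc_le hα
    _ = _ := by
        rw [show 2 * R / α = 2 / α * R by ring, ENNReal.ofReal_mul (by positivity)]
        push_cast
        rw [ENNReal.coe_toNNReal hfin]
        simp only [ENNReal.ofReal, mul_assoc]

/-- Smooth approximations, at scale `h`, of functions which are piecewise linear with break points
in `A`. -/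
structure IsSmoothedPiecewiseLinear (A : Finset ℝ) (α β R : ℝ) (B : ℕ → ℝ) (h : ℝ) (f : ℝ → ℝ) :
    Prop where
  contDiff : ContDiff ℝ ∞ f
  support_subset : ∀ v, f v ≠ 0 → v ∈ Icc α β
  abs_le : ∀ v, |f v| ≤ B 0
  abs_deriv_le : ∀ v, |iteratedDeriv 1 f v| ≤ B 1
  abs_iteratedDeriv_le : ∀ j, 2 ≤ j → ∀ v, |iteratedDeriv j f v| ≤ B j * h * (h⁻¹) ^ j
  iteratedDeriv_support : ∀ j, 2 ≤ j → ∀ v, iteratedDeriv j f v ≠ 0 → ∃ a ∈ A, |v - a| ≤ R * h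

lemma IsSmoothedPiecewiseLinear.sum_abs_le {A : Finset ℝ} {α β R h : ℝ} {B : ℕ → ℝ} {f : ℝ → ℝ}
    (hf : IsSmoothedPiecewiseLinear A α β R B h f) (hh : 0 < h) (hh1 : h ≤ 1) (j : ℕ) (v : ℝ) :
    ∑ k ∈ Finset.range (j + 1), |iteratedDeriv k f v| ≤
      (∑ k ∈ Finset.range (j + 1), |B k|) *
        (1 + (⋃ a ∈ A, Metric.closedBall a (R * h)).indicator (fun _ ↦ h * h⁻¹ ^ j) v) := by
  rw [Finset.sum_mul]
  refine Finset.sum_le_sum fun k hk ↦ ?_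
  have hkj : k ≤ j := Nat.le_of_lt_succ (Finset.mem_range.mp hk)
  have h0 : 0 ≤ (⋃ a ∈ A, Metric.closedBall a (R * h)).indicator (fun _ ↦ h * h⁻¹ ^ j) v :=
    indicator_nonneg (fun _ _ ↦ by positivity) v
  have hB := abs_nonneg (B k)
  have hle := le_abs_self (B k)
  rcases lt_or_ge k 2 with h2 | h2
  · have h3 : |iteratedDeriv k f v| ≤ B k := by
      interval_cases k
      · simpa using hf.abs_le v
      · exact hf.abs_deriv_le v
    nlinarith
  · by_cases h3 : iteratedDeriv k f v = 0
    · rw [h3, abs_zero]; positivity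
    · obtain ⟨a, ha, hva⟩ := hf.iteratedDeriv_support k h2 v h3
      rw [indicator_of_mem (by
        simp only [mem_iUnion]; exact ⟨a, ha, by simpa [Real.dist_eq] using hva⟩)]
      have h4 := hf.abs_iteratedDeriv_le k h2 v
      have h5 : h * h⁻¹ ^ k ≤ h * h⁻¹ ^ j := by
        gcongr
        exact (one_le_inv₀ hh).mpr hh1
      have h6 : 0 ≤ h * h⁻¹ ^ k := by positivity
      calc _ ≤ B k * (h * h⁻¹ ^ k) := by rw [← mul_assoc]; exact h4
        _ ≤ |B k| * (h * h⁻¹ ^ k) := by gcongr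
        _ ≤ |B k| * (1 + h * h⁻¹ ^ j) := by gcongr; linarith

theorem exists_lintegral_iteratedFDeriv_polarFun_le (hπ : Function.Surjective π)
    (A : Finset ℝ) {α β : ℝ} (R : ℝ) (B : ℕ → ℝ) (hα : 0 < α) {b : ({v : V // v ≠ v₀} → ℝ) → ℝ}
    (hbs : ContDiff ℝ ∞ b) (hb : HasCompactSupport b) {j : ℕ} (hj : 2 ≤ j) :
    ∃ C : ℝ≥0, ∀ h f, 0 < h → h ≤ 1 → IsSmoothedPiecewiseLinear A α β R B h f →
      ∫⁻ y, ‖iteratedFDeriv ℝ j (polarFun π v₀ f b) y‖ₑ ^ 2 ≤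
        C * ENNReal.ofReal (h ^ 3 * h⁻¹ ^ (2 * j)) := by
  obtain ⟨C₁, hC₁, h1⟩ := exists_norm_iteratedFDeriv_polarFun_le (β := β) hπ hα hbs hb j
  obtain ⟨C₂, h2⟩ := exists_volume_polarShell_inter_le (β := β) hπ hα hb
  set T := polarShell π v₀ α β b with hT
  have hTc : IsCompact T := isCompact_polarShell hπ hα hb
  set D := C₁ * ∑ k ∈ Finset.range (j + 1), |B k| with hD
  have hD0 : 0 ≤ D := by positivity
  refine ⟨2 * (D ^ 2).toNNReal * ((volume T).toNNReal + A.card * (C₂ * R.toNNReal)),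
    fun h f hh hh1 hf ↦ ?_⟩
  set W : Set (EuclideanSpace ℝ ι) := ⋃ a ∈ A, (T ∩ {y | |blockProd π y - a| ≤ R * h}) with hW
  have hWm : MeasurableSet W := by
    refine Finset.measurableSet_biUnion _ fun a _ ↦ hTc.isClosed.measurableSet.inter ?_
    exact (isClosed_le (continuous_blockProd.sub continuous_const).abs
      continuous_const).measurableSet
  set H := h * h⁻¹ ^ j with hH
  have hH0 : 0 ≤ H := by positivity
  have key : ∀ y, ‖iteratedFDeriv ℝ j (polarFun π v₀ f b) y‖ₑ ^ 2 ≤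
      ENNReal.ofReal (2 * D ^ 2) *
        (T.indicator 1 y + W.indicator (fun _ ↦ ENNReal.ofReal (H ^ 2)) y) := fun y ↦ by
    by_cases hy : y ∈ T
    · have h3 : ‖iteratedFDeriv ℝ j (polarFun π v₀ f b) y‖ ^ 2 ≤
          2 * D ^ 2 * (1 + W.indicator (fun _ ↦ H ^ 2) y) := by
        have h4 : (⋃ a ∈ A, Metric.closedBall a (R * h)).indicator (fun _ ↦ H) (blockProd π y) =
            W.indicator (fun _ ↦ H) y := by
          simp only [indicator, hW, mem_iUnion, mem_inter_iff, hy, true_and, mem_ofPred_eq,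
            Metric.mem_closedBall, Real.dist_eq]
        have h5 := (h1 f hf.contDiff y hy).trans (mul_le_mul_of_nonneg_left
          (hf.sum_abs_le hh hh1 j (blockProd π y)) hC₁)
        rw [h4, ← mul_assoc, ← hD] at h5
        have h6 : W.indicator (fun _ ↦ H ^ 2) y = (W.indicator (fun _ ↦ H) y) ^ 2 := by
          by_cases hyW : y ∈ W <;> simp [hyW]
        rw [h6]
        refine (pow_le_pow_left₀ (norm_nonneg _) h5 2).trans ?_
        nlinarith [sq_nonneg (1 - W.indicator (fun _ ↦ H) y), sq_nonneg D,
          mul_nonneg (sq_nonneg D) (sq_nonneg (1 - W.indicator (fun _ ↦ H) y))]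
      have h7 := ENNReal.ofReal_le_ofReal h3
      rw [ENNReal.ofReal_pow (norm_nonneg _), ofReal_norm, ENNReal.ofReal_mul (by positivity),
        ENNReal.ofReal_add zero_le_one (indicator_nonneg (fun _ _ ↦ by positivity) y)] at h7
      refine h7.trans (le_of_eq ?_)
      rw [indicator_of_mem hy]
      by_cases hyW : y ∈ W <;> simp [hyW]
    · have h3 : iteratedFDeriv ℝ j (polarFun π v₀ f b) y = 0 := by
        by_contra h0
        exact hy (tsupport_polarFun_subset hπ hα hf.support_subset hb
          (support_iteratedFDeriv_subset j h0))
      rw [h3]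
      simp
  have hTm := hTc.isClosed.measurableSet
  have hWv : volume W ≤ A.card * (C₂ * ENNReal.ofReal (R * h)) := by
    refine (measure_biUnion_finset_le _ _).trans ?_
    refine (Finset.sum_le_card_nsmul _ _ _ fun a _ ↦ h2 a (R * h)).trans ?_
    simp
  refine (lintegral_mono key).trans ?_
  rw [lintegral_const_mul _ (show Measurable fun y ↦ T.indicator 1 y + W.indicator
      (fun _ ↦ ENNReal.ofReal (H ^ 2)) y from
      (measurable_one.indicator hTm).add (measurable_const.indicator hWm)),
    lintegral_add_left (measurable_one.indicator hTm), lintegral_indicator_one hTm,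
    lintegral_indicator_const hWm]
  have hinv : 1 ≤ h⁻¹ := (one_le_inv₀ hh).mpr hh1
  have e1 : H ^ 2 * h = h ^ 3 * h⁻¹ ^ (2 * j) := by rw [hH, pow_mul']; ring
  have e2 : 1 ≤ h ^ 3 * h⁻¹ ^ (2 * j) := by
    obtain ⟨i, rfl⟩ := Nat.exists_eq_add_of_le hj
    rw [show 2 * (2 + i) = 3 + (1 + 2 * i) by ring, pow_add, ← mul_assoc, ← mul_pow,
      mul_inv_cancel₀ hh.ne', one_pow, one_mul]
    exact one_le_pow₀ hinv
  set Q := h ^ 3 * h⁻¹ ^ (2 * j)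
  calc _ ≤ ENNReal.ofReal (2 * D ^ 2) * (volume T * ENNReal.ofReal Q + ENNReal.ofReal (H ^ 2) *
        (A.card * (C₂ * ENNReal.ofReal (R * h)))) := by
        gcongr
        exact le_mul_of_one_le_right zero_le (ENNReal.one_le_ofReal.mpr e2)
    _ = ENNReal.ofReal (2 * D ^ 2) * (volume T * ENNReal.ofReal Q +
        A.card * (C₂ * ENNReal.ofReal R) * ENNReal.ofReal Q) := by
        rw [← e1, ENNReal.ofReal_mul (sq_nonneg H),
          show ENNReal.ofReal (R * h) = _ from ENNReal.ofReal_mul' hh.le]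
        ring
    _ = _ := by
        rw [ENNReal.ofReal_mul zero_le_two]
        push_cast
        rw [ENNReal.coe_toNNReal hTc.measure_lt_top.ne]
        simp only [ENNReal.ofReal, Real.toNNReal_ofNat]
        push_cast
        ring

end PolarEnergy

section PolarFourier

open scoped ENNReal NNReal ContDiff FourierTransform SchwartzMap

variable {ι V : Type*} [Fintype ι] [Fintype V] [DecidableEq V] {π : ι → V} {v₀ : V}

lemma fourier_polarFun_eq_of_blockNorm_eq {f : ℝ → ℝ} {b : ({v : V // v ≠ v₀} → ℝ) → ℝ}
    {F : 𝓢(EuclideanSpace ℝ ι, ℂ)} (hF : ∀ y, F y = (polarFun π v₀ f b y : ℂ))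
    {η η' : EuclideanSpace ℝ ι} (h : ∀ v, blockNorm π v η = blockNorm π v η') :
    𝓕 F η = 𝓕 F η' := by
  obtain ⟨A, hA, rfl⟩ := exists_isometry_of_blockNorm_eq h
  have h1 : (F : EuclideanSpace ℝ ι → ℂ) ∘ A = F := by
    ext y
    have h2 : blockProd π (A y) = blockProd π y := by simp only [blockProd, hA]
    simp only [Function.comp_apply, hF, polarFun, h2, polarLog, hA]
  rw [SchwartzMap.fourier_coe, ← Real.fourier_comp_linearIsometry, h1]

lemma rpow_le_add_pow {h x p : ℝ} (hh : 0 < h) (hx : 0 ≤ x) (hp : 4 ≤ p) {M : ℕ} (hM : p ≤ 2 * M) :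
    x ^ p ≤ h ^ (4 - p) * x ^ 4 + h ^ (2 * M - p) * x ^ (2 * M) := by
  have h1 : ∀ u : ℝ, 0 ≤ u → u ^ p ≤ u ^ 4 + u ^ (2 * M) := fun u hu ↦ by
    rcases hu.eq_or_lt with rfl | hu0
    · rw [Real.zero_rpow (by linarith)]; positivity
    rcases le_total u 1 with hu1 | hu1
    · have : u ^ p ≤ u ^ (4 : ℝ) := Real.rpow_le_rpow_of_exponent_ge hu0 hu1 hp
      rw [show (4 : ℝ) = (4 : ℕ) by norm_num, Real.rpow_natCast] at this
      have : 0 ≤ u ^ (2 * M) := by positivity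
      linarith
    · have : u ^ p ≤ u ^ (2 * M : ℝ) := Real.rpow_le_rpow_of_exponent_le hu1 hM
      rw [show (2 * M : ℝ) = (2 * M : ℕ) by norm_num, Real.rpow_natCast] at this
      have : 0 ≤ u ^ 4 := by positivity
      linarith
  have h2 := h1 (h * x) (by positivity)
  rw [Real.mul_rpow hh.le hx, mul_pow, mul_pow] at h2
  have h3 : h ^ (4 - p) = h ^ 4 * (h ^ p)⁻¹ := by
    rw [Real.rpow_sub hh, ← div_eq_mul_inv]
    norm_cast
  have h4 : h ^ (2 * M - p) = h ^ (2 * M) * (h ^ p)⁻¹ := by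
    rw [Real.rpow_sub hh, ← div_eq_mul_inv]
    norm_cast
  rw [h3, h4]
  have h5 : 0 < h ^ p := Real.rpow_pos_of_pos hh p
  calc x ^ p = (h ^ p)⁻¹ * (h ^ p * x ^ p) := by field_simp
    _ ≤ (h ^ p)⁻¹ * (h ^ 4 * x ^ 4 + h ^ (2 * M) * x ^ (2 * M)) := by gcongr
    _ = _ := by ring

theorem exists_lintegral_fourier_polarFun_le (hπ : Function.Surjective π)
    (A : Finset ℝ) {α β : ℝ} (R : ℝ) (B : ℕ → ℝ) (hα : 0 < α) {b : ({v : V // v ≠ v₀} → ℝ) → ℝ}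
    (hbs : ContDiff ℝ ∞ b) (hb : HasCompactSupport b) {p : ℝ} (hp : 4 ≤ p) :
    ∃ C : ℝ≥0, ∀ h f (F : 𝓢(EuclideanSpace ℝ ι, ℂ)), 0 < h → h ≤ 1 →
      IsSmoothedPiecewiseLinear A α β R B h f → (∀ y, F y = (polarFun π v₀ f b y : ℂ)) →
      ∫⁻ η, ‖𝓕 F η‖ₑ ^ 2 * ENNReal.ofReal (‖η‖ ^ p) ≤ C * ENNReal.ofReal (h ^ (3 - p)) := by
  classical
  obtain ⟨m, hm⟩ : ∃ m : ℕ, p ≤ 2 * (m + 2 : ℕ) := by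
    obtain ⟨m, hm⟩ := exists_nat_ge p
    exact ⟨m, by push_cast; linarith⟩
  obtain ⟨C₁, h1⟩ := exists_lintegral_iteratedFDeriv_polarFun_le hπ A (β := β) R B hα hbs hb
    (le_refl 2)
  obtain ⟨C₂, h2⟩ := exists_lintegral_iteratedFDeriv_polarFun_le hπ A (β := β) R B hα hbs hb
    (show 2 ≤ m + 1 + 1 by omega)
  refine ⟨Fintype.card ι ^ 2 * C₁ + Fintype.card ι ^ (m + 1 + 1) * C₂, fun h f F hh hh1 hf hF ↦ ?_⟩
  have hFeq : (F : EuclideanSpace ℝ ι → ℂ) = Complex.ofRealLI ∘ polarFun π v₀ f b := by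
    ext y; simp [hF]
  have hder : ∀ (j : ℕ) y, ‖iteratedFDeriv ℝ j F y‖ₑ = ‖iteratedFDeriv ℝ j (polarFun π v₀ f b) y‖ₑ :=
    fun j y ↦ by
      rw [hFeq, ← ofReal_norm, ← ofReal_norm, LinearIsometry.norm_iteratedFDeriv_comp_left _
        (contDiff_polarFun hπ hα hf.contDiff hf.support_subset hbs hb).contDiffAt
        (mod_cast le_top)]
  have e1 := (SchwartzMap.lintegral_fourier_mul_norm_pow_le F 1).trans
    (mul_le_mul_right ((lintegral_congr fun y ↦ by rw [hder]).le.trans (h1 h f hh hh1 hf)) _)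
  have e2 := (SchwartzMap.lintegral_fourier_mul_norm_pow_le F (m + 1)).trans
    (mul_le_mul_right ((lintegral_congr fun y ↦ by rw [hder]).le.trans (h2 h f hh hh1 hf)) _)
  have hpt : ∀ η, ‖𝓕 F η‖ₑ ^ 2 * ENNReal.ofReal (‖η‖ ^ p) ≤
      ENNReal.ofReal (h ^ (4 - p)) * (‖𝓕 F η‖ₑ ^ 2 * ‖η‖ₑ ^ (2 * (1 + 1))) +
      ENNReal.ofReal (h ^ (2 * (m + 2 : ℕ) - p)) *
        (‖𝓕 F η‖ₑ ^ 2 * ‖η‖ₑ ^ (2 * (m + 1 + 1))) := fun η ↦ by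
    have h3 := ENNReal.ofReal_le_ofReal (rpow_le_add_pow hh (norm_nonneg η) hp hm)
    rw [ENNReal.ofReal_add (by positivity) (by positivity), ENNReal.ofReal_mul (by positivity),
      ENNReal.ofReal_mul (by positivity), ENNReal.ofReal_pow (norm_nonneg _),
      ENNReal.ofReal_pow (norm_nonneg _), ofReal_norm] at h3
    refine (mul_le_mul_right h3 _).trans (le_of_eq ?_)
    ring
  have hmeas : ∀ k : ℕ, Measurable fun η ↦ ‖𝓕 F η‖ₑ ^ 2 * ‖η‖ₑ ^ k := fun k ↦
    ((𝓕 F).continuous.measurable.enorm.pow_const 2).mul (measurable_enorm.pow_const k)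
  refine (lintegral_mono hpt).trans ?_
  rw [lintegral_add_left ((hmeas _).const_mul _), lintegral_const_mul _ (hmeas _),
    lintegral_const_mul _ (hmeas _)]
  have q1 : h ^ (4 - p) * (h ^ 3 * h⁻¹ ^ (2 * 2)) = h ^ (3 - p) := by
    have : h ^ (3 : ℝ) = h ^ 3 := by norm_cast
    have : h ^ (4 : ℝ) = h ^ 4 := by norm_cast
    rw [Real.rpow_sub hh, Real.rpow_sub hh, ‹h ^ (3 : ℝ) = _›, ‹h ^ (4 : ℝ) = _›, inv_pow]
    field_simp
  have q2 : h ^ (2 * (m + 2 : ℕ) - p) * (h ^ 3 * h⁻¹ ^ (2 * (m + 1 + 1))) = h ^ (3 - p) := by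
    have : h ^ (3 : ℝ) = h ^ 3 := by norm_cast
    have : h ^ (2 * (m + 2 : ℕ) : ℝ) = h ^ (2 * (m + 1 + 1)) := by norm_cast
    rw [Real.rpow_sub hh, Real.rpow_sub hh, ‹h ^ (3 : ℝ) = _›, this, inv_pow]
    field_simp
  calc _ ≤ ENNReal.ofReal (h ^ (4 - p)) * (Fintype.card ι ^ (1 + 1) *
          (C₁ * ENNReal.ofReal (h ^ 3 * h⁻¹ ^ (2 * 2)))) +
        ENNReal.ofReal (h ^ (2 * (m + 2 : ℕ) - p)) * (Fintype.card ι ^ (m + 1 + 1) *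
          (C₂ * ENNReal.ofReal (h ^ 3 * h⁻¹ ^ (2 * (m + 1 + 1))))) := by gcongr
    _ = Fintype.card ι ^ 2 * C₁ * ENNReal.ofReal (h ^ (3 - p)) +
        Fintype.card ι ^ (m + 1 + 1) * C₂ * ENNReal.ofReal (h ^ (3 - p)) := by
      congr 1
      · rw [← q1, ENNReal.ofReal_mul (p := h ^ (4 - p)) (by positivity)]; ring
      · rw [← q2, ENNReal.ofReal_mul (p := h ^ (2 * (m + 2 : ℕ) - p)) (by positivity)]; ring
    _ = _ := by push_cast; ring

lemma integral_exp_comp_mul_exp {α β : ℝ} (hα : 0 < α) {f : ℝ → ℝ}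
    (hf : ∀ v, f v ≠ 0 → v ∈ Icc α β) :
    ∫ s, f (Real.exp s) * Real.exp s = ∫ v, f v := by
  have h1 := integral_image_eq_integral_abs_deriv_smul (s := univ) (f := Real.exp)
    (f' := Real.exp) MeasurableSet.univ (fun x _ ↦ (Real.hasDerivAt_exp x).hasDerivWithinAt)
    Real.exp_injective.injOn f
  rw [image_univ, Real.range_exp, setIntegral_eq_integral_of_forall_compl_eq_zero
    (fun v hv ↦ ?_)] at h1
  · rw [h1]
    simp [mul_comm]
  · by_contra h0
    exact hv (hα.trans_le (hf v h0).1)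

/-- The integral of a function with given radial and angular profile. -/
theorem exists_integral_polarFun_eq (hπ : Function.Surjective π) (v₀ : V) :
    ∃ c : ℝ, 0 < c ∧ ∀ (f : ℝ → ℝ) (b : ({v : V // v ≠ v₀} → ℝ) → ℝ) (α β : ℝ), 0 < α →
      (∀ v, f v ≠ 0 → v ∈ Icc α β) → Measurable f → Measurable b →
      ∫ y, polarFun π v₀ f b y = c * (∫ z, b z) * ∫ v, f v := by
  obtain ⟨c, hc0, hc⟩ := exists_map_polarLog_eq hπ v₀
  refine ⟨c, NNReal.coe_pos.mpr (pos_iff_ne_zero.mpr hc0), fun f b α β hα hf hfm hbm ↦ ?_⟩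
  set G : ({v : V // v ≠ v₀} → ℝ) × ℝ → ℝ := fun q ↦ b q.1 * (f (Real.exp q.2) * Real.exp q.2)
  have h1 : ∫ y, polarFun π v₀ f b y = ∫ y, G (polarLog π v₀ y) ∂scaleMeasure π := by
    rw [scaleMeasure, integral_withDensity_eq_integral_toReal_smul measurable_inv_blockProd
      (Eventually.of_forall fun _ ↦ ENNReal.ofReal_lt_top)]
    refine integral_congr_ae (Eventually.of_forall fun y ↦ ?_)
    simp only
    rw [ENNReal.toReal_ofReal (inv_nonneg.mpr (blockProd_nonneg y)), smul_eq_mul]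
    by_cases hy : blockProd π y = 0
    · have : f 0 = 0 := by
        by_contra h0
        exact hα.not_ge (hf 0 h0).1
      simp [polarFun, hy, this]
    · have hexp : Real.exp (polarLog π v₀ y).2 = blockProd π y :=
        Real.exp_log (lt_of_le_of_ne (blockProd_nonneg y) (Ne.symm hy))
      simp only [G, hexp, polarFun]
      field_simp
  have hG : Measurable G := by
    have := Real.measurable_exp
    fun_prop
  rw [h1, ← integral_map measurable_polarLog.aemeasurable hG.aestronglyMeasurable, hc,
    integral_smul_nnreal_measure, Measure.volume_eq_prod]
  simp only [G]
  rw [integral_prod_mul b fun s ↦ f (Real.exp s) * Real.exp s, integral_exp_comp_mul_exp hα hf,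
    NNReal.smul_def, smul_eq_mul, mul_assoc]

end PolarFourier

section PolarDual

open scoped ENNReal NNReal ContDiff FourierTransform SchwartzMap

variable {ι V : Type*} [Fintype ι] [Fintype V] [DecidableEq V] {π : ι → V} {v₀ : V}

lemma continuous_blockScale_apply (ξ : EuclideanSpace ℝ ι) :
    Continuous fun p : ({v : V // v ≠ v₀} → ℝ) × ℝ ↦ blockScale π (polarExp π v₀ p) ξ := by
  have h : ∀ i, Continuous fun p : ({v : V // v ≠ v₀} → ℝ) × ℝ ↦ polarExp π v₀ p (π i) :=
    fun i ↦ continuous_polarExp _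
  refine (PiLp.continuous_toLp 2 _).comp (continuous_pi fun i ↦ ?_)
  exact (Real.continuous_exp.comp (h i)).mul continuous_const

lemma polarExp_zero_left (L : ℝ) (v : V) :
    polarExp π v₀ (0, L) v = L / Fintype.card ι := by
  by_cases h : v ≠ v₀ <;> simp [polarExp, h]

lemma le_norm_blockScale_neg_polarExp (hπ : Function.Surjective π) {L : ℝ}
    {p : ({v : V // v ≠ v₀} → ℝ) × ℝ} (hp : p ∈ Metric.closedBall (0, L) 1)
    (ξ : EuclideanSpace ℝ ι) :
    Real.exp (-(Fintype.card V + 1)) * (Real.exp (-L / Fintype.card ι) * ‖ξ‖) ≤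
      ‖blockScale π (-polarExp π v₀ p) ξ‖ := by
  rw [← mul_assoc, ← Real.exp_add]
  refine le_norm_blockScale _ (fun v ↦ ?_) ξ
  have h1 : p = (p - (0, L)) + (0, L) := by simp
  have h2 := abs_polarExp_le hπ (p - (0, L)) v
  have h3 : ‖p - (0, L)‖ ≤ 1 := by simpa [dist_eq_norm] using hp
  have h4 : (0 : ℝ) ≤ Fintype.card V + 1 := by positivity
  have h5 := (abs_le.mp (h2.trans (mul_le_of_le_one_right h4 h3))).2
  rw [Pi.neg_apply, h1, polarExp_add, Pi.add_apply, polarExp_zero_left, neg_div]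
  linarith

lemma norm_eq_of_blockNorm_eq {y y' : EuclideanSpace ℝ ι}
    (h : ∀ v, blockNorm π v y = blockNorm π v y') : ‖y‖ = ‖y'‖ := by
  have h1 := sum_blockNorm_sq (π := π) y
  simp_rw [h, sum_blockNorm_sq] at h1
  exact ((sq_eq_sq₀ (norm_nonneg _) (norm_nonneg _)).mp h1).symm

theorem exists_lintegral_fourier_blockScale_sq_le (hπ : Function.Surjective π)
    (A : Finset ℝ) {α β : ℝ} (R : ℝ) (B : ℕ → ℝ) (hα : 0 < α) {b : ({v : V // v ≠ v₀} → ℝ) → ℝ}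
    (hbs : ContDiff ℝ ∞ b) (hb : HasCompactSupport b) {p : ℝ} (hp : 4 ≤ p) :
    ∃ C : ℝ≥0, ∀ h f (F : 𝓢(EuclideanSpace ℝ ι, ℂ)), 0 < h → h ≤ 1 →
      IsSmoothedPiecewiseLinear A α β R B h f → (∀ y, F y = (polarFun π v₀ f b y : ℂ)) →
      ∀ ξ, blockProd π ξ ≠ 0 → ∀ L : ℝ,
      ∫⁻ q in Metric.closedBall ((0 : {v : V // v ≠ v₀} → ℝ), L) 1,
        ‖𝓕 F (blockScale π (-polarExp π v₀ q) ξ)‖ₑ ^ 2 ≤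
      C * ENNReal.ofReal (h ^ (3 - p)) * ENNReal.ofReal ((Real.exp (-L) * blockProd π ξ)⁻¹ *
        (Real.exp (-L / Fintype.card ι) * ‖ξ‖) ^ (-p)) := by
  obtain ⟨c, hc0, hc⟩ := exists_map_polarLog_eq hπ v₀
  obtain ⟨C₁, hC₁⟩ := exists_lintegral_fourier_polarFun_le hπ A (β := β) R B hα hbs hb hp
  set M : ℝ := Real.exp 1 * Real.exp (-(Fintype.card V + 1)) ^ (-p)
  refine ⟨c⁻¹ * M.toNNReal * C₁, fun h f F hh hh1 hf hF ξ hξ L ↦ ?_⟩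
  have hξ0 : 0 < ‖ξ‖ := by
    rw [norm_pos_iff]
    rintro rfl
    refine hξ (le_antisymm ((blockProd_le_norm_pow 0).trans ?_) (blockProd_nonneg _))
    rw [norm_zero, zero_pow (card_pos_of_surjective hπ v₀).ne']
  have hNξ : 0 < blockProd π ξ := lt_of_le_of_ne (blockProd_nonneg _) (Ne.symm hξ)
  set T := Metric.closedBall ((0 : {v : V // v ≠ v₀} → ℝ), L) 1
  have hT : MeasurableSet T := measurableSet_closedBall
  set q₀ := polarLog π v₀ ξ
  let Φ : ({v : V // v ≠ v₀} → ℝ) × ℝ → ℝ≥0∞ := fun q ↦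
    T.indicator (fun p ↦ ‖𝓕 F (blockScale π (-polarExp π v₀ p) ξ)‖ₑ ^ 2) (q₀ - q)
  have hΦ : Measurable Φ := by
    have h1 : Measurable fun p : ({v : V // v ≠ v₀} → ℝ) × ℝ ↦
        ‖𝓕 F (blockScale π (-polarExp π v₀ p) ξ)‖ₑ ^ 2 := by
      have h2 := ((𝓕 F).continuous.comp
        ((continuous_blockScale_apply (v₀ := v₀) (π := π) ξ).comp continuous_neg)).measurable
      simp only [Function.comp_def, polarExp_neg] at h2
      exact h2.enorm.pow_const 2
    exact (h1.indicator hT).comp (measurable_const.sub measurable_id)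
  set D : ℝ := (Real.exp (-L) * blockProd π ξ)⁻¹ *
        (Real.exp (-L / Fintype.card ι) * ‖ξ‖) ^ (-p)
  have hD : 0 ≤ D := by positivity
  have hM : 0 ≤ M := by positivity
  have hpt : ∀ y, ENNReal.ofReal (blockProd π y)⁻¹ * Φ (polarLog π v₀ y) ≤
      ENNReal.ofReal (M * D) * (‖𝓕 F y‖ₑ ^ 2 * ENNReal.ofReal (‖y‖ ^ p)) := fun y ↦ by
    by_cases hy : blockProd π y = 0
    · simp [hy]
    by_cases hyT : q₀ - polarLog π v₀ y ∈ T
    swap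
    · simp [Φ, hyT]
    have hNy : 0 < blockProd π y := lt_of_le_of_ne (blockProd_nonneg _) (Ne.symm hy)
    have hbn : ∀ v, blockNorm π v (blockScale π (-polarExp π v₀ (q₀ - polarLog π v₀ y)) ξ) =
        blockNorm π v y := fun v ↦ by
      rw [← polarExp_neg, neg_sub]
      exact blockNorm_blockScale_polarLog_sub hπ hy hξ v
    have hle := le_norm_blockScale_neg_polarExp hπ hyT ξ
    rw [norm_eq_of_blockNorm_eq hbn] at hle
    have h2 : Real.log (blockProd π ξ) - Real.log (blockProd π y) ≤ L + 1 := by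
      have h3 : (q₀ - polarLog π v₀ y) ∈ Metric.closedBall (0 : {v : V // v ≠ v₀} → ℝ) 1 ×ˢ
        Metric.closedBall L 1 := by rw [closedBall_prod_same]; exact hyT
      have h4 := abs_le.mp (Real.dist_eq _ _ ▸ Metric.mem_closedBall.mp h3.2)
      have : (q₀ - polarLog π v₀ y).2 = Real.log (blockProd π ξ) - Real.log (blockProd π y) := rfl
      linarith [h4.2]
    have h3 : Real.exp (-L) * blockProd π ξ ≤ Real.exp 1 * blockProd π y := by
      rw [← Real.log_le_log_iff (by positivity) (by positivity),
        Real.log_mul (by positivity) (by positivity), Real.log_mul (by positivity) (by positivity),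
        Real.log_exp, Real.log_exp]
      linarith
    have h4 : (blockProd π y)⁻¹ ≤ Real.exp 1 * (Real.exp (-L) * blockProd π ξ)⁻¹ := by
      rw [inv_le_comm₀ hNy (by positivity), mul_inv, inv_inv, inv_mul_le_iff₀ (by positivity)]
      exact h3
    have h5 : 1 ≤ Real.exp (-(Fintype.card V + 1)) ^ (-p) *
        (Real.exp (-L / Fintype.card ι) * ‖ξ‖) ^ (-p) * ‖y‖ ^ p := by
      rw [← Real.mul_rpow (by positivity) (by positivity), Real.rpow_neg (by positivity),
        inv_mul_eq_div, one_le_div (by positivity)]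
      exact Real.rpow_le_rpow (by positivity) hle (by linarith)
    have h6 : (blockProd π y)⁻¹ ≤ M * D * ‖y‖ ^ p := by
      calc (blockProd π y)⁻¹ ≤ Real.exp 1 * (Real.exp (-L) * blockProd π ξ)⁻¹ * 1 := by
            rw [mul_one]; exact h4
        _ ≤ Real.exp 1 * (Real.exp (-L) * blockProd π ξ)⁻¹ *
            (Real.exp (-(Fintype.card V + 1)) ^ (-p) *
              (Real.exp (-L / Fintype.card ι) * ‖ξ‖) ^ (-p) * ‖y‖ ^ p) := by gcongr
        _ = _ := by simp only [M, D]; ring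
    have h7 : Φ (polarLog π v₀ y) = ‖𝓕 F y‖ₑ ^ 2 := by
      simp only [Φ, indicator_of_mem hyT, fourier_polarFun_eq_of_blockNorm_eq hF hbn]
    rw [h7]
    refine (mul_le_mul_left (ENNReal.ofReal_le_ofReal h6) _).trans (le_of_eq ?_)
    rw [ENNReal.ofReal_mul (by positivity)]
    ring
  have hHaar : (volume : Measure (({v : V // v ≠ v₀} → ℝ) × ℝ)).IsAddHaarMeasure :=
    Measure.prod.instIsAddHaarMeasure _ _
  have key : c * ∫⁻ q in T, ‖𝓕 F (blockScale π (-polarExp π v₀ q) ξ)‖ₑ ^ 2 ≤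
      ENNReal.ofReal (M * D) * (C₁ * ENNReal.ofReal (h ^ (3 - p))) := by
    calc c * ∫⁻ q in T, ‖𝓕 F (blockScale π (-polarExp π v₀ q) ξ)‖ₑ ^ 2
        = c * ∫⁻ q, Φ (q₀ - q) := by
          rw [← lintegral_indicator hT]
          simp only [Φ, sub_sub_cancel]
      _ = ∫⁻ q, Φ q ∂(c • volume) := by
          rw [lintegral_sub_left_eq_self Φ q₀, lintegral_smul_measure]; rfl
      _ = ∫⁻ y, Φ (polarLog π v₀ y) ∂scaleMeasure π := by
          rw [← hc, lintegral_map hΦ measurable_polarLog]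
      _ = ∫⁻ y, ENNReal.ofReal (blockProd π y)⁻¹ * Φ (polarLog π v₀ y) :=
          lintegral_withDensity_eq_lintegral_mul _ measurable_inv_blockProd
            (hΦ.comp measurable_polarLog)
      _ ≤ ∫⁻ y, ENNReal.ofReal (M * D) * (‖𝓕 F y‖ₑ ^ 2 * ENNReal.ofReal (‖y‖ ^ p)) :=
          lintegral_mono hpt
      _ = ENNReal.ofReal (M * D) * ∫⁻ y, ‖𝓕 F y‖ₑ ^ 2 * ENNReal.ofReal (‖y‖ ^ p) :=
          lintegral_const_mul' _ _ ENNReal.ofReal_ne_top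
      _ ≤ _ := by gcongr; exact hC₁ h f F hh hh1 hf hF
  have hcE : (c : ℝ≥0∞) ≠ 0 := by simpa using hc0
  calc ∫⁻ q in T, ‖𝓕 F (blockScale π (-polarExp π v₀ q) ξ)‖ₑ ^ 2
      = (c : ℝ≥0∞)⁻¹ * (c * ∫⁻ q in T, ‖𝓕 F (blockScale π (-polarExp π v₀ q) ξ)‖ₑ ^ 2) := by
        rw [← mul_assoc, ENNReal.inv_mul_cancel hcE ENNReal.coe_ne_top, one_mul]
    _ ≤ (c : ℝ≥0∞)⁻¹ * (ENNReal.ofReal (M * D) * (C₁ * ENNReal.ofReal (h ^ (3 - p)))) := by gcongr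
    _ = _ := by
        rw [ENNReal.ofReal_mul hM, ENNReal.coe_mul, ENNReal.coe_mul, ENNReal.coe_inv hc0]
        simp only [ENNReal.ofReal]
        ring

theorem exists_lintegral_fourier_blockScale_le (hπ : Function.Surjective π)
    (A : Finset ℝ) {α β : ℝ} (R : ℝ) (B : ℕ → ℝ) (hα : 0 < α) {b : ({v : V // v ≠ v₀} → ℝ) → ℝ}
    (hbs : ContDiff ℝ ∞ b) (hb : HasCompactSupport b) {p : ℝ} (hp : 4 ≤ p) :
    ∃ C : ℝ≥0, ∀ h f (F : 𝓢(EuclideanSpace ℝ ι, ℂ)), 0 < h → h ≤ 1 / 2 →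
      IsSmoothedPiecewiseLinear A α β R B h f → (∀ y, F y = (polarFun π v₀ f b y : ℂ)) →
      ∀ ξ, blockProd π ξ ≠ 0 → ∀ L : ℝ,
      ∫⁻ q in Metric.closedBall (0 : {v : V // v ≠ v₀} → ℝ) 1 ×ˢ Icc (L - 2 * h) (L + 2 * h),
        ‖𝓕 F (blockScale π (-polarExp π v₀ q) ξ)‖ₑ ≤
      C * ENNReal.ofReal (h ^ ((4 - p) / 2)) *
        ENNReal.ofReal ((Real.exp (-L) * blockProd π ξ) ^ (-(1 / 2) : ℝ) *
        (Real.exp (-L / Fintype.card ι) * ‖ξ‖) ^ (-p / 2)) := by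
  obtain ⟨C, hC⟩ := exists_lintegral_fourier_blockScale_sq_le hπ A (β := β) R B hα hbs hb hp
  set U := Metric.closedBall (0 : {v : V // v ≠ v₀} → ℝ) 1
  have hU : volume U ≠ ⊤ := measure_closedBall_lt_top.ne
  refine ⟨(C * (volume U).toNNReal * 4) ^ (1 / 2 : ℝ), fun h f F hh hh1 hf hF ξ hξ L ↦ ?_⟩
  have hNξ : 0 < blockProd π ξ := lt_of_le_of_ne (blockProd_nonneg _) (Ne.symm hξ)
  set W := U ×ˢ Icc (L - 2 * h) (L + 2 * h)
  have hW : W ⊆ Metric.closedBall (0, L) 1 := by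
    rw [← closedBall_prod_same]
    refine prod_mono le_rfl fun s hs ↦ ?_
    rw [Real.closedBall_eq_Icc]
    exact ⟨by linarith [hs.1], by linarith [hs.2]⟩
  have hmeas : Measurable fun q : ({v : V // v ≠ v₀} → ℝ) × ℝ ↦
      ‖𝓕 F (blockScale π (-polarExp π v₀ q) ξ)‖ₑ := by
    have h2 := ((𝓕 F).continuous.comp
      ((continuous_blockScale_apply (v₀ := v₀) (π := π) ξ).comp continuous_neg)).measurable
    simp only [Function.comp_def, polarExp_neg] at h2
    exact h2.enorm
  have hvol : volume W = volume U * ENNReal.ofReal (4 * h) := by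
    rw [Measure.volume_eq_prod, Measure.prod_prod, Real.volume_Icc]
    congr 2; ring
  have hCS := ENNReal.lintegral_mul_le_Lp_mul_Lq (volume.restrict W) Real.HolderConjugate.two_two
    hmeas.aemeasurable (aemeasurable_const (b := 1))
  simp only [Pi.mul_apply, mul_one, ENNReal.one_rpow, lintegral_const, one_mul,
    Measure.restrict_apply_univ] at hCS
  set D : ℝ := (Real.exp (-L) * blockProd π ξ)⁻¹ *
        (Real.exp (-L / Fintype.card ι) * ‖ξ‖) ^ (-p)
  have hD : 0 ≤ D := by positivity
  have h1 : ∫⁻ q in W, ‖𝓕 F (blockScale π (-polarExp π v₀ q) ξ)‖ₑ ^ (2 : ℝ) ≤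
      C * ENNReal.ofReal (h ^ (3 - p)) * ENNReal.ofReal D := by
    refine le_trans ?_ (hC h f F hh (by linarith) hf hF ξ hξ L)
    simp only [ENNReal.rpow_ofNat]
    exact lintegral_mono_set hW
  refine hCS.trans ?_
  rw [← ENNReal.mul_rpow_of_nonneg _ _ (by norm_num)]
  have h2 : (h ^ (3 - p) * h) ^ (1 / 2 : ℝ) = h ^ ((4 - p) / 2) := by
    rw [show h ^ (3 - p) * h = h ^ (4 - p) by
      rw [← Real.rpow_add_one hh.ne']; congr 1; ring, ← Real.rpow_mul hh.le]
    congr 1; ring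
  have h3 : D ^ (1 / 2 : ℝ) = (Real.exp (-L) * blockProd π ξ) ^ (-(1 / 2) : ℝ) *
        (Real.exp (-L / Fintype.card ι) * ‖ξ‖) ^ (-p / 2) := by
    rw [Real.mul_rpow (by positivity) (by positivity), Real.inv_rpow (by positivity),
      ← Real.rpow_neg (by positivity), ← Real.rpow_mul (by positivity)]
    congr 2; ring
  calc _ ≤ (C * ENNReal.ofReal (h ^ (3 - p)) * ENNReal.ofReal D * volume W) ^ (1 / 2 : ℝ) := by
        gcongr
    _ = ((C * (volume U).toNNReal * 4 : ℝ≥0) * ENNReal.ofReal (h ^ (3 - p) * h) *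
          ENNReal.ofReal D) ^ (1 / 2 : ℝ) := by
        rw [hvol, ENNReal.ofReal_mul (by norm_num : (0 : ℝ) ≤ 4),
          ENNReal.ofReal_mul (p := h ^ (3 - p)) (by positivity), ENNReal.coe_mul, ENNReal.coe_mul,
          ENNReal.coe_toNNReal hU, ENNReal.ofReal_ofNat]
        push_cast
        ring_nf
    _ = _ := by
        rw [ENNReal.mul_rpow_of_nonneg _ _ (by norm_num), ENNReal.mul_rpow_of_nonneg _ _ (by norm_num),
          ENNReal.ofReal_rpow_of_nonneg (by positivity) (by norm_num),
          ENNReal.ofReal_rpow_of_nonneg (by positivity) (by norm_num), h2, h3,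
          ENNReal.coe_rpow_of_nonneg _ (by norm_num)]

end PolarDual

section PolarPoisson

open scoped ENNReal NNReal ContDiff FourierTransform SchwartzMap RealInnerProductSpace

variable {ι V : Type*} [Fintype ι] [Fintype V] [DecidableEq V] {π : ι → V} {v₀ : V}

theorem enorm_tsum_polarFun_sub_le (hπ : Function.Surjective π)
    {f : ℝ → ℝ} {b : ({v : V // v ≠ v₀} → ℝ) → ℝ}
    {F : 𝓢(EuclideanSpace ℝ ι, ℂ)} (hF : ∀ y, F y = (polarFun π v₀ f b y : ℂ))
    (hFc : HasCompactSupport F)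
    (L L' : EuclideanSpace ℝ ι ≃L[ℝ] EuclideanSpace ℝ ι) (hLL' : ∀ x y, ⟪L' x, L y⟫ = ⟪x, y⟫)
    (q : ({v : V // v ≠ v₀} → ℝ) × ℝ) :
    ‖∑' m, polarFun π v₀ f b (blockScale π (polarExp π v₀ q) (L (intVec m))) -
      Real.exp (-q.2) *
        |LinearMap.det (L : EuclideanSpace ℝ ι →ₗ[ℝ] EuclideanSpace ℝ ι)|⁻¹ *
        ∫ y, polarFun π v₀ f b y‖ₑ ≤
    ENNReal.ofReal (Real.exp (-q.2) *
        |LinearMap.det (L : EuclideanSpace ℝ ι →ₗ[ℝ] EuclideanSpace ℝ ι)|⁻¹) *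
      ∑' m : ι → ℤ, if m = 0 then 0 else
        ‖𝓕 F (blockScale π (-polarExp π v₀ q) (L' (intVec m)))‖ₑ := by
  classical
  set D := LinearMap.det (L : EuclideanSpace ℝ ι →ₗ[ℝ] EuclideanSpace ℝ ι)
  set A := L.trans (blockScale π (polarExp π v₀ q))
  set A' := L'.trans (blockScale π (-polarExp π v₀ q))
  have hAA' : ∀ x y, ⟪A' x, A y⟫ = ⟪x, y⟫ := fun x y ↦ by
    simp only [A, A', ContinuousLinearEquiv.trans_apply, inner_blockScale, hLL']
  have hdet : |LinearMap.det (A : EuclideanSpace ℝ ι →ₗ[ℝ] EuclideanSpace ℝ ι)|⁻¹ =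
      Real.exp (-q.2) * |D|⁻¹ := by
    have h1 : (A : EuclideanSpace ℝ ι →ₗ[ℝ] EuclideanSpace ℝ ι) =
        (blockScale π (polarExp π v₀ q) : EuclideanSpace ℝ ι →ₗ[ℝ] EuclideanSpace ℝ ι).comp
          (L : EuclideanSpace ℝ ι →ₗ[ℝ] EuclideanSpace ℝ ι) := rfl
    rw [h1, LinearMap.det_comp, det_blockScale, sum_blockDim_mul_polarExp hπ, abs_mul,
      abs_of_pos (Real.exp_pos _), mul_inv, Real.exp_neg]
  have hP := poisson_lattice F hFc A A' hAA'
  rw [hdet, (SchwartzMap.summable_intVec (𝓕 F) A').tsum_eq_add_tsum_ite 0] at hP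
  have hA0 : A' (intVec 0) = 0 := by rw [intVec_zero, map_zero]
  have hF0 : 𝓕 F 0 = ((∫ y, polarFun π v₀ f b y : ℝ) : ℂ) := by
    rw [SchwartzMap.fourier_coe, Real.fourier_eq]
    simp [hF, integral_complex_ofReal]
  have hreal : (∑' m, F (A (intVec m))) = ((∑' m, polarFun π v₀ f b
      (blockScale π (polarExp π v₀ q) (L (intVec m))) : ℝ) : ℂ) := by
    rw [Complex.ofReal_tsum]
    exact tsum_congr fun m ↦ hF _
  rw [hreal, hA0, hF0] at hP
  have hE : 0 ≤ Real.exp (-q.2) * |D|⁻¹ := by positivity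
  have h3 : ‖∑' m, polarFun π v₀ f b (blockScale π (polarExp π v₀ q) (L (intVec m))) -
      Real.exp (-q.2) * |D|⁻¹ * ∫ y, polarFun π v₀ f b y‖ₑ =
      ‖((Real.exp (-q.2) * |D|⁻¹ : ℝ) : ℂ) *
        ∑' m : ι → ℤ, if m = 0 then 0 else 𝓕 F (A' (intVec m))‖ₑ := by
    rw [← ofReal_norm, ← ofReal_norm, ← Complex.norm_real]
    congr 2
    push_cast at hP ⊢
    rw [hP]
    ring
  rw [h3, enorm_mul, ← ofReal_norm (((Real.exp (-q.2) * |D|⁻¹ : ℝ) : ℂ)), Complex.norm_real,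
    Real.norm_of_nonneg hE]
  gcongr
  refine enorm_tsum_le_tsum_enorm.trans (le_of_eq (tsum_congr fun m ↦ ?_))
  split_ifs <;> simp [A']

theorem exists_lintegral_tsum_polarFun_sub_le (hπ : Function.Surjective π)
    (A : Finset ℝ) {α β : ℝ} (R : ℝ) (B : ℕ → ℝ) (hα : 0 < α) {b : ({v : V // v ≠ v₀} → ℝ) → ℝ}
    (hbs : ContDiff ℝ ∞ b) (hb : HasCompactSupport b) {p : ℝ} (hp : 4 ≤ p)
    (hpn : Fintype.card ι ≤ p)
    (L L' : EuclideanSpace ℝ ι ≃L[ℝ] EuclideanSpace ℝ ι) (hLL' : ∀ x y, ⟪L' x, L y⟫ = ⟪x, y⟫)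
    (hne : ∀ m, m ≠ 0 → blockProd π (L' (intVec m)) ≠ 0)
    (hsum : Summable fun m : ι → ℤ ↦
      blockProd π (L' (intVec m)) ^ (-(1 / 2) : ℝ) * ‖L' (intVec m)‖ ^ (-p / 2)) :
    ∃ c C : ℝ, ∀ h f Y (S : ℝ → ℝ), 0 < h → h ≤ 1 / 4 → 1 ≤ Y →
      IsSmoothedPiecewiseLinear A α β R B h f →
      (∀ z s, S (Real.exp s) = ∑' m, polarFun π v₀ f b
        (blockScale π (polarExp π v₀ (z, s)) (L (intVec m)))) →
      ∫⁻ μ in Icc (1 - h) (1 + h), ‖S (μ / Y) - c * (Y / μ) * ∫ v, f v‖ₑ ≤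
        ENNReal.ofReal (C * h ^ ((4 - p) / 2)) := by
  obtain ⟨c₀, -, hc₀⟩ := exists_integral_polarFun_eq hπ v₀
  obtain ⟨C, hC⟩ := exists_lintegral_fourier_blockScale_le hπ A (β := β) R B hα hbs hb hp
  set D := LinearMap.det (L : EuclideanSpace ℝ ι →ₗ[ℝ] EuclideanSpace ℝ ι)
  set U := Metric.closedBall (0 : {v : V // v ≠ v₀} → ℝ) 1
  have hU : volume U ≠ ⊤ := measure_closedBall_lt_top.ne
  have hU0 : volume U ≠ 0 := (Metric.measure_closedBall_pos _ _ one_pos).ne'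
  have hUr : 0 < (volume U).toReal := ENNReal.toReal_pos hU0 hU
  set T₀ := ∑' m : ι → ℤ,
      blockProd π (L' (intVec m)) ^ (-(1 / 2) : ℝ) * ‖L' (intVec m)‖ ^ (-p / 2)
  have hterm : ∀ m : ι → ℤ, 0 ≤
      blockProd π (L' (intVec m)) ^ (-(1 / 2) : ℝ) * ‖L' (intVec m)‖ ^ (-p / 2) := fun m ↦
    mul_nonneg (Real.rpow_nonneg (blockProd_nonneg _) _) (by positivity)
  refine ⟨|D|⁻¹ * (c₀ * ∫ z, b z), |D|⁻¹ * C * T₀ / (volume U).toReal,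
    fun h f Y S hh hh1 hY hf hS ↦ ?_⟩
  have hY0 : 0 < Y := by linarith
  have hfc : HasCompactSupport (polarFun π v₀ f b) :=
    hasCompactSupport_polarFun hπ hα hf.support_subset hb
  have hfs : ContDiff ℝ ∞ (polarFun π v₀ f b) :=
    contDiff_polarFun hπ hα hf.contDiff hf.support_subset hbs hb
  have hFc : HasCompactSupport fun y ↦ (polarFun π v₀ f b y : ℂ) :=
    hfc.comp_left Complex.ofReal_zero
  set F : 𝓢(EuclideanSpace ℝ ι, ℂ) := hFc.toSchwartzMap (Complex.ofRealCLM.contDiff.comp hfs)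
  have hF : ∀ y, F y = (polarFun π v₀ f b y : ℂ) := fun y ↦ rfl
  have hInt : ∫ y, polarFun π v₀ f b y = c₀ * (∫ z, b z) * ∫ v, f v :=
    hc₀ f b α β hα hf.support_subset hf.contDiff.continuous.measurable hbs.continuous.measurable
  set W := Icc (-Real.log Y - 2 * h) (-Real.log Y + 2 * h)
  let g : (ι → ℤ) → ({v : V // v ≠ v₀} → ℝ) × ℝ → ℝ≥0∞ := fun m q ↦ if m = 0 then 0 else
        ‖𝓕 F (blockScale π (-polarExp π v₀ q) (L' (intVec m)))‖ₑ
  have hg : ∀ m, Measurable (g m) := fun m ↦ by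
    by_cases hm : m = 0
    · simp only [g, hm, if_true]
      exact measurable_const
    have h2 := ((𝓕 F).continuous.comp
      ((continuous_blockScale_apply (v₀ := v₀) (π := π) (L' (intVec m))).comp
        continuous_neg)).measurable
    simp only [Function.comp_def, polarExp_neg] at h2
    simp only [g, hm, if_false]
    exact h2.enorm
  have hsub : Icc (1 - h) (1 + h) ⊆ (fun s ↦ Y * Real.exp s) '' W := fun μ hμ ↦ by
    have hμ0 : 0 < μ := by linarith [hμ.1]
    refine ⟨Real.log (μ / Y), ?_, ?_⟩
    · rw [Real.log_div hμ0.ne' hY0.ne']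
      have h1 := Real.log_le_sub_one_of_pos hμ0
      have h2 := Real.one_sub_inv_le_log_of_pos hμ0
      have h3 : 1 - 2 * h ≤ 2 - μ⁻¹ - h * 0 ∧ -(2 * h) ≤ 1 - μ⁻¹ := by
        have : μ⁻¹ ≤ 1 + 2 * h := by
          rw [inv_le_comm₀ hμ0 (by linarith)]
          refine le_trans ?_ hμ.1
          rw [inv_le_iff_one_le_mul₀ (by linarith)]
          nlinarith
        constructor <;> linarith
      exact ⟨by linarith [h3.2], by linarith [hμ.2]⟩
    · simp only
      rw [Real.exp_log (by positivity)]
      field_simp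
  set I : ℝ≥0∞ := ∫⁻ μ in Icc (1 - h) (1 + h),
    ‖S (μ / Y) - |D|⁻¹ * (c₀ * ∫ z, b z) * (Y / μ) * ∫ v, f v‖ₑ
  have hI : ∀ z, I ≤ ∫⁻ s in W, ENNReal.ofReal (Y * |D|⁻¹) * ∑' m, g m (z, s) := fun z ↦ by
    calc I ≤ ∫⁻ μ in (fun s ↦ Y * Real.exp s) '' W,
            ‖S (μ / Y) - |D|⁻¹ * (c₀ * ∫ z, b z) * (Y / μ) * ∫ v, f v‖ₑ := lintegral_mono_set hsub
      _ = ∫⁻ s in W, ENNReal.ofReal |Y * Real.exp s| *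
          ‖S (Y * Real.exp s / Y) - |D|⁻¹ * (c₀ * ∫ z, b z) * (Y / (Y * Real.exp s)) *
            ∫ v, f v‖ₑ :=
          lintegral_image_eq_lintegral_abs_deriv_mul measurableSet_Icc
            (fun s _ ↦ ((Real.hasDerivAt_exp s).const_mul Y).hasDerivWithinAt)
            (fun s _ t _ hst ↦ Real.exp_injective (mul_left_cancel₀ hY0.ne' hst)) _
      _ ≤ _ := lintegral_mono fun s ↦ by
          have h1 := enorm_tsum_polarFun_sub_le hπ hF hFc L L' hLL' (z, s)
          rw [← hS z s, hInt] at h1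
          have h2 : Y * Real.exp s / Y = Real.exp s := by field_simp
          have h3 : |D|⁻¹ * (c₀ * ∫ z, b z) * (Y / (Y * Real.exp s)) * ∫ v, f v =
              Real.exp (-s) * |D|⁻¹ * (c₀ * (∫ z, b z) * ∫ v, f v) := by
            rw [Real.exp_neg]; field_simp
          rw [h2, h3]
          refine (mul_le_mul_right h1 _).trans (le_of_eq ?_)
          rw [← mul_assoc, ← ENNReal.ofReal_mul (abs_nonneg _), abs_of_pos (by positivity)]
          congr 2
          simp only
          rw [Real.exp_neg]; field_simp; rfl
  have hbound : ∀ m, ENNReal.ofReal (Y * |D|⁻¹) * ∫⁻ q in U ×ˢ W, g m q ≤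
      ENNReal.ofReal (|D|⁻¹ * C * h ^ ((4 - p) / 2)) * ENNReal.ofReal
        (blockProd π (L' (intVec m)) ^ (-(1 / 2) : ℝ) * ‖L' (intVec m)‖ ^ (-p / 2)) := fun m ↦ by
    by_cases hm : m = 0
    · simp [g, hm]
    have h1 := hC h f F hh (by linarith) hf hF _ (hne m hm) (-Real.log Y)
    simp only [g, hm, if_false]
    refine (mul_le_mul_right h1 _).trans ?_
    have hN := blockProd_nonneg (π := π) (L' (intVec m))
    rw [neg_neg, Real.exp_log hY0, Real.mul_rpow hY0.le hN,
      Real.mul_rpow (Real.exp_pos _).le (norm_nonneg _), ENNReal.ofReal_mul hY0.le]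
    have h2 : Y * (Y ^ (-(1 / 2) : ℝ) *
        Real.exp (Real.log Y / Fintype.card ι) ^ (-p / 2)) ≤ 1 := by
      rw [← Real.exp_mul, Real.rpow_def_of_pos hY0]
      nth_rewrite 1 [← Real.exp_log hY0]
      rw [← Real.exp_add, ← Real.exp_add, Real.exp_le_one_iff]
      have hn : (0 : ℝ) < Fintype.card ι := by exact_mod_cast card_pos_of_surjective hπ v₀
      have h3 := Real.log_nonneg hY
      have h4 : 1 ≤ p / Fintype.card ι := by rwa [one_le_div hn]
      have : Real.log Y + (Real.log Y * -(1 / 2) + Real.log Y / Fintype.card ι * (-p / 2)) =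
          Real.log Y / 2 * (1 - p / Fintype.card ι) := by field_simp; ring
      rw [this]
      exact mul_nonpos_of_nonneg_of_nonpos (by positivity) (by linarith)
    have h5 := ENNReal.ofReal_le_ofReal (mul_le_of_le_one_left (hterm m) h2)
    refine le_trans (le_of_eq ?_) (mul_le_mul_right h5 _)
    rw [show (C : ℝ≥0∞) = ENNReal.ofReal C by simp]
    simp only [← ENNReal.ofReal_mul hY0.le]
    rw [← ENNReal.ofReal_mul (NNReal.coe_nonneg C), ← ENNReal.ofReal_mul (by positivity),
      ← ENNReal.ofReal_mul (by positivity), ← ENNReal.ofReal_mul (by positivity)]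
    congr 1
    ring
  have hfin : I * volume U ≤ ENNReal.ofReal (|D|⁻¹ * C * h ^ ((4 - p) / 2) * T₀) := by
    calc I * volume U = ∫⁻ z in U, I := by rw [setLIntegral_const]
      _ ≤ ∫⁻ z in U, ∫⁻ s in W, ENNReal.ofReal (Y * |D|⁻¹) * ∑' m, g m (z, s) :=
          lintegral_mono fun z ↦ hI z
      _ = ∫⁻ q in U ×ˢ W, ENNReal.ofReal (Y * |D|⁻¹) * ∑' m, g m q := by
          rw [Measure.volume_eq_prod, ← Measure.prod_restrict, lintegral_prod]
          exact ((Measurable.tsum hg).const_mul _).aemeasurable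
      _ = ENNReal.ofReal (Y * |D|⁻¹) * ∑' m, ∫⁻ q in U ×ˢ W, g m q := by
          rw [lintegral_const_mul' _ _ ENNReal.ofReal_ne_top,
            lintegral_tsum fun m ↦ (hg m).aemeasurable]
      _ = ∑' m, ENNReal.ofReal (Y * |D|⁻¹) * ∫⁻ q in U ×ˢ W, g m q := ENNReal.tsum_mul_left.symm
      _ ≤ ∑' m, ENNReal.ofReal (|D|⁻¹ * C * h ^ ((4 - p) / 2)) * ENNReal.ofReal
          (blockProd π (L' (intVec m)) ^ (-(1 / 2) : ℝ) * ‖L' (intVec m)‖ ^ (-p / 2)) :=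
          ENNReal.tsum_le_tsum hbound
      _ = _ := by
          rw [ENNReal.tsum_mul_left, ← ENNReal.ofReal_tsum_of_nonneg hterm hsum,
            ← ENNReal.ofReal_mul (by positivity)]
  have h9 : I ≤ ENNReal.ofReal (|D|⁻¹ * C * h ^ ((4 - p) / 2) * T₀) / volume U :=
    (ENNReal.le_div_iff_mul_le (Or.inl hU0) (Or.inl hU)).mpr hfin
  refine h9.trans (le_of_eq ?_)
  conv_lhs => rw [← ENNReal.ofReal_toReal hU]
  rw [← ENNReal.ofReal_div_of_pos hUr]
  congr 1
  ring

end PolarPoisson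

section LatticeVec

open NumberField.InfinitePlace NumberField.mixedEmbedding Module
open scoped RealInnerProductSpace

variable (K : Type*) [Field K]

/-- The infinite place to which a coordinate of the mixed space belongs. -/
def placeOf : index K → InfinitePlace K := Sum.elim (fun w ↦ w.1) (fun p ↦ p.1.1)

lemma placeOf_surjective : Function.Surjective (placeOf K) := fun w ↦ by
  rcases w.isReal_or_isComplex with hw | hw
  · exact ⟨Sum.inl ⟨w, hw⟩, rfl⟩
  · exact ⟨Sum.inr (⟨w, hw⟩, 0), rfl⟩

noncomputable instance : DecidableEq (InfinitePlace K) := Classical.decEq _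

noncomputable instance : DecidablePred (IsReal (K := K)) := Classical.decPred _

noncomputable instance : DecidablePred (IsComplex (K := K)) := Classical.decPred _

variable [NumberField K]

lemma card_index : Fintype.card (index K) = finrank ℚ K := by
  rw [← mixedEmbedding.finrank K, ← Module.finrank_eq_card_basis (stdBasis K)]

variable {K}

lemma sum_filter_placeOf_isReal (g : index K → ℝ) {w : InfinitePlace K} (hw : w.IsReal) :
    ∑ i with placeOf K i = w, g i = g (Sum.inl ⟨w, hw⟩) := by
  rw [Finset.sum_filter, Fintype.sum_sum_type]
  have h2 : ∀ p : {w : InfinitePlace K // IsComplex w} × Fin 2,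
      (if placeOf K (Sum.inr p) = w then g (Sum.inr p) else 0) = 0 := fun p ↦
    if_neg fun h ↦ not_isReal_iff_isComplex.mpr p.1.2 (by rw [show p.1.1 = w from h]; exact hw)
  rw [Finset.sum_congr rfl fun p _ ↦ h2 p, Finset.sum_const_zero, add_zero,
    Finset.sum_eq_single (⟨w, hw⟩ : {w : InfinitePlace K // IsReal w})]
  · exact if_pos rfl
  · exact fun b _ hb ↦ if_neg fun h ↦ hb (Subtype.ext h)
  · simp

lemma sum_filter_placeOf_isComplex (g : index K → ℝ) {w : InfinitePlace K} (hw : w.IsComplex) :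
    ∑ i with placeOf K i = w, g i = g (Sum.inr (⟨w, hw⟩, 0)) + g (Sum.inr (⟨w, hw⟩, 1)) := by
  rw [Finset.sum_filter, Fintype.sum_sum_type]
  have h2 : ∀ p : {w : InfinitePlace K // IsReal w},
      (if placeOf K (Sum.inl p) = w then g (Sum.inl p) else 0) = 0 := fun p ↦
    if_neg fun h ↦ not_isReal_iff_isComplex.mpr hw (by rw [← show p.1 = w from h]; exact p.2)
  rw [Finset.sum_congr rfl fun p _ ↦ h2 p, Finset.sum_const_zero, zero_add,
    Fintype.sum_prod_type, Finset.sum_eq_single (⟨w, hw⟩ : {w : InfinitePlace K // IsComplex w})]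
  · rw [Fin.sum_univ_two, if_pos (by rfl), if_pos (by rfl)]
  · exact fun b _ hb ↦ Finset.sum_eq_zero fun j _ ↦ if_neg fun h ↦ hb (Subtype.ext h)
  · simp

lemma blockDim_placeOf (w : InfinitePlace K) : blockDim (placeOf K) w = w.mult := by
  have h : (blockDim (placeOf K) w : ℝ) = ∑ i with placeOf K i = w, 1 := by
    simp [blockDim]
  rcases w.isReal_or_isComplex with hw | hw
  · rw [sum_filter_placeOf_isReal _ hw] at h
    rw [mult_isReal ⟨w, hw⟩]
    exact_mod_cast h
  · rw [sum_filter_placeOf_isComplex _ hw] at h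
    rw [mult_isComplex ⟨w, hw⟩]
    norm_num at h
    exact_mod_cast h

variable (K) in
/-- The Euclidean coordinates of the mixed embedding. -/
noncomputable def latticeVec : K →+ EuclideanSpace ℝ (index K) where
  toFun x := WithLp.toLp 2 fun i ↦ (stdBasis K).repr (mixedEmbedding K x) i
  map_zero' := by ext; simp
  map_add' x y := by ext; simp

lemma latticeVec_inl (x : K) (w : {w : InfinitePlace K // IsReal w}) :
    latticeVec K x (Sum.inl w) = (w.1.embedding x).re := by
  change (mixedEmbedding K x).1 w = _
  rw [mixedEmbedding_apply_isReal, ← embedding_of_isReal_apply w.2, Complex.ofReal_re]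

lemma latticeVec_inr_zero (x : K) (w : {w : InfinitePlace K // IsComplex w}) :
    latticeVec K x (Sum.inr (w, 0)) = (w.1.embedding x).re := rfl

lemma latticeVec_inr_one (x : K) (w : {w : InfinitePlace K // IsComplex w}) :
    latticeVec K x (Sum.inr (w, 1)) = (w.1.embedding x).im := rfl

lemma embedding_im_of_isReal {w : InfinitePlace K} (hw : w.IsReal) (x : K) :
    (w.embedding x).im = 0 := by
  rw [← embedding_of_isReal_apply hw, Complex.ofReal_im]

lemma blockNorm_latticeVec (w : InfinitePlace K) (x : K) :
    blockNorm (placeOf K) w (latticeVec K x) = w x := by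
  have h : w x ^ 2 = (w.embedding x).re ^ 2 + (w.embedding x).im ^ 2 := by
    rw [← norm_embedding_eq, Complex.sq_norm, Complex.normSq_apply]
    ring
  rw [blockNorm, ← Real.sqrt_sq (apply_nonneg w x), h]
  congr 1
  rcases w.isReal_or_isComplex with hw | hw
  · rw [sum_filter_placeOf_isReal _ hw, latticeVec_inl, embedding_im_of_isReal hw]
    ring
  · rw [sum_filter_placeOf_isComplex _ hw, latticeVec_inr_zero, latticeVec_inr_one]

lemma blockProd_latticeVec (x : K) :
    blockProd (placeOf K) (latticeVec K x) = |(Algebra.norm ℚ x : ℝ)| := by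
  simp_rw [blockProd, blockNorm_latticeVec, blockDim_placeOf, prod_eq_abs_norm]
  simp

variable (K) in
/-- The diagonal map turning the trace form into the Euclidean inner product. -/
noncomputable def traceTwist : EuclideanSpace ℝ (index K) →ₗ[ℝ] EuclideanSpace ℝ (index K) where
  toFun y := WithLp.toLp 2 fun i ↦
    Sum.elim (fun _ ↦ (1 : ℝ)) (fun p ↦ if p.2 = 0 then 2 else -2) i * y i
  map_add' y y' := by ext i; simp [mul_add]
  map_smul' c y := by ext i; simp; ring

lemma traceTwist_apply (y : EuclideanSpace ℝ (index K)) (i : index K) : traceTwist K y i =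
    Sum.elim (fun _ ↦ (1 : ℝ)) (fun p ↦ if p.2 = 0 then 2 else -2) i * y i := rfl

lemma blockNorm_traceTwist (w : InfinitePlace K) (y : EuclideanSpace ℝ (index K)) :
    blockNorm (placeOf K) w (traceTwist K y) = w.mult * blockNorm (placeOf K) w y := by
  rw [blockNorm, blockNorm, ← Real.sqrt_sq (Nat.cast_nonneg w.mult),
    ← Real.sqrt_mul (sq_nonneg _), Finset.mul_sum]
  congr 1
  rcases w.isReal_or_isComplex with hw | hw
  · simp_rw [sum_filter_placeOf_isReal _ hw, traceTwist_apply, mult_isReal ⟨w, hw⟩]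
    simp
  · simp_rw [sum_filter_placeOf_isComplex _ hw, traceTwist_apply, mult_isComplex ⟨w, hw⟩]
    simp
    ring

lemma inner_traceTwist_latticeVec (x y : K) :
    ⟪traceTwist K (latticeVec K x), latticeVec K y⟫ = (Algebra.trace ℚ K (x * y) : ℝ) := by
  have h : (Algebra.trace ℚ K (x * y) : ℂ) = ∑ i, indexEquiv K i (x * y) := by
    rw [← eq_ratCast (algebraMap ℚ ℂ), trace_eq_sum_embeddings ℂ,
      Equiv.sum_comp (indexEquiv K) fun σ ↦ σ (x * y)]
    exact Fintype.sum_equiv (RingHom.equivRatAlgHom (R := K) (S := ℂ)).symm _ _ fun σ ↦ rfl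
  have h' := congrArg Complex.re h
  rw [Complex.ratCast_re] at h'
  rw [h', Complex.re_sum, PiLp.inner_apply, Fintype.sum_sum_type, Fintype.sum_sum_type,
    Fintype.sum_prod_type, Fintype.sum_prod_type]
  congr 1
  · refine Finset.sum_congr rfl fun w _ ↦ ?_
    simp [latticeVec_inl, embedding_im_of_isReal w.2, traceTwist_apply]
    ring
  · refine Finset.sum_congr rfl fun w _ ↦ ?_
    rw [Fin.sum_univ_two, Fin.sum_univ_two, indexEquiv_apply_isComplex_fst,
      indexEquiv_apply_isComplex_snd]
    simp [traceTwist_apply, latticeVec_inr_zero, latticeVec_inr_one]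
    ring

end LatticeVec

section LatticeMap

open NumberField.InfinitePlace NumberField.mixedEmbedding Module
open scoped RealInnerProductSpace

variable {K : Type*} [Field K] [NumberField K]

/-- The integral combination of basis vectors with prescribed coordinates. -/
noncomputable def intComb (b : Basis (index K) ℚ K) (m : index K → ℤ) : K := ∑ i, m i • b i

lemma intComb_injective (b : Basis (index K) ℚ K) : Function.Injective (intComb b) := by
  intro m m' h
  have h2 : ∀ m : index K → ℤ, ∀ i, b.repr (intComb b m) i = m i := fun m i ↦ by
    rw [intComb, Finset.sum_congr rfl fun i _ ↦ (Int.cast_smul_eq_zsmul ℚ (m i) (b i)).symm,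
      b.repr_sum_self]
  ext i
  have := congrArg (fun x ↦ b.repr x i) h
  simp only [h2] at this
  exact_mod_cast this

lemma intComb_zero (b : Basis (index K) ℚ K) : intComb b 0 = 0 := by simp [intComb]

lemma intComb_ne_zero (b : Basis (index K) ℚ K) {m : index K → ℤ} (hm : m ≠ 0) :
    intComb b m ≠ 0 := fun h ↦ hm (intComb_injective b (h.trans (intComb_zero b).symm))

/-- The real span of the lattice vectors of a rational basis. -/
noncomputable def latticeMap (b : Basis (index K) ℚ K) :
    EuclideanSpace ℝ (index K) →ₗ[ℝ] EuclideanSpace ℝ (index K) where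
  toFun y := ∑ i, y i • latticeVec K (b i)
  map_add' y y' := by simp [add_smul, Finset.sum_add_distrib]
  map_smul' c y := by simp [mul_smul, Finset.smul_sum]

lemma latticeMap_intVec (b : Basis (index K) ℚ K) (m : index K → ℤ) :
    latticeMap b (intVec m) = latticeVec K (intComb b m) := by
  rw [intComb, map_sum]
  refine Finset.sum_congr rfl fun i _ ↦ ?_
  rw [map_zsmul, intVec_apply, Int.cast_smul_eq_zsmul]

lemma inner_latticeMap (b : Basis (index K) ℚ K) (x y : EuclideanSpace ℝ (index K)) :
    ⟪traceTwist K (latticeMap b.traceDual x), latticeMap b y⟫ = ⟪x, y⟫ := by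
  have h : ∀ i j, ⟪traceTwist K (latticeVec K (b.traceDual i)), latticeVec K (b j)⟫ =
      if j = i then (1 : ℝ) else 0 := fun i j ↦ by
    rw [inner_traceTwist_latticeVec, Basis.trace_traceDual_mul]
    split_ifs <;> simp
  have h1 : ∀ (b : Basis (index K) ℚ K) (y : EuclideanSpace ℝ (index K)),
      latticeMap b y = ∑ i, y i • latticeVec K (b i) := fun _ _ ↦ rfl
  rw [h1, h1, map_sum, sum_inner]
  simp_rw [inner_sum, map_smul, real_inner_smul_left, real_inner_smul_right, h]
  rw [PiLp.inner_apply]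
  refine Finset.sum_congr rfl fun i _ ↦ ?_
  simp only [mul_ite, mul_one, mul_zero, Finset.sum_ite_eq', Finset.mem_univ, if_true,
    RCLike.inner_apply, conj_trivial]
  ring

lemma exists_lattice_equiv (b : Basis (index K) ℚ K) :
    ∃ L L' : EuclideanSpace ℝ (index K) ≃L[ℝ] EuclideanSpace ℝ (index K),
      (∀ m, L (intVec m) = latticeVec K (intComb b m)) ∧
      (∀ m, L' (intVec m) = traceTwist K (latticeVec K (intComb b.traceDual m))) ∧
      ∀ x y, ⟪L' x, L y⟫ = ⟪x, y⟫ := by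
  have h1 : Function.Injective (latticeMap b) := by
    rw [injective_iff_map_eq_zero]
    intro y hy
    have := inner_latticeMap b y y
    rw [hy, inner_zero_right] at this
    exact inner_self_eq_zero.mp this.symm
  have h2 : Function.Injective (traceTwist K ∘ₗ latticeMap b.traceDual) := by
    rw [injective_iff_map_eq_zero]
    intro y hy
    have := inner_latticeMap b y y
    rw [LinearMap.comp_apply] at hy
    rw [hy, inner_zero_left] at this
    exact inner_self_eq_zero.mp this.symm
  refine ⟨(LinearEquiv.ofInjectiveEndo _ h1).toContinuousLinearEquiv,
    (LinearEquiv.ofInjectiveEndo _ h2).toContinuousLinearEquiv, fun m ↦ latticeMap_intVec b m,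
    fun m ↦ ?_, fun x y ↦ inner_latticeMap b x y⟩
  rw [← latticeMap_intVec]
  rfl

/-- The `ℤ`-span of the basis is stable under multiplication by algebraic integers. -/
def IsStableBasis (b : Basis (index K) ℚ K) : Prop :=
  ∀ (a : 𝓞 K) (m : index K → ℤ), ∃ m', (a : K) * intComb b m = intComb b m'

lemma IsStableBasis.traceDual {b : Basis (index K) ℚ K} (hb : IsStableBasis b) :
    IsStableBasis b.traceDual := by
  classical
  intro a m
  have h1 : ∀ m m' : index K → ℤ, Algebra.trace ℚ K (intComb b.traceDual m * intComb b m') =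
      ((∑ i, m i * m' i : ℤ) : ℚ) := fun m m' ↦ by
    simp only [intComb, Finset.sum_mul, Finset.mul_sum, map_sum, smul_mul_assoc, mul_smul_comm,
      map_zsmul, Basis.trace_traceDual_mul]
    push_cast
    refine Finset.sum_congr rfl fun i _ ↦ ?_
    rw [Finset.smul_sum]
    simp [mul_comm]
  have h2 : ∀ i, ∃ k : ℤ, Algebra.trace ℚ K ((a : K) * intComb b.traceDual m * b i) = k := by
    intro i
    obtain ⟨m', hm'⟩ := hb a (Pi.single i 1)
    have h3 : intComb b (Pi.single i 1) = b i := by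
      simp [intComb, Pi.single_apply, ite_smul]
    rw [h3] at hm'
    exact ⟨_, by rw [mul_right_comm, hm', mul_comm, h1]⟩
  choose k hk using h2
  refine ⟨k, b.traceDual.repr.injective ?_⟩
  ext i
  rw [Basis.traceDual_repr_apply, Algebra.traceForm_apply, hk, intComb,
    Finset.sum_congr rfl fun i _ ↦ (Int.cast_smul_eq_zsmul ℚ (k i) (b.traceDual i)).symm,
    Basis.repr_sum_self]

lemma exists_basis_of_ideal (I : Ideal (𝓞 K)) (hI : I ≠ ⊥) :
    ∃ b : Basis (index K) ℚ K, IsStableBasis b ∧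
      ∀ x : K, (∃ m, intComb b m = x) ↔ ∃ a ∈ I, (a : K) = x := by
  let J : (FractionalIdeal (nonZeroDivisors (𝓞 K)) K)ˣ :=
    Units.mk0 (I : FractionalIdeal (nonZeroDivisors (𝓞 K)) K)
      (FractionalIdeal.coeIdeal_ne_zero.mpr hI)
  let b0 := basisOfFractionalIdeal K J
  let e : Free.ChooseBasisIndex ℤ J ≃ index K := Fintype.equivOfCardEq (by
    rw [card_index, ← Module.finrank_eq_card_basis b0])
  have h1 : ∀ x : K, (∃ m, intComb (b0.reindex e) m = x) ↔ ∃ a ∈ I, (a : K) = x := fun x ↦ by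
    have h2 : x ∈ Submodule.span ℤ (Set.range b0) ↔ ∃ a ∈ I, (a : K) = x := by
      rw [mem_span_basisOfFractionalIdeal]
      exact FractionalIdeal.mem_coeIdeal _
    rw [← h2, ← Basis.range_reindex b0 e, Submodule.mem_span_range_iff_exists_fun]
    rfl
  refine ⟨b0.reindex e, fun a m ↦ ?_, h1⟩
  obtain ⟨x, hx, hx'⟩ := (h1 _).mp ⟨m, rfl⟩
  obtain ⟨m', hm'⟩ := (h1 (a * x : 𝓞 K)).mpr ⟨_, I.mul_mem_left a hx, rfl⟩
  exact ⟨m', by rw [hm', ← hx']; simp⟩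

end LatticeMap

section PolarGrowth

variable {ι V : Type*} [Fintype ι] [Fintype V] [DecidableEq V] {π : ι → V} {v₀ : V}

lemma exists_norm_le_mul_polarExp (hπ : Function.Surjective π) (z : {v : V // v ≠ v₀} → ℝ) :
    ∃ v, ‖z‖ ≤ Fintype.card ι * polarExp π v₀ (z, 0) v := by
  have hne : (Finset.univ : Finset V).Nonempty := ⟨v₀, Finset.mem_univ _⟩
  obtain ⟨v, -, hv⟩ := Finset.exists_max_image Finset.univ (polarExp π v₀ (z, 0)) hne
  refine ⟨v, ?_⟩
  set M := polarExp π v₀ (z, 0) v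
  have hsum : ∑ w, (blockDim π w : ℝ) * polarExp π v₀ (z, 0) w = 0 :=
    sum_blockDim_mul_polarExp hπ (z, 0)
  have hd : ∑ w, (blockDim π w : ℝ) = Fintype.card ι := by exact_mod_cast sum_blockDim (π := π)
  have hn : (0 : ℝ) < Fintype.card ι := by exact_mod_cast card_pos_of_surjective hπ v
  have hM : 0 ≤ M := by
    have h : ∑ w, (blockDim π w : ℝ) * polarExp π v₀ (z, 0) w ≤ ∑ w, (blockDim π w : ℝ) * M :=
      Finset.sum_le_sum fun w hw ↦ mul_le_mul_of_nonneg_left (hv w hw) (Nat.cast_nonneg _)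
    rw [hsum, ← Finset.sum_mul, hd] at h
    exact nonneg_of_mul_nonneg_right h hn
  have hz : ∀ w : {v : V // v ≠ v₀}, z w = blockDim π w.1 * polarExp π v₀ (z, 0) w.1 := fun w ↦ by
    have hd : (blockDim π w.1 : ℝ) ≠ 0 := by exact_mod_cast (blockDim_pos hπ w.1).ne'
    simp only [polarExp, w.2, ne_eq, not_false_eq_true, dite_true]
    field_simp
    ring
  rw [pi_norm_le_iff_of_nonneg (by positivity)]
  intro w
  rw [Real.norm_eq_abs, abs_le, hz]
  have hle : ∀ s : Finset V, ∑ w ∈ s, (blockDim π w : ℝ) * polarExp π v₀ (z, 0) w ≤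
      Fintype.card ι * M := fun s ↦ by
    rw [← hd, Finset.sum_mul]
    refine (Finset.sum_le_sum fun w _ ↦ mul_le_mul_of_nonneg_left (hv w (Finset.mem_univ _))
      (Nat.cast_nonneg _)).trans ?_
    exact Finset.sum_le_sum_of_subset_of_nonneg (Finset.subset_univ _)
      fun _ _ _ ↦ mul_nonneg (Nat.cast_nonneg _) hM
  constructor
  · have h1 := hle (Finset.univ.erase w.1)
    rw [← Finset.add_sum_erase _ _ (Finset.mem_univ w.1)] at hsum
    linarith
  · simpa using hle {w.1}

lemma rpow_mul_norm_rpow_le (hπ : Function.Surjective π) (R : ℝ) {p : ℝ} (hp : 0 ≤ p) :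
    ∃ C : ℝ, 0 ≤ C ∧ ∀ (y y0 : EuclideanSpace ℝ ι) (ℓ : {v : V // v ≠ v₀} → ℝ),
      blockProd π y0 ≠ 0 → ‖(polarLog π v₀ y0).1‖ ≤ R → blockProd π y ≠ 0 →
      polarLog π v₀ y = polarLog π v₀ y0 + (ℓ, 0) →
      blockProd π y ^ (-(1 / 2) : ℝ) * ‖y‖ ^ (-p / 2) ≤
        C * ‖y0‖ ^ (-(Fintype.card ι + p) / 2) *
          Real.exp (-(p / (2 * Fintype.card ι)) * ‖ℓ‖) := by
  set n : ℝ := ((Fintype.card ι : ℕ) : ℝ) with hn_def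
  have hn : 0 < n := Nat.cast_pos.mpr (card_pos_of_surjective hπ v₀)
  have hV : (0 : ℝ) < Fintype.card V := by exact_mod_cast Fintype.card_pos_iff.mpr ⟨v₀⟩
  set c : ℝ := (Fintype.card V + 1) * R with hc
  set D : ℝ := Fintype.card V * Real.exp c with hD
  have hDpos : 0 < D := by positivity
  refine ⟨D ^ ((n + p) / 2) * Real.exp (c * p / 2), by positivity, ?_⟩
  intro y y0 ℓ hy0 hR hy hyy0
  set ν : ℝ := Real.exp (Real.log (blockProd π y) / n) with hν
  have hs : (polarLog π v₀ y).2 = (polarLog π v₀ y0).2 := by rw [hyy0]; simp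
  have hs' : Real.log (blockProd π y) = Real.log (blockProd π y0) := hs
  have hp0 : polarLog π v₀ y0 = ((polarLog π v₀ y0).1, 0) + (0, (polarLog π v₀ y0).2) := by simp
  have hbd : ∀ v, |polarExp π v₀ ((polarLog π v₀ y0).1, 0) v| ≤ c := fun v ↦ by
    refine (abs_polarExp_le hπ _ v).trans ?_
    rw [hc]
    gcongr
    simpa using hR
  have hb0 : ∀ v, blockNorm π v y0 =
      Real.exp (polarExp π v₀ ((polarLog π v₀ y0).1, 0) v) * ν := fun v ↦ by
    rw [blockNorm_eq_exp_polarExp (v₀ := v₀) hπ hy0, hp0, polarExp_add, Pi.add_apply,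
      polarExp_zero_left, Real.exp_add, hν, hs']
    simp [polarLog, hn_def]
  have hb : ∀ v, blockNorm π v y = blockNorm π v y0 * Real.exp (polarExp π v₀ (ℓ, 0) v) :=
    fun v ↦ by
    rw [blockNorm_eq_exp_polarExp (v₀ := v₀) hπ hy, hyy0, polarExp_add, Pi.add_apply,
      Real.exp_add, ← blockNorm_eq_exp_polarExp hπ hy0]
  have hνpos : 0 < ν := Real.exp_pos _
  have h1 : ‖y0‖ ≤ D * ν := by
    refine (norm_le_sum_blockNorm (π := π) y0).trans ?_
    have : ∀ v ∈ Finset.univ, blockNorm π v y0 ≤ Real.exp c * ν := fun v _ ↦ by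
      rw [hb0]
      gcongr
      exact (le_abs_self _).trans (hbd v)
    refine (Finset.sum_le_card_nsmul _ _ _ this).trans ?_
    rw [nsmul_eq_mul, Finset.card_univ, hD, mul_assoc]
  have h2 : ν * Real.exp (-c) * Real.exp (‖ℓ‖ / n) ≤ ‖y‖ := by
    obtain ⟨v, hv⟩ := exists_norm_le_mul_polarExp hπ ℓ
    refine le_trans ?_ (blockNorm_le_norm (π := π) v y)
    rw [hb, hb0, mul_comm ν]
    gcongr
    · exact neg_le_of_abs_le (hbd v)
    · rw [div_le_iff₀ hn, mul_comm]
      exact hv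
  have hy0pos : 0 < ‖y0‖ := by
    have : 0 < blockNorm π v₀ y0 := blockNorm_pos hπ hy0 v₀
    exact this.trans_le (blockNorm_le_norm _ _)
  have hNpos : 0 < blockProd π y := lt_of_le_of_ne (blockProd_nonneg _) hy.symm
  have hN : blockProd π y ^ (-(1 / 2) : ℝ) = ν ^ (-(n / 2)) := by
    rw [hν, ← Real.exp_mul, Real.rpow_def_of_pos hNpos]
    congr 1
    field_simp
  have h3 : ‖y‖ ^ (-p / 2) ≤ (ν * Real.exp (-c) * Real.exp (‖ℓ‖ / n)) ^ (-p / 2) :=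
    Real.rpow_le_rpow_of_nonpos (by positivity) h2 (by linarith)
  have h4 : ν ^ (-((n + p) / 2)) ≤ (‖y0‖ / D) ^ (-((n + p) / 2)) := by
    refine Real.rpow_le_rpow_of_nonpos (by positivity) ?_ (by linarith)
    rw [div_le_iff₀ hDpos, mul_comm]
    exact h1
  rw [hN]
  clear_value ν n c D
  calc ν ^ (-(n / 2)) * ‖y‖ ^ (-p / 2)
      ≤ ν ^ (-(n / 2)) * (ν * Real.exp (-c) * Real.exp (‖ℓ‖ / n)) ^ (-p / 2) := by gcongr
    _ = ν ^ (-((n + p) / 2)) * (Real.exp (c * p / 2) * Real.exp (-(p / (2 * n)) * ‖ℓ‖)) := by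
        rw [Real.mul_rpow (by positivity) (by positivity), Real.mul_rpow hνpos.le (by positivity),
          ← Real.exp_mul, ← Real.exp_mul, ← mul_assoc, ← mul_assoc, ← Real.rpow_add hνpos,
          ← mul_assoc]
        congr 2
        · congr 1
          ring
        · congr 1
          ring
        · field_simp
    _ ≤ (‖y0‖ / D) ^ (-((n + p) / 2)) *
          (Real.exp (c * p / 2) * Real.exp (-(p / (2 * n)) * ‖ℓ‖)) := by gcongr
    _ = _ := by
        rw [Real.div_rpow hy0pos.le hDpos.le, Real.rpow_neg hDpos.le, div_inv_eq_mul,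
          show -((n + p) / 2) = -(n + p) / 2 by ring]
        ring

end PolarGrowth

section UnitLattice

open NumberField.InfinitePlace NumberField.mixedEmbedding NumberField.Units
  NumberField.Units.dirichletUnitTheorem Module

variable {K : Type*} [Field K] [NumberField K]

lemma blockProd_latticeVec_ne_zero {x : K} (hx : x ≠ 0) :
    blockProd (placeOf K) (latticeVec K x) ≠ 0 := by
  rw [blockProd_latticeVec]
  simpa using hx

lemma polarLog_latticeVec_unit_mul (u : (𝓞 K)ˣ) {x : K} (hx : x ≠ 0) :
    polarLog (placeOf K) w₀ (latticeVec K ((u : K) * x)) =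
      polarLog (placeOf K) w₀ (latticeVec K x) + (logEmbedding K (Additive.ofMul u), 0) := by
  have hN : blockProd (placeOf K) (latticeVec K ((u : K) * x)) =
      blockProd (placeOf K) (latticeVec K x) := by
    rw [blockProd_latticeVec, blockProd_latticeVec, map_mul]
    push_cast
    rw [abs_mul, show |(Algebra.norm ℚ (u : K) : ℝ)| = 1 by
      exact_mod_cast congrArg (Rat.cast (K := ℝ)) (NumberField.Units.norm K u), one_mul]
  ext w
  · simp only [polarLog, hN, Prod.fst_add, Pi.add_apply, logEmbedding_component,
      blockNorm_latticeVec, map_mul, blockDim_placeOf]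
    rw [Real.log_mul (by simp) (by simpa using hx)]
    ring
  · simp [polarLog, hN]

variable (K) in
/-- The space of logarithms of absolute values of units. -/
abbrev LogSpace : Type _ := {w : InfinitePlace K // w ≠ w₀} → ℝ

variable (K) in
/-- The unit lattice, as a lattice in `LogSpace K`. -/
noncomputable def logLattice : Submodule ℤ (LogSpace K) := unitLattice K

instance : DiscreteTopology (logLattice K) := instDiscrete_unitLattice K

instance : IsZLattice ℝ (logLattice K) := ⟨unitLattice_span_eq_top K⟩

lemma exists_unit_of_mem_logLattice (ℓ : logLattice K) :
    ∃ u : (𝓞 K)ˣ, logEmbedding K (Additive.ofMul u) = ℓ := by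
  obtain ⟨ℓ, u, -, hu⟩ := ℓ
  exact ⟨u.toMul, hu⟩

lemma logEmbedding_mem_logLattice (u : (𝓞 K)ˣ) :
    logEmbedding K (Additive.ofMul u) ∈ logLattice K := ⟨Additive.ofMul u, trivial, rfl⟩

variable (K) in
lemma exists_norm_add_logLattice_le :
    ∃ R : ℝ, ∀ z : LogSpace K, ∃ ℓ : logLattice K, ‖z + ℓ‖ ≤ R := by
  let b : Basis (Fin (Units.rank K)) ℤ (logLattice K) := basisUnitLattice K
  let b' := b.ofZLatticeBasis ℝ (logLattice K)
  refine ⟨∑ i, ‖b' i‖, fun z ↦ ?_⟩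
  have hmem : -(ZSpan.floor b' z : LogSpace K) ∈ logLattice K := by
    refine neg_mem ?_
    exact (Basis.ofZLatticeBasis_span ℝ (logLattice K) b).le (ZSpan.floor b' z).2
  refine ⟨⟨_, hmem⟩, ?_⟩
  rw [← sub_eq_add_neg, ← ZSpan.fract_apply]
  exact ZSpan.norm_fract_le b' z

variable (K) in
lemma summable_exp_neg_mul_norm_logLattice {c : ℝ} (hc : 0 < c) :
    Summable fun ℓ : logLattice K ↦ Real.exp (-c * ‖ℓ‖) := by
  set k : ℕ := finrank ℤ (logLattice K) + 1 with hk
  have h := (ZLattice.summable_norm_rpow (logLattice K) (-(k : ℝ)) (by rw [hk]; simp)).mul_left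
    (k.factorial / c ^ k)
  refine Summable.of_norm_bounded_eventually h ?_
  have h0 : {ℓ : logLattice K | ¬ ‖Real.exp (-c * ‖ℓ‖)‖ ≤ k.factorial / c ^ k * ‖ℓ‖ ^ (-(k : ℝ))} ⊆
      {0} := by
    intro ℓ hℓ
    by_contra hne
    refine hℓ ?_
    have hpos : 0 < ‖ℓ‖ := norm_pos_iff.mpr hne
    have := Real.pow_div_factorial_le_exp (c * ‖ℓ‖) (by positivity) k
    rw [Real.norm_eq_abs, abs_of_pos (Real.exp_pos _), neg_mul, Real.exp_neg,
      Real.rpow_neg hpos.le, Real.rpow_natCast, ← div_eq_mul_inv, div_div, ← mul_pow]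
    rw [← inv_div]
    exact inv_anti₀ (by positivity) this
  exact (Set.finite_singleton _).subset h0

theorem summable_blockProd_rpow_mul {b : Basis (index K) ℚ K} (hb : IsStableBasis b) {p : ℝ}
    (hp : finrank ℚ K < p) :
    Summable fun m : index K → ℤ ↦
      blockProd (placeOf K) (latticeVec K (intComb b m)) ^ (-(1 / 2) : ℝ) *
        ‖latticeVec K (intComb b m)‖ ^ (-p / 2) := by
  have hπ := placeOf_surjective K
  have hn : (0 : ℝ) ≤ finrank ℚ K := Nat.cast_nonneg _
  have hn0 : (0 : ℝ) < finrank ℚ K := by exact_mod_cast finrank_pos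
  obtain ⟨R, hR⟩ := exists_norm_add_logLattice_le K
  obtain ⟨C, hC0, hC⟩ := rpow_mul_norm_rpow_le (v₀ := (w₀ : InfinitePlace K)) hπ R
    (p := p) (by linarith)
  obtain ⟨L, -, hL, -, -⟩ := exists_lattice_equiv b
  choose u hu using exists_unit_of_mem_logLattice (K := K)
  have key : ∀ m : index K → ℤ, ∃ q : (index K → ℤ) × logLattice K,
      (m = 0 → q.1 = 0) ∧ (u q.2 : K) * intComb b q.1 = intComb b m ∧
      (m ≠ 0 → ‖(polarLog (placeOf K) w₀ (latticeVec K (intComb b q.1))).1‖ ≤ R) := by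
    intro m
    by_cases hm : m = 0
    · exact ⟨(0, 0), fun _ ↦ rfl, by rw [hm, intComb_zero, mul_zero], fun h ↦ (h hm).elim⟩
    · obtain ⟨ℓ, hℓ⟩ := hR (polarLog (placeOf K) w₀ (latticeVec K (intComb b m))).1
      obtain ⟨m0, hm0⟩ := hb ((u (-ℓ))⁻¹ : (𝓞 K)ˣ) m
      have h1 : (u (-ℓ) : K) * intComb b m0 = intComb b m := by
        rw [← hm0]
        simp
      have hx0 : intComb b m0 ≠ 0 := by
        rintro h
        rw [h, mul_zero] at h1
        exact intComb_ne_zero b hm h1.symm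
      refine ⟨(m0, -ℓ), fun h ↦ (hm h).elim, h1, fun _ ↦ ?_⟩
      have h2 := polarLog_latticeVec_unit_mul (u (-ℓ)) hx0
      rw [h1, hu] at h2
      rw [h2] at hℓ
      simpa using hℓ
  choose q hq0 hq hqR using key
  have hinj : Function.Injective q := fun m m' h ↦ by
    apply intComb_injective b
    rw [← hq m, ← hq m', h]
  have hs1 := summable_norm_intVec_rpow L (r := -(Fintype.card (index K) + p) / 2) (by
    rw [card_index]
    linarith)
  have hs2 := summable_exp_neg_mul_norm_logLattice K
    (c := p / (2 * Fintype.card (index K))) (by rw [card_index]; exact div_pos (by linarith) (by linarith))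
  have hs := ((hs1.mul_of_nonneg hs2 (fun _ ↦ by positivity) (fun _ ↦ by positivity)).mul_left
    C).comp_injective hinj
  refine Summable.of_nonneg_of_le (fun m ↦ ?_) (fun m ↦ ?_) hs
  · have := blockProd_nonneg (π := placeOf K) (latticeVec K (intComb b m))
    positivity
  · by_cases hm : m = 0
    · have : blockProd (placeOf K) (latticeVec K (intComb b m)) = 0 := by
        rw [hm, intComb_zero, blockProd_latticeVec]
        simp
      rw [this, Real.zero_rpow (by norm_num), zero_mul]
      simp only [Function.comp_apply]
      positivity
    · have hx := intComb_ne_zero b hm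
      have hx0 : intComb b (q m).1 ≠ 0 := fun h ↦ hx (by rw [← hq, h, mul_zero])
      have h2 := polarLog_latticeVec_unit_mul (u (q m).2) hx0
      rw [hq, hu] at h2
      refine (hC _ _ _ (blockProd_latticeVec_ne_zero hx0) (hqR m hm)
        (blockProd_latticeVec_ne_zero hx) h2).trans ?_
      simp only [Function.comp_apply]
      rw [hL, mul_assoc]
      rfl

end UnitLattice

section PartitionOfUnity

open scoped ContDiff Convolution

variable {E : Type*} [NormedAddCommGroup E] [NormedSpace ℝ E] [FiniteDimensional ℝ E]

lemma exists_zLattice_partition_of_unity (Λ : Submodule ℤ E) [DiscreteTopology Λ]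
    [IsZLattice ℝ Λ] :
    ∃ β : E → ℝ, ContDiff ℝ ∞ β ∧ HasCompactSupport β ∧ ∀ x, ∑' ℓ : Λ, β (x + ℓ) = 1 := by
  borelize E
  let μ : Measure E := Measure.addHaar
  have : Module.Free ℤ Λ := ZLattice.module_free ℝ Λ
  have : Module.Finite ℤ Λ := ZLattice.module_finite ℝ Λ
  obtain ⟨D, hD, hDb, hfund⟩ : ∃ D : Set E, MeasurableSet D ∧ Bornology.IsBounded D ∧
      IsAddFundamentalDomain Λ D μ := by
    let b0 := Module.Free.chooseBasis ℤ Λ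
    exact ⟨_, ZSpan.fundamentalDomain_measurableSet (b0.ofZLatticeBasis ℝ Λ),
      ZSpan.fundamentalDomain_isBounded _, ZLattice.isAddFundamentalDomain b0 μ⟩
  obtain ⟨φ, hφc, hφs, hφ1⟩ : ∃ φ : E → ℝ, HasCompactSupport φ ∧ ContDiff ℝ ∞ φ ∧
      ∫ x, φ x ∂μ = 1 := by
    let bump : ContDiffBump (0 : E) := default
    exact ⟨bump.normed μ, bump.hasCompactSupport_normed, bump.contDiff_normed,
      bump.integral_normed⟩
  have hφi : Integrable φ μ := hφs.continuous.integrable_of_hasCompactSupport hφc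
  let g : E → ℝ := D.indicator 1
  have hgc : HasCompactSupport g := by
    refine HasCompactSupport.intro hDb.isCompact_closure fun x hx ↦ ?_
    exact Set.indicator_of_notMem (fun h ↦ hx (subset_closure h)) _
  have hgi : LocallyIntegrable g μ := by
    refine Integrable.locallyIntegrable ?_
    rw [integrable_indicator_iff hD]
    exact integrableOn_const hDb.measure_lt_top.ne
  refine ⟨g ⋆[ContinuousLinearMap.lsmul ℝ ℝ, μ] φ,
    hφc.contDiff_convolution_right _ hgi hφs, hgc.convolution _ hφc, fun x ↦ ?_⟩
  have h1 : ∀ y, (g ⋆[ContinuousLinearMap.lsmul ℝ ℝ, μ] φ) y = ∫ t in D, φ (y - t) ∂μ :=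
    fun y ↦ by
    rw [← integral_indicator hD]
    refine integral_congr_ae (.of_forall fun t ↦ ?_)
    by_cases ht : t ∈ D <;> simp [g, ht]
  have : VAddInvariantMeasure Λ E μ :=
    inferInstanceAs (VAddInvariantMeasure Λ.toAddSubgroup E μ)
  have h2 := hfund.integral_eq_tsum' (fun t ↦ φ (x - t)) (hφi.comp_sub_left x)
  rw [integral_sub_left_eq_self φ μ x, hφ1] at h2
  rw [h2]
  refine tsum_congr fun ℓ ↦ ?_
  rw [h1]
  refine integral_congr_ae (.of_forall fun t ↦ ?_)
  show φ (x + ℓ - t) = φ (x - (-(ℓ : E) + t))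
  congr 1
  abel

end PartitionOfUnity

section PrimalSum

open NumberField.InfinitePlace NumberField.mixedEmbedding NumberField.Units
  NumberField.Units.dirichletUnitTheorem Module
open scoped ContDiff nonZeroDivisors Convolution

variable {K : Type*} [Field K] [NumberField K]

lemma blockNorm_le_blockNorm_traceTwist (w : InfinitePlace K)
    (y : EuclideanSpace ℝ (index K)) :
    blockNorm (placeOf K) w y ≤ blockNorm (placeOf K) w (traceTwist K y) := by
  rw [blockNorm_traceTwist]
  exact le_mul_of_one_le_left (blockNorm_nonneg _ _) (by exact_mod_cast mult_pos)

lemma blockProd_le_blockProd_traceTwist (y : EuclideanSpace ℝ (index K)) :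
    blockProd (placeOf K) y ≤ blockProd (placeOf K) (traceTwist K y) :=
  Finset.prod_le_prod (fun _ _ ↦ pow_nonneg (blockNorm_nonneg _ _) _) fun w _ ↦
    pow_le_pow_left₀ (blockNorm_nonneg _ _) (blockNorm_le_blockNorm_traceTwist w y) _

lemma norm_le_norm_traceTwist (y : EuclideanSpace ℝ (index K)) : ‖y‖ ≤ ‖traceTwist K y‖ := by
  refine le_of_sq_le_sq ?_ (norm_nonneg _)
  rw [← sum_blockNorm_sq (π := placeOf K) y, ← sum_blockNorm_sq (π := placeOf K) (traceTwist K y)]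
  exact Finset.sum_le_sum fun w _ ↦
    pow_le_pow_left₀ (blockNorm_nonneg _ _) (blockNorm_le_blockNorm_traceTwist w y) _

lemma blockProd_traceTwist_ne_zero {x : K} (hx : x ≠ 0) :
    blockProd (placeOf K) (traceTwist K (latticeVec K x)) ≠ 0 :=
  (((blockProd_nonneg _).lt_of_ne (blockProd_latticeVec_ne_zero hx).symm).trans_le
    (blockProd_le_blockProd_traceTwist _)).ne'

lemma blockProd_traceTwist_rpow_mul_le {y : EuclideanSpace ℝ (index K)}
    (hy : blockProd (placeOf K) y ≠ 0) {p : ℝ} (hp : 0 ≤ p) :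
    blockProd (placeOf K) (traceTwist K y) ^ (-(1 / 2) : ℝ) * ‖traceTwist K y‖ ^ (-p / 2) ≤
      blockProd (placeOf K) y ^ (-(1 / 2) : ℝ) * ‖y‖ ^ (-p / 2) := by
  have h1 : 0 < blockProd (placeOf K) y := (blockProd_nonneg _).lt_of_ne hy.symm
  have h2 : 0 < ‖y‖ := (blockNorm_pos (placeOf_surjective K) hy w₀).trans_le (blockNorm_le_norm _ _)
  have h3 := h1.trans_le (blockProd_le_blockProd_traceTwist y)
  have h4 := h2.trans_le (norm_le_norm_traceTwist y)
  exact mul_le_mul (Real.rpow_le_rpow_of_nonpos h1 (blockProd_le_blockProd_traceTwist y)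
    (by norm_num)) (Real.rpow_le_rpow_of_nonpos h2 (norm_le_norm_traceTwist y) (by linarith))
    (by positivity) (by positivity)

lemma summable_blockProd_traceTwist_rpow_mul {b : Basis (index K) ℚ K} (hb : IsStableBasis b)
    {p : ℝ} (hp : finrank ℚ K < p) :
    Summable fun m : index K → ℤ ↦
      blockProd (placeOf K) (traceTwist K (latticeVec K (intComb b m))) ^ (-(1 / 2) : ℝ) *
        ‖traceTwist K (latticeVec K (intComb b m))‖ ^ (-p / 2) := by
  have hn : (0 : ℝ) ≤ finrank ℚ K := Nat.cast_nonneg _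
  refine Summable.of_norm_bounded_eventually (summable_blockProd_rpow_mul hb hp) ?_
  refine (Set.finite_singleton (0 : index K → ℤ)).subset fun m hm ↦ ?_
  by_contra hne
  refine hm ?_
  rw [mem_ofPred_eq, Real.norm_eq_abs, abs_of_nonneg (mul_nonneg
    (Real.rpow_nonneg (blockProd_nonneg _) _) (Real.rpow_nonneg (norm_nonneg _) _))]
  exact blockProd_traceTwist_rpow_mul_le (blockProd_latticeVec_ne_zero (intComb_ne_zero b hne))
    (by linarith)

end PrimalSum

section ClassSum

open NumberField.InfinitePlace NumberField.mixedEmbedding NumberField.Units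
  NumberField.Units.dirichletUnitTheorem Module
open scoped ContDiff nonZeroDivisors

variable {K : Type*} [Field K] [NumberField K]

/-- The nonzero lattice points of an ideal, parametrised by ideals in the inverse class, roots of
unity and the unit lattice. -/
lemma exists_equiv_ne_zero {J : (Ideal (𝓞 K))⁰} {b : Basis (index K) ℚ K}
    (hb : ∀ x : K, (∃ m, intComb b m = x) ↔ ∃ a ∈ (J : Ideal (𝓞 K)), (a : K) = x) :
    ∃ (g : {I : (Ideal (𝓞 K))⁰ // ClassGroup.mk0 I = (ClassGroup.mk0 J)⁻¹} → 𝓞 K)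
      (u : logLattice K → (𝓞 K)ˣ)
      (e : ({I : (Ideal (𝓞 K))⁰ // ClassGroup.mk0 I = (ClassGroup.mk0 J)⁻¹} ×
        torsion K × logLattice K) ≃ {m : index K → ℤ // m ≠ 0}),
      (∀ I, g I ≠ 0 ∧ ((I.1 : Ideal (𝓞 K)) * J = Ideal.span {g I})) ∧
      (∀ ℓ, logEmbedding K (Additive.ofMul (u ℓ)) = ℓ) ∧
      ∀ I ζ ℓ, intComb b (e (I, ζ, ℓ)).1 = (((ζ : (𝓞 K)ˣ) * u ℓ : (𝓞 K)ˣ) : K) * (g I : K) := by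
  choose u hu using exists_unit_of_mem_logLattice (K := K)
  have hg0 : ∀ I : {I : (Ideal (𝓞 K))⁰ // ClassGroup.mk0 I = (ClassGroup.mk0 J)⁻¹},
      ∃ x : 𝓞 K, x ≠ 0 ∧ (I.1 : Ideal (𝓞 K)) * J = Ideal.span {x} := fun I ↦
    ClassGroup.mk0_eq_mk0_inv_iff.mp I.2
  choose g hg using hg0
  have hm : ∀ (I : {I : (Ideal (𝓞 K))⁰ // ClassGroup.mk0 I = (ClassGroup.mk0 J)⁻¹})
      (v : (𝓞 K)ˣ), ∃ m, intComb b m = (v : K) * (g I : K) := fun I v ↦ by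
    refine (hb _).mpr ⟨v * g I, ?_, by simp⟩
    refine Ideal.mul_mem_left _ _ (Ideal.mul_le_right (I := (I.1 : Ideal (𝓞 K))) ?_)
    rw [(hg I).2]
    exact Ideal.mem_span_singleton_self _
  choose M hM using hm
  have hM0 : ∀ I v, M I v ≠ 0 := fun I v h ↦ by
    have := hM I v
    rw [h, intComb_zero, eq_comm, mul_eq_zero] at this
    rcases this with h | h
    · exact absurd h (by simp)
    · exact (hg I).1 (by exact_mod_cast h)
  let F : ({I : (Ideal (𝓞 K))⁰ // ClassGroup.mk0 I = (ClassGroup.mk0 J)⁻¹} ×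
      torsion K × logLattice K) → {m : index K → ℤ // m ≠ 0} :=
    fun q ↦ ⟨M q.1 ((q.2.1 : (𝓞 K)ˣ) * u q.2.2), hM0 _ _⟩
  have hF : ∀ I ζ ℓ, intComb b (F (I, ζ, ℓ)).1 =
      (((ζ : (𝓞 K)ˣ) * u ℓ : (𝓞 K)ˣ) : K) * (g I : K) := fun I ζ ℓ ↦ hM _ _
  have hJ0 : (J : Ideal (𝓞 K)) ≠ 0 := nonZeroDivisors.coe_ne_zero J
  have hbij : Function.Bijective F := by
    constructor
    · rintro ⟨I, ζ, ℓ⟩ ⟨I', ζ', ℓ'⟩ h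
      have h1 : (((ζ : (𝓞 K)ˣ) * u ℓ : (𝓞 K)ˣ) : 𝓞 K) * g I =
          (((ζ' : (𝓞 K)ˣ) * u ℓ' : (𝓞 K)ˣ) : 𝓞 K) * g I' := by
        apply RingOfIntegers.coe_injective
        have := congrArg (fun m ↦ intComb b m.1) h
        simp only [hF] at this
        simpa using this
      have h2 : I = I' := by
        have h3 : Ideal.span {g I} = Ideal.span {g I'} := by
          rw [← Ideal.span_singleton_mul_left_unit (Units.isUnit ((ζ : (𝓞 K)ˣ) * u ℓ)), h1,
            Ideal.span_singleton_mul_left_unit (Units.isUnit _)]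
        rw [← (hg I).2, ← (hg I').2] at h3
        exact Subtype.ext (Subtype.ext (mul_right_cancel₀ hJ0 h3))
      subst h2
      have h4 : (ζ : (𝓞 K)ˣ) * u ℓ = ζ' * u ℓ' :=
        Units.ext (mul_right_cancel₀ (hg I).1 h1)
      have h5 : ℓ = ℓ' := by
        have h6 := congrArg (fun v ↦ logEmbedding K (Additive.ofMul v)) h4
        simp only [ofMul_mul, map_add, hu, logEmbedding_eq_zero_iff.mpr ζ.2,
          logEmbedding_eq_zero_iff.mpr ζ'.2, zero_add] at h6
        exact Subtype.ext h6
      subst h5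
      rw [Subtype.ext (mul_right_cancel h4)]
    · rintro ⟨m, hm⟩
      obtain ⟨a, haJ, ha⟩ := (hb _).mp ⟨m, rfl⟩
      have ha0 : a ≠ 0 := by
        rintro rfl
        exact intComb_ne_zero b hm (by rw [← ha]; simp)
      obtain ⟨I, hI⟩ := Ideal.dvd_span_singleton.mpr haJ
      have hI0 : I ≠ 0 := by
        rintro rfl
        rw [mul_zero] at hI
        exact ha0 (Ideal.span_singleton_eq_bot.mp hI)
      let I' : (Ideal (𝓞 K))⁰ := ⟨I, mem_nonZeroDivisors_of_ne_zero hI0⟩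
      have hIJ : (I' : Ideal (𝓞 K)) * J = Ideal.span {a} := by rw [hI, mul_comm]
      have hcl : ClassGroup.mk0 I' = (ClassGroup.mk0 J)⁻¹ :=
        ClassGroup.mk0_eq_mk0_inv_iff.mpr ⟨a, ha0, hIJ⟩
      have has : Associated (g ⟨I', hcl⟩) a := by
        rw [← Ideal.span_singleton_eq_span_singleton, ← (hg _).2, ← hIJ]
      obtain ⟨v, hv⟩ := has
      let ℓ : logLattice K := ⟨_, logEmbedding_mem_logLattice v⟩
      have hζ : v * (u ℓ)⁻¹ ∈ torsion K := by
        rw [← logEmbedding_eq_zero_iff, ofMul_mul, ofMul_inv, map_add, map_neg, hu]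
        exact add_neg_cancel _
      refine ⟨(⟨I', hcl⟩, ⟨_, hζ⟩, ℓ), Subtype.ext (intComb_injective b ?_)⟩
      rw [hF, ← ha, ← hv]
      simp [mul_comm]
  exact ⟨g, u, Equiv.ofBijective F hbij, hg, hu, fun I ζ ℓ ↦ hF I ζ ℓ⟩

lemma abs_norm_eq_absNorm_mul {I J : Ideal (𝓞 K)} {g : 𝓞 K} (h : I * J = Ideal.span {g}) :
    |(Algebra.norm ℚ (g : K) : ℝ)| = Ideal.absNorm I * Ideal.absNorm J := by
  have h1 := congrArg Ideal.absNorm h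
  rw [map_mul, Ideal.absNorm_span_singleton] at h1
  have h2 : (Algebra.norm ℚ (g : K) : ℚ) = (Algebra.norm ℤ g : ℤ) :=
    (Algebra.coe_norm_int g).symm
  rw [h2]
  push_cast
  rw [← Int.cast_abs, Int.abs_eq_natAbs, ← h1]
  push_cast
  rfl

lemma tsum_polarFun_latticeVec_eq {J : (Ideal (𝓞 K))⁰} {b : Basis (index K) ℚ K}
    (hb : ∀ x : K, (∃ m, intComb b m = x) ↔ ∃ a ∈ (J : Ideal (𝓞 K)), (a : K) = x)
    {α α' : ℝ} (hα : 0 < α) {f : ℝ → ℝ} (hfs : ContDiff ℝ ∞ f)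
    (hf : ∀ v, f v ≠ 0 → v ∈ Icc α α') {β : LogSpace K → ℝ} (hβs : ContDiff ℝ ∞ β)
    (hβc : HasCompactSupport β) (hβ : ∀ x, ∑' ℓ : logLattice K, β (x + ℓ) = 1)
    (z : LogSpace K) (s : ℝ) :
    ∑' m : index K → ℤ, polarFun (placeOf K) w₀ f β
        (blockScale (placeOf K) (polarExp (placeOf K) w₀ (z, s)) (latticeVec K (intComb b m))) =
      Nat.card (torsion K) *
        ∑' I : {I : (Ideal (𝓞 K))⁰ // ClassGroup.mk0 I = (ClassGroup.mk0 J)⁻¹},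
          f (Real.exp s * (Ideal.absNorm (I.1 : Ideal (𝓞 K)) *
            Ideal.absNorm (J : Ideal (𝓞 K)))) := by
  have hπ := placeOf_surjective K
  obtain ⟨L, -, hL, -, -⟩ := exists_lattice_equiv b
  obtain ⟨g, u, e, hg, hu, he⟩ := exists_equiv_ne_zero hb
  set G : (index K → ℤ) → ℝ := fun m ↦ polarFun (placeOf K) w₀ f β
    (blockScale (placeOf K) (polarExp (placeOf K) w₀ (z, s)) (latticeVec K (intComb b m))) with hG
  have hfc : HasCompactSupport (polarFun (placeOf K) w₀ f β) :=
    hasCompactSupport_polarFun hπ hα hf hβc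
  have hpfs : ContDiff ℝ ∞ (polarFun (placeOf K) w₀ f β) := contDiff_polarFun hπ hα hfs hf hβs hβc
  have hsum : Summable G := by
    have hFc : HasCompactSupport fun y ↦ (polarFun (placeOf K) w₀ f β y : ℂ) :=
      hfc.comp_left Complex.ofReal_zero
    have h := SchwartzMap.summable_intVec
      (hFc.toSchwartzMap (Complex.ofRealCLM.contDiff.comp hpfs))
      (L.trans (blockScale (placeOf K) (polarExp (placeOf K) w₀ (z, s))))
    refine Complex.summable_ofReal.mp (h.congr fun m ↦ ?_)
    show ((polarFun (placeOf K) w₀ f β (blockScale (placeOf K) (polarExp (placeOf K) w₀ (z, s))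
      (L (intVec m))) : ℝ) : ℂ) = _
    rw [hL]
  have hG0 : ∀ m, m ∉ {m : index K → ℤ | m ≠ 0} → G m = 0 := fun m hm ↦ by
    have hm0 : m = 0 := by simpa using hm
    rw [hG, hm0]
    have h0 : blockProd (placeOf K) (0 : EuclideanSpace ℝ (index K)) = 0 := by
      simpa using blockProd_latticeVec (0 : K)
    simp only [polarFun, intComb_zero, map_zero, h0]
    by_contra h
    exact hα.not_ge (hf 0 (left_ne_zero_of_mul h)).1
  have h1 : ∀ I ζ ℓ, G (e (I, ζ, ℓ)).1 =
      f (Real.exp s * (Ideal.absNorm (I.1 : Ideal (𝓞 K)) * Ideal.absNorm (J : Ideal (𝓞 K)))) *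
        β ((polarLog (placeOf K) w₀ (latticeVec K (g I : K))).1 + z + ℓ) := fun I ζ ℓ ↦ by
    have hgI : (g I : K) ≠ 0 := by exact_mod_cast (hg I).1
    have hx : blockProd (placeOf K) (latticeVec K ((((ζ : (𝓞 K)ˣ) * u ℓ : (𝓞 K)ˣ) : K) * g I)) ≠ 0 :=
      blockProd_latticeVec_ne_zero (mul_ne_zero (by simp) hgI)
    simp only [hG, polarFun]
    rw [he, polarLog_blockScale hπ _ hx, polarLog_latticeVec_unit_mul _ hgI, blockProd_blockScale,
      sum_blockDim_mul_polarExp hπ, blockProd_latticeVec, map_mul]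
    have hN : |((Algebra.norm ℚ (((ζ : (𝓞 K)ˣ) * u ℓ : (𝓞 K)ˣ) : K) : ℚ) : ℝ)| = 1 := by
      exact_mod_cast congrArg (Rat.cast (K := ℝ)) (NumberField.Units.norm K _)
    rw [Rat.cast_mul, abs_mul, hN, one_mul, abs_norm_eq_absNorm_mul (hg I).2, ofMul_mul, map_add,
      logEmbedding_eq_zero_iff.mpr ζ.2, zero_add, hu]
    congr 2
    simp only [Prod.fst_add]
    abel
  have hinj : Function.Injective fun q ↦ (e q).1 := Subtype.val_injective.comp e.injective
  have hrange : Function.support G ⊆ Set.range fun q ↦ (e q).1 := fun m hm ↦ by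
    have hm0 : m ≠ 0 := fun h ↦ hm (hG0 m (by simp [h]))
    exact ⟨e.symm ⟨m, hm0⟩, by simp⟩
  have hsum' : Summable fun q ↦ G (e q).1 := hsum.comp_injective hinj
  rw [← hinj.tsum_eq hrange, hsum'.tsum_prod, ← tsum_mul_left]
  refine tsum_congr fun I ↦ ?_
  rw [(hsum'.prod_factor I).tsum_prod]
  simp_rw [h1, tsum_mul_left, hβ, tsum_const]
  simp [mul_comm]

end ClassSum

section IdealSum

open NumberField.InfinitePlace NumberField.mixedEmbedding NumberField.Units
  NumberField.Units.dirichletUnitTheorem Module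
open scoped ContDiff nonZeroDivisors

variable {K : Type*} [Field K] [NumberField K]

lemma exists_finset_apply_mul_absNorm_eq_zero (P : (Ideal (𝓞 K))⁰ → Prop) {β τ₀ : ℝ} (hτ₀ : 0 < τ₀) :
    ∃ T : Finset {I : (Ideal (𝓞 K))⁰ // P I}, ∀ f : ℝ → ℝ, (∀ v, f v ≠ 0 → v ≤ β) →
      ∀ τ, τ₀ ≤ τ → ∀ I ∉ T, f (τ * Ideal.absNorm (I.1 : Ideal (𝓞 K))) = 0 := by
  have hfin := Ideal.finite_setOfPred_absNorm_le₀ (S := 𝓞 K) ⌊β / τ₀⌋₊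
  have hfin' := Set.Finite.preimage (f := fun I : {I : (Ideal (𝓞 K))⁰ // P I} ↦ I.1)
    Subtype.val_injective.injOn hfin
  refine ⟨hfin'.toFinset, fun f hf τ hτ I hI ↦ ?_⟩
  by_contra h
  refine hI ?_
  rw [Set.Finite.mem_toFinset]
  refine Nat.le_floor ?_
  rw [le_div_iff₀ hτ₀, mul_comm]
  exact (mul_le_mul_of_nonneg_right hτ (Nat.cast_nonneg _)).trans (hf _ h)

lemma exists_lintegral_tsum_class_sub_le (A : Finset ℝ) {α β : ℝ} (R : ℝ) (B : ℕ → ℝ) (hα : 0 < α)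
    {p : ℝ} (hp : 4 ≤ p) (hpn : finrank ℚ K < p) (𝒞 : ClassGroup (𝓞 K)) :
    ∃ c C : ℝ, ∀ h f Y, 0 < h → h ≤ 1 / 4 → 1 ≤ Y → IsSmoothedPiecewiseLinear A α β R B h f →
      ∫⁻ μ in Icc (1 - h) (1 + h),
        ‖(∑' I : {I : (Ideal (𝓞 K))⁰ // ClassGroup.mk0 I = 𝒞},
          f (μ / Y * Ideal.absNorm (I.1 : Ideal (𝓞 K)))) - c * (Y / μ) * ∫ v, f v‖ₑ ≤
        ENNReal.ofReal (C * h ^ ((4 - p) / 2)) := by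
  obtain ⟨J, hJ⟩ := ClassGroup.mk0_surjective 𝒞⁻¹
  have hJ' : 𝒞 = (ClassGroup.mk0 J)⁻¹ := by rw [hJ, inv_inv]
  subst hJ'
  obtain ⟨b, hbs, hb⟩ := exists_basis_of_ideal (J : Ideal (𝓞 K)) (nonZeroDivisors.coe_ne_zero J)
  obtain ⟨L, L', hL, hL', hLL'⟩ := exists_lattice_equiv b
  obtain ⟨φ, hφs, hφc, hφ⟩ := exists_zLattice_partition_of_unity (logLattice K)
  obtain ⟨c, C, hC⟩ := exists_lintegral_tsum_polarFun_sub_le (v₀ := (w₀ : InfinitePlace K))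
    (placeOf_surjective K) A (β := β) R B hα hφs hφc hp (by rw [card_index]; exact hpn.le) L L' hLL'
    (fun m hm ↦ by rw [hL']; exact blockProd_traceTwist_ne_zero (intComb_ne_zero _ hm))
    (by simp_rw [hL']; exact summable_blockProd_traceTwist_rpow_mul hbs.traceDual hpn)
  set N : ℝ := ((Ideal.absNorm (J : Ideal (𝓞 K)) : ℕ) : ℝ) with hN_def
  have hN : 1 ≤ N := by
    rw [hN_def, Nat.one_le_cast, Nat.one_le_iff_ne_zero, Ne, Ideal.absNorm_eq_zero_iff]
    exact nonZeroDivisors.coe_ne_zero J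
  set w : ℝ := ((Nat.card (torsion K) : ℕ) : ℝ) with hw_def
  have hw : 0 < w := Nat.cast_pos.mpr Nat.card_pos
  refine ⟨c * N / w, w⁻¹ * C, fun h f Y hh hh4 hY hf ↦ ?_⟩
  have h1 := hC h f (Y * N) (fun t ↦ w * ∑' I : {I : (Ideal (𝓞 K))⁰ //
    ClassGroup.mk0 I = (ClassGroup.mk0 J)⁻¹}, f (t * (Ideal.absNorm (I.1 : Ideal (𝓞 K)) * N)))
    hh hh4 (one_le_mul_of_one_le_of_one_le hY hN) hf fun z s ↦ by
      simp_rw [hL]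
      exact (tsum_polarFun_latticeVec_eq hb hα hf.contDiff hf.support_subset hφs hφc hφ z s).symm
  have h2 : ∀ μ : ℝ, ‖(∑' I : {I : (Ideal (𝓞 K))⁰ // ClassGroup.mk0 I = (ClassGroup.mk0 J)⁻¹},
      f (μ / Y * Ideal.absNorm (I.1 : Ideal (𝓞 K)))) - c * N / w * (Y / μ) * ∫ v, f v‖ₑ =
      ENNReal.ofReal w⁻¹ * ‖w * (∑' I : {I : (Ideal (𝓞 K))⁰ //
        ClassGroup.mk0 I = (ClassGroup.mk0 J)⁻¹}, f (μ / (Y * N) *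
          (Ideal.absNorm (I.1 : Ideal (𝓞 K)) * N))) - c * (Y * N / μ) * ∫ v, f v‖ₑ := fun μ ↦ by
    rw [← Real.enorm_of_nonneg (inv_nonneg.mpr hw.le), ← enorm_mul, mul_sub,
      inv_mul_cancel_left₀ hw.ne']
    congr 2
    · refine tsum_congr fun I ↦ ?_
      congr 1
      field_simp
    · ring
  simp_rw [h2]
  rw [lintegral_const_mul' _ _ ENNReal.ofReal_ne_top, mul_assoc,
    ENNReal.ofReal_mul (inv_nonneg.mpr hw.le)]
  gcongr

lemma tsum_rK_mul_eq {α β : ℝ} (hα : 0 < α) {f : ℝ → ℝ} (hf : ∀ v, f v ≠ 0 → v ∈ Icc α β)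
    {τ : ℝ} (hτ : 0 < τ) :
    ∑' m : ℕ, (rK K m : ℝ) * f (τ * m) = ∑ 𝒞 : ClassGroup (𝓞 K),
      ∑' I : {I : (Ideal (𝓞 K))⁰ // ClassGroup.mk0 I = 𝒞},
        f (τ * Ideal.absNorm (I.1 : Ideal (𝓞 K))) := by
  set φ : (Ideal (𝓞 K))⁰ → ℝ := fun I ↦ f (τ * Ideal.absNorm (I : Ideal (𝓞 K))) with hφ
  have hs : Summable φ := by
    obtain ⟨T, hT⟩ := exists_finset_apply_mul_absNorm_eq_zero (K := K) (β := β) (fun _ ↦ True) hτ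
    refine summable_of_ne_finset_zero (s := T.image Subtype.val) fun I hI ↦ ?_
    exact hT f (fun v hv ↦ (hf v hv).2) τ le_rfl ⟨I, trivial⟩
      fun h ↦ hI (Finset.mem_image_of_mem Subtype.val h)
  have h1 : ∑' I, φ I = ∑ 𝒞 : ClassGroup (𝓞 K),
      ∑' I : {I : (Ideal (𝓞 K))⁰ // ClassGroup.mk0 I = 𝒞}, φ I.1 := by
    have hs' : Summable fun c ↦ φ (Equiv.sigmaFiberEquiv (ClassGroup.mk0 (R := 𝓞 K)) c) :=
      (Equiv.sigmaFiberEquiv _).summable_iff.mpr hs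
    rw [← (Equiv.sigmaFiberEquiv (ClassGroup.mk0 (R := 𝓞 K))).tsum_eq φ, hs'.tsum_sigma,
      tsum_fintype]
    rfl
  rw [← h1]
  let ν : (Ideal (𝓞 K))⁰ → ℕ := fun I ↦ Ideal.absNorm (I : Ideal (𝓞 K))
  have hs' : Summable fun c ↦ φ (Equiv.sigmaFiberEquiv ν c) :=
    (Equiv.sigmaFiberEquiv _).summable_iff.mpr hs
  rw [← (Equiv.sigmaFiberEquiv ν).tsum_eq φ, hs'.tsum_sigma]
  refine tsum_congr fun m ↦ ?_
  have h2 : ∀ I : {I // ν I = m}, φ (Equiv.sigmaFiberEquiv ν ⟨m, I⟩) = f (τ * m) :=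
    fun I ↦ congrArg (fun k : ℕ ↦ f (τ * k)) I.2
  simp_rw [h2, tsum_const, nsmul_eq_mul]
  by_cases hm : m = 0
  · have hf0 : f 0 = 0 := by
      by_contra h
      exact hα.not_ge (hf 0 h).1
    simp [hm, hf0]
  · congr 2
    refine Nat.card_congr ⟨fun I ↦ ⟨⟨I.1, mem_nonZeroDivisors_of_ne_zero fun h ↦ hm ?_⟩, I.2⟩,
      fun I ↦ ⟨I.1, I.2⟩, fun _ ↦ rfl, fun _ ↦ rfl⟩
    rw [← I.2, h]
    simp

variable (K) in
theorem exists_lintegral_tsum_rK_sub_le (A : Finset ℝ) {α β : ℝ} (R : ℝ) (B : ℕ → ℝ)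
    (hα : 0 < α) {p : ℝ} (hp : 4 ≤ p) (hpn : finrank ℚ K < p) :
    ∃ c C : ℝ, ∀ h f Y, 0 < h → h ≤ 1 / 4 → 1 ≤ Y → IsSmoothedPiecewiseLinear A α β R B h f →
      ∫⁻ μ in Icc (1 - h) (1 + h),
        ‖(∑' m : ℕ, (rK K m : ℝ) * f (μ / Y * m)) - c * (Y / μ) * ∫ v, f v‖ₑ ≤
        ENNReal.ofReal (C * h ^ ((4 - p) / 2)) := by
  choose c C hC using exists_lintegral_tsum_class_sub_le (K := K) A (β := β) R B hα hp hpn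
  refine ⟨∑ 𝒞, c 𝒞, ∑ 𝒞, |C 𝒞|, fun h f Y hh hh4 hY hf ↦ ?_⟩
  have hY0 : 0 < Y := by linarith
  have hS : ∀ 𝒞 : ClassGroup (𝓞 K), AEMeasurable (fun μ : ℝ ↦
      ∑' I : {I : (Ideal (𝓞 K))⁰ // ClassGroup.mk0 I = 𝒞},
        f (μ / Y * Ideal.absNorm (I.1 : Ideal (𝓞 K)))) (volume.restrict (Icc (1 - h) (1 + h))) :=
    fun 𝒞 ↦ by
    obtain ⟨T, hT⟩ := exists_finset_apply_mul_absNorm_eq_zero (K := K) (β := β)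
      (fun I ↦ ClassGroup.mk0 I = 𝒞) (τ₀ := (3 / 4) / Y) (by positivity)
    have hm : Measurable fun μ : ℝ ↦ ∑ I ∈ T, f (μ / Y * Ideal.absNorm (I.1 : Ideal (𝓞 K))) := by
      have := hf.contDiff.continuous
      fun_prop
    refine ⟨_, hm, ?_⟩
    filter_upwards [ae_restrict_mem measurableSet_Icc] with μ hμ
    refine tsum_eq_sum fun I hI ↦ hT f (fun v hv ↦ (hf.support_subset v hv).2) _ ?_ I hI
    gcongr
    linarith [hμ.1]
  calc _ ≤ ∫⁻ μ in Icc (1 - h) (1 + h), ∑ 𝒞 : ClassGroup (𝓞 K),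
        ‖(∑' I : {I : (Ideal (𝓞 K))⁰ // ClassGroup.mk0 I = 𝒞},
          f (μ / Y * Ideal.absNorm (I.1 : Ideal (𝓞 K)))) - c 𝒞 * (Y / μ) * ∫ v, f v‖ₑ := by
        refine setLIntegral_mono_ae' measurableSet_Icc (.of_forall fun μ hμ ↦ ?_)
        have hμ0 : 0 < μ := by linarith [hμ.1]
        rw [tsum_rK_mul_eq hα hf.support_subset (div_pos hμ0 hY0), Finset.sum_mul, Finset.sum_mul,
          ← Finset.sum_sub_distrib]
        exact enorm_sum_le _ _
    _ = ∑ 𝒞 : ClassGroup (𝓞 K), ∫⁻ μ in Icc (1 - h) (1 + h),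
        ‖(∑' I : {I : (Ideal (𝓞 K))⁰ // ClassGroup.mk0 I = 𝒞},
          f (μ / Y * Ideal.absNorm (I.1 : Ideal (𝓞 K)))) - c 𝒞 * (Y / μ) * ∫ v, f v‖ₑ := by
        refine lintegral_finsetSum' _ fun 𝒞 _ ↦ ?_
        have := hS 𝒞
        fun_prop
    _ ≤ ∑ 𝒞, ENNReal.ofReal (|C 𝒞| * h ^ ((4 - p) / 2)) := by
        refine Finset.sum_le_sum fun 𝒞 _ ↦ (hC 𝒞 h f Y hh hh4 hY hf).trans ?_
        gcongr
        exact le_abs_self _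
    _ = _ := by
        rw [← ENNReal.ofReal_sum_of_nonneg fun _ _ ↦ by positivity, Finset.sum_mul]

end IdealSum

section Ramp

open scoped ContDiff

/-- A smooth function which agrees with `max s 0` outside `[0, 1]`. -/
noncomputable def smoothRamp (s : ℝ) : ℝ := s * Real.smoothTransition s

/-- A smooth bump function which is `1` on `[-4, 4]` and vanishes outside `[-5, 5]`. -/
noncomputable def rampBump : ContDiffBump (0 : ℝ) := ⟨4, 5, by norm_num, by norm_num⟩

lemma contDiff_smoothRamp : ContDiff ℝ ∞ smoothRamp :=
  contDiff_id.mul Real.smoothTransition.contDiff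

lemma smoothRamp_of_nonpos {s : ℝ} (hs : s ≤ 0) : smoothRamp s = 0 := by
  rw [smoothRamp, Real.smoothTransition.zero_of_nonpos hs, mul_zero]

lemma smoothRamp_of_one_le {s : ℝ} (hs : 1 ≤ s) : smoothRamp s = s := by
  rw [smoothRamp, Real.smoothTransition.one_of_one_le hs, mul_one]

lemma smoothRamp_nonneg (s : ℝ) : 0 ≤ smoothRamp s := by
  rcases le_total s 0 with h | h
  · rw [smoothRamp_of_nonpos h]
  · exact mul_nonneg h (Real.smoothTransition.nonneg s)

lemma smoothRamp_le (s : ℝ) : smoothRamp s ≤ |s| := by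
  rcases le_total s 0 with h | h
  · rw [smoothRamp_of_nonpos h]
    exact abs_nonneg s
  · exact (mul_le_of_le_one_right h (Real.smoothTransition.le_one s)).trans (le_abs_self s)

lemma contDiff_rampBump : ContDiff ℝ ∞ rampBump := rampBump.contDiff

lemma rampBump_eq_one {s : ℝ} (hs : |s| ≤ 4) : rampBump s = 1 :=
  rampBump.one_of_mem_closedBall (by simpa [rampBump] using hs)

lemma rampBump_eq_zero {s : ℝ} (hs : 5 ≤ |s|) : rampBump s = 0 :=
  rampBump.zero_of_le_dist (by simpa [rampBump] using hs)

lemma abs_integral_smoothRamp_sub_le {h a v : ℝ} (hh : 0 < h) (hh1 : h ≤ 1 / 4) (ha : a ≤ 1)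
    (hv : 0 ≤ v) :
    |(∫ μ in (1 - h)..(1 + h), h * smoothRamp ((a - μ * v) / h)) - 2 * h * max (a - v) 0| ≤
      ∫ μ in (1 - h)..(1 + h), 4 * h * rampBump ((a - μ * v) / h) := by
  have hle : 1 - h ≤ 1 + h := by linarith
  have hc1 : Continuous fun μ : ℝ ↦ h * smoothRamp ((a - μ * v) / h) := by
    have := contDiff_smoothRamp.continuous
    fun_prop
  have hc2 : Continuous fun μ : ℝ ↦ 4 * h * rampBump ((a - μ * v) / h) := by
    have := contDiff_rampBump.continuous
    fun_prop
  have hnn : 0 ≤ ∫ μ in (1 - h)..(1 + h), 4 * h * rampBump ((a - μ * v) / h) :=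
    intervalIntegral.integral_nonneg hle fun μ _ ↦
      mul_nonneg (by positivity) rampBump.nonneg
  rcases le_or_gt v (a - 2 * h) with h1 | h1
  · have h2 : ∫ μ in (1 - h)..(1 + h), h * smoothRamp ((a - μ * v) / h) =
        ∫ μ in (1 - h)..(1 + h), (a - μ * v) := by
      refine intervalIntegral.integral_congr fun μ hμ ↦ ?_
      rw [uIcc_of_le hle] at hμ
      have : 1 ≤ (a - μ * v) / h := by
        rw [le_div_iff₀ hh]
        nlinarith [hμ.2]
      rw [smoothRamp_of_one_le this]
      field_simp
    rw [h2, max_eq_left (by linarith), intervalIntegral.integral_sub (by simp)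
      (Continuous.intervalIntegrable (by fun_prop) _ _), intervalIntegral.integral_mul_const,
      integral_id, intervalIntegral.integral_const, smul_eq_mul]
    have : (1 + h - (1 - h)) * a - ((1 + h) ^ 2 - (1 - h) ^ 2) / 2 * v - 2 * h * (a - v) = 0 := by
      ring
    rw [this, abs_zero]
    exact hnn
  rcases le_or_gt (a + 2 * h) v with h2 | h2
  · have h3 : ∫ μ in (1 - h)..(1 + h), h * smoothRamp ((a - μ * v) / h) =
        ∫ μ in (1 - h)..(1 + h), (0 : ℝ) := by
      refine intervalIntegral.integral_congr fun μ hμ ↦ ?_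
      rw [uIcc_of_le hle] at hμ
      have : (a - μ * v) / h ≤ 0 := by
        refine div_nonpos_of_nonpos_of_nonneg ?_ hh.le
        nlinarith [hμ.1]
      rw [smoothRamp_of_nonpos this, mul_zero]
    rw [h3, max_eq_right (by linarith)]
    simpa using hnn
  · have h3 : 2 * h * max (a - v) 0 = ∫ μ in (1 - h)..(1 + h), max (a - v) 0 := by
      rw [intervalIntegral.integral_const, smul_eq_mul]
      ring
    rw [h3, ← intervalIntegral.integral_sub (hc1.intervalIntegrable _ _) (by simp)]
    refine (intervalIntegral.abs_integral_le_integral_abs hle).trans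
      (intervalIntegral.integral_mono_on hle
        (Continuous.intervalIntegrable (by fun_prop) _ _) (hc2.intervalIntegrable _ _)
        fun μ hμ ↦ ?_)
    have h4 : |(a - μ * v) / h| ≤ 4 := by
      rw [abs_div, abs_of_pos hh, div_le_iff₀ hh, abs_le]
      constructor <;> nlinarith [hμ.1, hμ.2]
    rw [rampBump_eq_one h4, mul_one]
    have h5 : h * smoothRamp ((a - μ * v) / h) ≤ h * 4 :=
      mul_le_mul_of_nonneg_left ((smoothRamp_le _).trans h4) hh.le
    have h6 := mul_nonneg hh.le (smoothRamp_nonneg ((a - μ * v) / h))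
    have h7 : max (a - v) 0 ≤ 2 * h := max_le (by linarith) (by linarith)
    have h8 : 0 ≤ max (a - v) 0 := le_max_right _ _
    rw [abs_le]
    constructor <;> linarith

end Ramp

section RampCombination

open scoped ContDiff Topology

/-- A smoothed ramp with slope `c`, modified by a bump of height `d` at the corner. -/
noncomputable def bumpedRamp (c d s : ℝ) : ℝ := c * smoothRamp s + d * rampBump s

variable {c d s : ℝ}

lemma contDiff_bumpedRamp : ContDiff ℝ ∞ (bumpedRamp c d) :=
  (contDiff_const.mul contDiff_smoothRamp).add (contDiff_const.mul contDiff_rampBump)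

lemma bumpedRamp_of_le (hs : s ≤ -5) : bumpedRamp c d s = 0 := by
  rw [bumpedRamp, smoothRamp_of_nonpos (by linarith),
    rampBump_eq_zero (by rw [abs_of_nonpos (by linarith)]; linarith)]
  ring

lemma bumpedRamp_of_ge (hs : 5 ≤ s) : bumpedRamp c d s = c * s := by
  rw [bumpedRamp, smoothRamp_of_one_le (by linarith),
    rampBump_eq_zero (hs.trans (le_abs_self s))]
  ring

lemma abs_bumpedRamp_le (c d s : ℝ) : |bumpedRamp c d s| ≤ (|c| + |d|) * (1 + |s|) := by
  have h1 : |smoothRamp s| ≤ |s| := by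
    rw [abs_of_nonneg (smoothRamp_nonneg s)]
    exact smoothRamp_le s
  have h2 : |rampBump s| ≤ 1 := by
    rw [abs_of_nonneg rampBump.nonneg]
    exact rampBump.le_one
  calc |bumpedRamp c d s| ≤ |c| * |smoothRamp s| + |d| * |rampBump s| := by
        rw [bumpedRamp, ← abs_mul, ← abs_mul]
        exact abs_add_le _ _
    _ ≤ |c| * |s| + |d| * 1 := by gcongr
    _ ≤ _ := by nlinarith [abs_nonneg c, abs_nonneg d, abs_nonneg s, mul_nonneg (abs_nonneg d) (abs_nonneg s)]

lemma iteratedDeriv_bumpedRamp_of_lt (hs : 5 < |s|) (j : ℕ) :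
    (iteratedDeriv (j + 1) (bumpedRamp c d) s = 0) ∨
      (iteratedDeriv (j + 1) (bumpedRamp c d) s = if j = 0 then c else 0) := by
  rcases lt_abs.mp hs with h | h
  · right
    have h1 : bumpedRamp c d =ᶠ[𝓝 s] fun s ↦ c * s := by
      filter_upwards [lt_mem_nhds h] with x hx using bumpedRamp_of_ge hx.le
    have h2 : deriv (fun s ↦ c * s) = fun _ : ℝ ↦ c := by
      ext x
      simp
    rw [h1.iteratedDeriv_eq, iteratedDeriv_succ', h2, iteratedDeriv_const]
  · left
    have h1 : bumpedRamp c d =ᶠ[𝓝 s] fun s ↦ 0 := by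
      filter_upwards [gt_mem_nhds (show s < -5 by linarith)] with x hx using bumpedRamp_of_le hx.le
    rw [h1.iteratedDeriv_eq, iteratedDeriv_fun_const_zero]

lemma abs_le_of_iteratedDeriv_bumpedRamp_ne_zero {j : ℕ} (hj : 2 ≤ j)
    (h : iteratedDeriv j (bumpedRamp c d) s ≠ 0) : |s| ≤ 5 := by
  by_contra! h5
  obtain ⟨k, rfl⟩ : ∃ k, j = k + 1 := ⟨j - 1, by omega⟩
  rcases iteratedDeriv_bumpedRamp_of_lt (c := c) (d := d) h5 k with h1 | h1
  · exact h h1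
  · rw [if_neg (by omega)] at h1
    exact h h1

lemma exists_abs_iteratedDeriv_bumpedRamp_le (c d : ℝ) (j : ℕ) (hj : 1 ≤ j) :
    ∃ D : ℝ, ∀ s, |iteratedDeriv j (bumpedRamp c d) s| ≤ D := by
  obtain ⟨k, rfl⟩ : ∃ k, j = k + 1 := ⟨j - 1, by omega⟩
  obtain ⟨D, hD⟩ := (isCompact_Icc (a := (-5 : ℝ)) (b := 5)).exists_bound_of_continuousOn
    ((contDiff_bumpedRamp (c := c) (d := d)).continuous_iteratedDeriv (k + 1)
      (mod_cast le_top)).continuousOn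
  refine ⟨max D |c|, fun s ↦ ?_⟩
  rcases le_or_gt |s| 5 with h5 | h5
  · exact (hD s (abs_le.mp h5)).trans (le_max_left _ _)
  · rcases iteratedDeriv_bumpedRamp_of_lt (c := c) (d := d) h5 k with h1 | h1
    · rw [h1, abs_zero]
      exact (abs_nonneg c).trans (le_max_right _ _)
    · rw [h1]
      refine le_trans ?_ (le_max_right _ _)
      split_ifs <;> simp

lemma iteratedDeriv_scaled {φ : ℝ → ℝ} (hφ : ContDiff ℝ ∞ φ) (h a : ℝ) (j : ℕ) (v : ℝ) :
    iteratedDeriv j (fun v ↦ h * φ ((a - v) / h)) v =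
      h * ((-h⁻¹) ^ j * iteratedDeriv j φ ((a - v) / h)) := by
  rw [iteratedDeriv_const_mul_field]
  congr 1
  have h1 := iteratedDeriv_comp_const_sub j (fun x ↦ φ (h⁻¹ * x)) a
  rw [iteratedDeriv_comp_const_mul (hφ.of_le (mod_cast le_top))] at h1
  have h2 := congrFun h1 v
  simp only [smul_eq_mul, ← div_eq_inv_mul] at h2
  rw [h2, ← mul_assoc, ← mul_pow]
  ring

variable {ι : Type*} [Fintype ι]

/-- A smoothing at scale `h` of the piecewise linear function `∑ i, c i * max (a i - v) 0`. -/
noncomputable def rampSum (a c d : ι → ℝ) (h v : ℝ) : ℝ :=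
  ∑ i, h * bumpedRamp (c i) (d i) ((a i - v) / h)

lemma isSmoothedPiecewiseLinear_rampSum {a c d : ι → ℝ} (ha : ∀ i, a i ∈ Icc (1 / 4) 1)
    (hc0 : ∑ i, c i = 0) (hc1 : ∑ i, c i * a i = 0) {D : ι → ℕ → ℝ}
    (hD : ∀ i j, 1 ≤ j → ∀ s, |iteratedDeriv j (bumpedRamp (c i) (d i)) s| ≤ D i j)
    {h : ℝ} (hh : 0 < h) (hh1 : h ≤ 1 / 100) :
    IsSmoothedPiecewiseLinear (Finset.univ.image a) (1 / 8) 2 5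
      (fun j ↦ if j = 0 then ∑ i, 4 * (|c i| + |d i|) else ∑ i, D i j) h (rampSum a c d h) := by
  have hsupp : ∀ v, rampSum a c d h v ≠ 0 → v ∈ Icc (1 / 8 : ℝ) 2 := fun v hv ↦ by
    by_contra hv'
    refine hv ?_
    rw [mem_Icc, not_and_or, not_le, not_le] at hv'
    rcases hv' with hv' | hv'
    · have h1 : ∀ i, h * bumpedRamp (c i) (d i) ((a i - v) / h) = c i * a i - c i * v := fun i ↦ by
        rw [bumpedRamp_of_ge (by rw [le_div_iff₀ hh]; linarith [(ha i).1])]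
        field_simp
      simp_rw [rampSum, h1, Finset.sum_sub_distrib, ← Finset.sum_mul, hc0, hc1]
      ring
    · refine Finset.sum_eq_zero fun i _ ↦ ?_
      rw [bumpedRamp_of_le (by rw [div_le_iff₀ hh]; linarith [(ha i).2]), mul_zero]
  have hder : ∀ j v, iteratedDeriv j (rampSum a c d h) v =
      ∑ i, h * ((-h⁻¹) ^ j * iteratedDeriv j (bumpedRamp (c i) (d i)) ((a i - v) / h)) :=
    fun j v ↦ by
    simp_rw [← iteratedDeriv_scaled contDiff_bumpedRamp]
    refine iteratedDeriv_fun_sum fun i _ ↦ ?_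
    have := (contDiff_bumpedRamp (c := c i) (d := d i)).of_le (m := (j : ℕ∞)) (mod_cast le_top)
    refine ContDiff.contDiffAt ?_
    exact contDiff_const.mul (this.comp ((contDiff_const.sub contDiff_id).div_const h))
  have habs : ∀ j v, |iteratedDeriv j (rampSum a c d h) v| ≤
      ∑ i, h * (h⁻¹ ^ j * |iteratedDeriv j (bumpedRamp (c i) (d i)) ((a i - v) / h)|) :=
    fun j v ↦ by
    rw [hder]
    refine (Finset.abs_sum_le_sum_abs _ _).trans (Finset.sum_le_sum fun i _ ↦ le_of_eq ?_)
    rw [abs_mul, abs_mul, abs_pow, abs_neg, abs_inv, abs_of_pos hh]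
  refine ⟨?_, hsupp, fun v ↦ ?_, fun v ↦ ?_, fun j hj v ↦ ?_, fun j hj v hv ↦ ?_⟩
  · refine ContDiff.sum fun i _ ↦ ?_
    exact contDiff_const.mul (contDiff_bumpedRamp.comp
      ((contDiff_const.sub contDiff_id).div_const h))
  · rw [if_pos rfl]
    by_cases hv : rampSum a c d h v = 0
    · rw [hv, abs_zero]
      positivity
    · have hv' := hsupp v hv
      refine (Finset.abs_sum_le_sum_abs _ _).trans (Finset.sum_le_sum fun i _ ↦ ?_)
      rw [abs_mul, abs_of_pos hh]
      calc _ ≤ h * ((|c i| + |d i|) * (1 + |(a i - v) / h|)) := by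
            gcongr
            exact abs_bumpedRamp_le _ _ _
        _ = (|c i| + |d i|) * (h + |a i - v|) := by
            rw [abs_div, abs_of_pos hh]
            field_simp
        _ ≤ (|c i| + |d i|) * 4 := by
            gcongr
            have : |a i - v| ≤ 2 := by
              rw [abs_le]
              constructor <;> linarith [(ha i).1, (ha i).2, hv'.1, hv'.2]
            linarith
        _ = _ := mul_comm _ _
  · rw [if_neg one_ne_zero]
    refine (habs 1 v).trans (Finset.sum_le_sum fun i _ ↦ ?_)
    rw [pow_one, mul_inv_cancel_left₀ hh.ne']
    exact hD i 1 le_rfl _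
  · rw [if_neg (by omega), mul_assoc, Finset.sum_mul]
    refine (habs j v).trans (Finset.sum_le_sum fun i _ ↦ ?_)
    rw [← mul_assoc, mul_comm (D i j)]
    gcongr
    exact hD i j (by omega) _
  · rw [hder] at hv
    obtain ⟨i, -, hi⟩ := Finset.exists_ne_zero_of_sum_ne_zero hv
    have h1 : iteratedDeriv j (bumpedRamp (c i) (d i)) ((a i - v) / h) ≠ 0 := fun h0 ↦ hi (by
      rw [h0, mul_zero, mul_zero])
    have h2 := abs_le_of_iteratedDeriv_bumpedRamp_ne_zero hj h1
    refine ⟨a i, Finset.mem_image_of_mem a (Finset.mem_univ i), ?_⟩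
    rwa [abs_sub_comm, ← div_le_iff₀ hh, ← abs_of_pos hh, ← abs_div]

end RampCombination

section Tent

variable {ι : Type*} [Fintype ι]

/-- The piecewise linear function `∑ i, c i * max (a i - v) 0`. -/
noncomputable def tentSum (a c : ι → ℝ) (v : ℝ) : ℝ := ∑ i, c i * max (a i - v) 0

lemma abs_integral_rampSum_sub_le {a c d : ι → ℝ} {h v : ℝ} (hh : 0 < h) (hh1 : h ≤ 1 / 4)
    (ha : ∀ i, a i ≤ 1) (hv : 0 ≤ v) :
    |(∫ μ in (1 - h)..(1 + h), rampSum a c d h (μ * v)) -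
      ∑ i, d i * (∫ μ in (1 - h)..(1 + h), h * rampBump ((a i - μ * v) / h)) -
      2 * h * tentSum a c v| ≤
      ∑ i, 4 * |c i| * ∫ μ in (1 - h)..(1 + h), h * rampBump ((a i - μ * v) / h) := by
  have hc1 : ∀ i, Continuous fun μ : ℝ ↦ h * smoothRamp ((a i - μ * v) / h) := fun i ↦ by
    have := contDiff_smoothRamp.continuous
    fun_prop
  have hc2 : ∀ i, Continuous fun μ : ℝ ↦ h * rampBump ((a i - μ * v) / h) := fun i ↦ by
    have := contDiff_rampBump.continuous
    fun_prop
  have h1 : ∫ μ in (1 - h)..(1 + h), rampSum a c d h (μ * v) =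
      ∑ i, (c i * (∫ μ in (1 - h)..(1 + h), h * smoothRamp ((a i - μ * v) / h)) +
        d i * ∫ μ in (1 - h)..(1 + h), h * rampBump ((a i - μ * v) / h)) := by
    have : ∀ i μ, h * bumpedRamp (c i) (d i) ((a i - μ * v) / h) =
        c i * (h * smoothRamp ((a i - μ * v) / h)) + d i * (h * rampBump ((a i - μ * v) / h)) :=
      fun i μ ↦ by rw [bumpedRamp]; ring
    simp_rw [rampSum, this]
    have hInt : ∀ i, IntervalIntegrable (fun μ : ℝ ↦ c i * (h * smoothRamp ((a i - μ * v) / h)) +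
        d i * (h * rampBump ((a i - μ * v) / h))) volume (1 - h) (1 + h) := fun i ↦
      ((continuous_const.mul (hc1 i)).add (continuous_const.mul (hc2 i))).intervalIntegrable _ _
    rw [intervalIntegral.integral_finsetSum fun i _ ↦ hInt i]
    refine Finset.sum_congr rfl fun i _ ↦ ?_
    rw [intervalIntegral.integral_add (((hc1 i).intervalIntegrable _ _).const_mul _)
      (((hc2 i).intervalIntegrable _ _).const_mul _),
      intervalIntegral.integral_const_mul (c i), intervalIntegral.integral_const_mul (d i)]
  rw [h1, tentSum, Finset.mul_sum, ← Finset.sum_sub_distrib, ← Finset.sum_sub_distrib]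
  refine (Finset.abs_sum_le_sum_abs _ _).trans (Finset.sum_le_sum fun i _ ↦ ?_)
  have h2 := abs_integral_smoothRamp_sub_le (a := a i) hh hh1 (ha i) hv
  have h3 : ∫ μ in (1 - h)..(1 + h), 4 * h * rampBump ((a i - μ * v) / h) =
      4 * ∫ μ in (1 - h)..(1 + h), h * rampBump ((a i - μ * v) / h) := by
    rw [← intervalIntegral.integral_const_mul]
    simp_rw [mul_assoc]
  rw [h3] at h2
  calc _ = |c i * ((∫ μ in (1 - h)..(1 + h), h * smoothRamp ((a i - μ * v) / h)) -
        2 * h * max (a i - v) 0)| := by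
        congr 1
        ring
    _ ≤ |c i| * (4 * ∫ μ in (1 - h)..(1 + h), h * rampBump ((a i - μ * v) / h)) := by
        rw [abs_mul]
        exact mul_le_mul_of_nonneg_left h2 (abs_nonneg _)
    _ = _ := by ring

lemma tentSum_le_integral_rampSum {a c d : ι → ℝ} {h v : ℝ} (hh : 0 < h) (hh1 : h ≤ 1 / 4)
    (ha : ∀ i, a i ≤ 1) (hv : 0 ≤ v) (hd : ∀ i, 4 * |c i| = d i) :
    2 * h * tentSum a c v ≤ ∫ μ in (1 - h)..(1 + h), rampSum a c d h (μ * v) := by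
  have h1 := neg_le_of_abs_le (abs_integral_rampSum_sub_le (c := c) (d := d) hh hh1 ha hv)
  simp_rw [hd] at h1
  linarith

lemma integral_rampSum_le_tentSum {a c d : ι → ℝ} {h v : ℝ} (hh : 0 < h) (hh1 : h ≤ 1 / 4)
    (ha : ∀ i, a i ≤ 1) (hv : 0 ≤ v) (hd : ∀ i, 4 * |c i| = - d i) :
    ∫ μ in (1 - h)..(1 + h), rampSum a c d h (μ * v) ≤ 2 * h * tentSum a c v := by
  have h1 := le_of_abs_le (abs_integral_rampSum_sub_le (c := c) (d := d) hh hh1 ha hv)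
  simp_rw [hd, neg_mul, Finset.sum_neg_distrib] at h1
  linarith

lemma integral_max_sub {a : ℝ} (ha : a ∈ Icc (0 : ℝ) 2) :
    ∫ v in (0 : ℝ)..2, max (a - v) 0 = a ^ 2 / 2 := by
  have hc : Continuous fun v : ℝ ↦ max (a - v) 0 := by fun_prop
  rw [← intervalIntegral.integral_add_adjacent_intervals (hc.intervalIntegrable 0 a)
    (hc.intervalIntegrable a 2)]
  have h1 : ∫ v in (0 : ℝ)..a, max (a - v) 0 = ∫ v in (0 : ℝ)..a, (a - v) := by
    refine intervalIntegral.integral_congr fun v hv ↦ ?_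
    rw [uIcc_of_le ha.1] at hv
    exact max_eq_left (by linarith [hv.2])
  have h2 : ∫ v in a..2, max (a - v) 0 = ∫ v in a..2, (0 : ℝ) := by
    refine intervalIntegral.integral_congr fun v hv ↦ ?_
    rw [uIcc_of_le ha.2] at hv
    exact max_eq_right (by linarith [hv.1])
  rw [h1, h2, intervalIntegral.integral_sub (by simp) (by simp)]
  simp
  ring

lemma abs_integral_bumpedRamp_sub_le {a c d h : ℝ} (ha : a ∈ Icc (1 / 4 : ℝ) 1) (hh : 0 < h)
    (hh1 : h ≤ 1 / 100) :
    |(∫ v in (0 : ℝ)..2, h * bumpedRamp c d ((a - v) / h)) - c * (a ^ 2 / 2)| ≤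
      110 * (|c| + |d|) * h ^ 2 := by
  have hc1 : Continuous fun v : ℝ ↦ h * bumpedRamp c d ((a - v) / h) := by
    have := (contDiff_bumpedRamp (c := c) (d := d)).continuous
    fun_prop
  have hc2 : Continuous fun v : ℝ ↦ c * max (a - v) 0 := by fun_prop
  rw [← integral_max_sub ⟨by linarith [ha.1], by linarith [ha.2]⟩,
    ← intervalIntegral.integral_const_mul,
    ← intervalIntegral.integral_sub (hc1.intervalIntegrable _ _) (hc2.intervalIntegrable _ _)]
  have hsupp : ∀ v, 5 * h ≤ |a - v| →
      h * bumpedRamp c d ((a - v) / h) - c * max (a - v) 0 = 0 := fun v hv ↦ by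
    rcases le_abs.mp hv with h1 | h1
    · rw [bumpedRamp_of_ge ((le_div_iff₀ hh).mpr h1), max_eq_left (by linarith)]
      field_simp
      ring
    · rw [bumpedRamp_of_le ((div_le_iff₀ hh).mpr (by linarith)), max_eq_right (by linarith)]
      ring
  have hs : ∀ v, h * bumpedRamp c d ((a - v) / h) - c * max (a - v) 0 ≠ 0 →
      v ∈ Ioc (a - 5 * h) (a + 5 * h) := fun v hv ↦ by
    have := lt_of_not_ge fun h0 ↦ hv (hsupp v h0)
    rw [abs_lt] at this
    constructor <;> linarith [this.1, this.2]
  have hs' : Function.support (fun v ↦ h * bumpedRamp c d ((a - v) / h) - c * max (a - v) 0) ⊆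
      Ioc 0 2 := fun v hv ↦ by
    have := hs v hv
    constructor <;> linarith [this.1, this.2, ha.1, ha.2]
  rw [intervalIntegral.integral_eq_integral_of_support_subset hs',
    ← intervalIntegral.integral_eq_integral_of_support_subset (a := a - 5 * h) (b := a + 5 * h) hs,
    ← Real.norm_eq_abs]
  refine (intervalIntegral.norm_integral_le_of_norm_le_const (C := 11 * (|c| + |d|) * h)
    fun v hv ↦ ?_).trans (le_of_eq ?_)
  · rw [uIoc_of_le (by linarith)] at hv
    have h1 : |a - v| ≤ 5 * h := abs_le.mpr ⟨by linarith [hv.2], by linarith [hv.1]⟩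
    have h2 : |(a - v) / h| ≤ 5 := by
      rwa [abs_div, abs_of_pos hh, div_le_iff₀ hh]
    have h3 : max (a - v) 0 ≤ 5 * h := max_le ((le_abs_self _).trans h1) (by positivity)
    calc _ ≤ |h * bumpedRamp c d ((a - v) / h)| + |c * max (a - v) 0| := norm_sub_le _ _
      _ = h * |bumpedRamp c d ((a - v) / h)| + |c| * max (a - v) 0 := by
          rw [abs_mul, abs_mul, abs_of_pos hh, abs_of_nonneg (le_max_right (a - v) 0)]
      _ ≤ h * ((|c| + |d|) * (1 + 5)) + |c| * (5 * h) := by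
          gcongr
          exact (abs_bumpedRamp_le _ _ _).trans (by gcongr)
      _ ≤ _ := by nlinarith [mul_nonneg (abs_nonneg d) hh.le]
  · rw [abs_of_pos (show 0 < a + 5 * h - (a - 5 * h) by linarith)]
    ring

lemma abs_integral_rampSum_sub_sq_le {a c d : ι → ℝ} (ha : ∀ i, a i ∈ Icc (1 / 4) 1) {h : ℝ}
    (hh : 0 < h) (hh1 : h ≤ 1 / 100) (hs : ∀ v, rampSum a c d h v ≠ 0 → v ∈ Icc (1 / 8) 2) :
    |(∫ v, rampSum a c d h v) - ∑ i, c i * (a i ^ 2 / 2)| ≤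
      (∑ i, 110 * (|c i| + |d i|)) * h ^ 2 := by
  have hs' : Function.support (rampSum a c d h) ⊆ Ioc 0 2 := fun v hv ↦ by
    have := hs v hv
    constructor <;> linarith [this.1, this.2]
  rw [← intervalIntegral.integral_eq_integral_of_support_subset hs']
  simp_rw [rampSum]
  have hInt : ∀ i, IntervalIntegrable (fun v ↦ h * bumpedRamp (c i) (d i) ((a i - v) / h))
      volume 0 2 := fun i ↦ Continuous.intervalIntegrable (by
    have := (contDiff_bumpedRamp (c := c i) (d := d i)).continuous
    fun_prop) _ _
  rw [intervalIntegral.integral_finsetSum fun i _ ↦ hInt i, ← Finset.sum_sub_distrib, Finset.sum_mul]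
  exact (Finset.abs_sum_le_sum_abs _ _).trans (Finset.sum_le_sum fun i _ ↦
    abs_integral_bumpedRamp_sub_le (ha i) hh hh1)

end Tent

section TentBound

lemma abs_integral_inv_sub_le {h : ℝ} (hh : 0 < h) (hh1 : h ≤ 1 / 2) :
    |(∫ μ in (1 - h)..(1 + h), μ⁻¹) - 2 * h| ≤ 4 * h ^ 3 := by
  have hle : 1 - h ≤ 1 + h := by linarith
  have h1 : ∫ μ in (1 - h)..(1 + h), (2 - μ) = 2 * h := by
    rw [intervalIntegral.integral_sub (by simp) (by simp), integral_id,
      intervalIntegral.integral_const, smul_eq_mul]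
    ring
  have hpos : ∀ μ ∈ uIcc (1 - h) (1 + h), 1 / 2 ≤ μ := fun μ hμ ↦ by
    rw [uIcc_of_le hle] at hμ
    linarith [hμ.1]
  have hInt : IntervalIntegrable (fun μ : ℝ ↦ μ⁻¹) volume (1 - h) (1 + h) :=
    intervalIntegral.intervalIntegrable_inv (fun μ hμ ↦ by linarith [hpos μ hμ])
      continuousOn_id
  rw [← h1, ← intervalIntegral.integral_sub hInt (by
    exact (continuous_const.sub continuous_id).intervalIntegrable _ _), ← Real.norm_eq_abs]
  refine (intervalIntegral.norm_integral_le_of_norm_le_const (C := 2 * h ^ 2)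
    fun μ hμ ↦ ?_).trans (le_of_eq ?_)
  · have h2 := hpos μ (uIoc_subset_uIcc hμ)
    rw [uIoc_of_le hle] at hμ
    have h3 : μ⁻¹ - (2 - μ) = (μ - 1) ^ 2 * μ⁻¹ := by
      field_simp
      ring
    have h4 : (μ - 1) ^ 2 ≤ h ^ 2 := by nlinarith [hμ.1, hμ.2]
    have h5 : μ⁻¹ ≤ 2 := by
      rw [inv_le_comm₀ (by linarith) two_pos]
      linarith
    have h6 : 0 ≤ μ⁻¹ := inv_nonneg.mpr (by linarith)
    rw [h3, Real.norm_eq_abs, abs_of_nonneg (by positivity)]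
    calc _ ≤ h ^ 2 * 2 := by gcongr
      _ = _ := by ring
  · rw [abs_of_pos (by linarith)]
    ring

lemma abs_integral_sum_sub_le_of_lintegral_le {r : ℕ → ℝ} {f : ℝ → ℝ} {α β h t c D : ℝ}
    (hf : Continuous f) (hα : 0 < α) (hs : ∀ v, f v ≠ 0 → v ∈ Icc α β) (hh : 0 < h)
    (hh1 : h ≤ 1 / 2) (ht : 0 < t) {N : ℕ} (hN : 2 * β * t ≤ N)
    (hD : ∫⁻ μ in Icc (1 - h) (1 + h),
      ‖(∑' m : ℕ, r m * f (μ / t * m)) - c * (t / μ) * ∫ v, f v‖ₑ ≤ ENNReal.ofReal D) :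
    |(∑ m ∈ Finset.Icc 1 N, r m * ∫ μ in (1 - h)..(1 + h), f (μ * (m / t))) -
      c * t * (∫ v, f v) * ∫ μ in (1 - h)..(1 + h), μ⁻¹| ≤ |D| := by
  have hle : 1 - h ≤ 1 + h := by linarith
  have hsum : ∀ μ ∈ Icc (1 - h) (1 + h), ∑' m : ℕ, r m * f (μ / t * m) =
      ∑ m ∈ Finset.Icc 1 N, r m * f (μ * (m / t)) := fun μ hμ ↦ by
    rw [tsum_eq_sum (s := Finset.Icc 1 N)]
    · refine Finset.sum_congr rfl fun m _ ↦ ?_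
      congr 2
      ring
    · intro m hm
      by_contra h0
      have h1 := hs _ (right_ne_zero_of_mul h0)
      refine hm (Finset.mem_Icc.mpr ⟨?_, ?_⟩)
      · by_contra h2
        have h3 : m = 0 := by omega
        rw [h3, Nat.cast_zero, mul_zero] at h1
        exact hα.not_ge h1.1
      · have h2 := h1.2
        rw [div_mul_eq_mul_div, div_le_iff₀ ht] at h2
        have h3 : (m : ℝ) ≤ N := by
          nlinarith [hμ.1, (Nat.cast_nonneg m : (0 : ℝ) ≤ m)]
        exact_mod_cast h3
  have hint1 : ∀ m : ℕ, IntervalIntegrable (fun μ ↦ r m * f (μ * (m / t))) volume (1 - h) (1 + h) :=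
    fun m ↦ Continuous.intervalIntegrable (by fun_prop) _ _
  have hint2 : IntervalIntegrable (fun μ : ℝ ↦ μ⁻¹) volume (1 - h) (1 + h) :=
    intervalIntegral.intervalIntegrable_inv (fun μ hμ ↦ by
      rw [uIcc_of_le hle] at hμ
      linarith [hμ.1]) continuousOn_id
  have h1 : (∑ m ∈ Finset.Icc 1 N, r m * ∫ μ in (1 - h)..(1 + h), f (μ * (m / t))) -
      c * t * (∫ v, f v) * ∫ μ in (1 - h)..(1 + h), μ⁻¹ =
      ∫ μ in (1 - h)..(1 + h), ((∑ m ∈ Finset.Icc 1 N, r m * f (μ * (m / t))) -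
        c * t * (∫ v, f v) * μ⁻¹) := by
    rw [intervalIntegral.integral_sub (Continuous.intervalIntegrable (by fun_prop) _ _) (hint2.const_mul _), intervalIntegral.integral_finsetSum fun m _ ↦ hint1 m,
      intervalIntegral.integral_const_mul (c * t * ∫ v, f v)]
    congr 1
    exact Finset.sum_congr rfl fun m _ ↦ (intervalIntegral.integral_const_mul _ _).symm
  rw [h1, intervalIntegral.integral_of_le hle, ← Real.norm_eq_abs,
    ← ENNReal.ofReal_le_ofReal_iff (abs_nonneg D), ofReal_norm]
  calc _ ≤ ∫⁻ μ in Ioc (1 - h) (1 + h), ‖(∑ m ∈ Finset.Icc 1 N, r m * f (μ * (m / t))) -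
        c * t * (∫ v, f v) * μ⁻¹‖ₑ := enorm_integral_le_lintegral_enorm _
    _ = ∫⁻ μ in Ioc (1 - h) (1 + h),
        ‖(∑' m : ℕ, r m * f (μ / t * m)) - c * (t / μ) * ∫ v, f v‖ₑ := by
        refine setLIntegral_congr_fun measurableSet_Ioc fun μ hμ ↦ ?_
        rw [hsum μ ⟨hμ.1.le, hμ.2⟩]
        congr 2
        ring
    _ ≤ _ := lintegral_mono_set Ioc_subset_Icc_self
    _ ≤ _ := hD
    _ ≤ _ := ENNReal.ofReal_le_ofReal (le_abs_self D)

lemma tentSum_eq_zero_of_one_le {ι : Type*} [Fintype ι] {a c : ι → ℝ} (ha : ∀ i, a i ≤ 1)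
    {v : ℝ} (hv : 1 ≤ v) : tentSum a c v = 0 :=
  Finset.sum_eq_zero fun i _ ↦ by rw [max_eq_right (by linarith [ha i]), mul_zero]

lemma rpow_scale_le {n p ε t : ℝ} (hn : 6 ≤ n) (hε : 0 < ε) (hp : p = n + ε) (ht : 1 ≤ t) :
    (t ^ (-3 / (2 * n)) / 100) ^ ((2 - p) / 2) ≤
      100 ^ ((p - 2) / 2) * t ^ (1 - 3 / n + ε) := by
  have ht0 : 0 < t := by linarith
  rw [Real.div_rpow (Real.rpow_nonneg ht0.le _) (by norm_num), ← Real.rpow_mul ht0.le,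
    div_eq_mul_inv, ← Real.rpow_neg (by norm_num), mul_comm]
  gcongr ?_ * ?_
  · exact le_of_eq (by ring_nf)
  · refine Real.rpow_le_rpow_of_exponent_le ht ?_
    have hn0 : 0 < n := by linarith
    have h1 : -3 / (2 * n) * ((2 - p) / 2) = (3 / 4 * n + 3 / 4 * ε - 3 / 2) / n := by
      rw [hp]
      field_simp
      ring
    have h2 : 1 - 3 / n + ε = (n - 3 + ε * n) / n := by
      field_simp
    rw [h1, h2]
    gcongr
    nlinarith

theorem exists_abs_sum_rK_tentSum_sub_le (K : Type*) [Field K] [NumberField K]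
    (hn : 6 ≤ Module.finrank ℚ K) {ε : ℝ} (hε : 0 < ε) {ι : Type*} [Fintype ι] {a c : ι → ℝ}
    (ha : ∀ i, a i ∈ Icc (1 / 4) 1) (hc0 : ∑ i, c i = 0) (hc1 : ∑ i, c i * a i = 0) :
    ∃ κ C : ℝ, ∀ t : ℝ, 1 ≤ t → ∀ N : ℕ, t ≤ N →
      |(∑ m ∈ Finset.Icc 1 N, (rK K m : ℝ) * tentSum a c (m / t)) -
        κ * t * ∑ i, c i * (a i ^ 2 / 2)| ≤ C * t ^ (1 - 3 / (Module.finrank ℚ K : ℝ) + ε) := by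
  set n : ℝ := ((Module.finrank ℚ K : ℕ) : ℝ) with hn_def
  have hn6 : 6 ≤ n := by rw [hn_def]; exact_mod_cast hn
  set d : ι → ℝ := fun i ↦ 4 * |c i| with hd_def
  choose! D₁ hD₁ using fun (i : ι) (j : ℕ) (hj : 1 ≤ j) ↦
    exists_abs_iteratedDeriv_bumpedRamp_le (c i) (d i) j hj
  choose! D₂ hD₂ using fun (i : ι) (j : ℕ) (hj : 1 ≤ j) ↦
    exists_abs_iteratedDeriv_bumpedRamp_le (c i) (-d i) j hj
  set D : ι → ℕ → ℝ := fun i j ↦ max (D₁ i j) (D₂ i j) with hD_def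
  set B : ℕ → ℝ := fun j ↦ if j = 0 then ∑ i, 4 * (|c i| + |d i|) else ∑ i, D i j with hB_def
  obtain ⟨κ, C, hC⟩ := exists_lintegral_tsum_rK_sub_le K (Finset.univ.image a) (α := 1 / 8)
    (β := 2) 5 B (by norm_num) (p := n + ε) (by linarith) (by linarith)
  set I₀ : ℝ := ∑ i, c i * (a i ^ 2 / 2) with hI₀
  set M : ℝ := ∑ i, 110 * (|c i| + |d i|) with hM
  have hM0 : 0 ≤ M := Finset.sum_nonneg fun i _ ↦ by positivity
  have key : ∀ t : ℝ, 1 ≤ t → ∀ N : ℕ, 4 * t ≤ N → ∀ h, 0 < h → h ≤ 1 / 100 → ∀ f : ℝ → ℝ,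
      IsSmoothedPiecewiseLinear (Finset.univ.image a) (1 / 8) 2 5 B h f →
      |(∫ v, f v) - I₀| ≤ M * h ^ 2 →
      |(∑ m ∈ Finset.Icc 1 N, (rK K m : ℝ) * ∫ μ in (1 - h)..(1 + h), f (μ * (m / t))) -
        2 * h * (κ * t * I₀)| ≤
        2 * h * (|κ| * (2 * M + 2 * |I₀|) * (t * h ^ 2) + |C| * h ^ ((2 - (n + ε)) / 2)) := by
    intro t ht N hN h hh hh1 f hf hfI
    have hC' := abs_integral_sum_sub_le_of_lintegral_le (N := N) (by exact hf.contDiff.continuous)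
      (by norm_num) hf.support_subset hh (by linarith) (by linarith) (by linarith)
      (hC h f t hh (by linarith) ht hf)
    set L : ℝ := ∫ μ in (1 - h)..(1 + h), μ⁻¹ with hL
    have hL1 : |L - 2 * h| ≤ 4 * h ^ 3 := abs_integral_inv_sub_le hh (by linarith)
    have hL2 : |L| ≤ 4 * h := by
      have := abs_sub_abs_le_abs_sub L (2 * h)
      rw [abs_of_pos (show 0 < 2 * h by linarith)] at this
      nlinarith [pow_pos hh 2, pow_pos hh 3]
    have h1 : |(∫ v, f v) * L - 2 * h * I₀| ≤ (4 * M + 4 * |I₀|) * h ^ 3 := by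
      calc _ = |((∫ v, f v) - I₀) * L + I₀ * (L - 2 * h)| := by
            congr 1
            ring
        _ ≤ |(∫ v, f v) - I₀| * |L| + |I₀| * |L - 2 * h| := by
            rw [← abs_mul, ← abs_mul]
            exact abs_add_le _ _
        _ ≤ M * h ^ 2 * (4 * h) + |I₀| * (4 * h ^ 3) := by gcongr
        _ = _ := by ring
    have h2 : |C * h ^ ((4 - (n + ε)) / 2)| = h * (|C| * h ^ ((2 - (n + ε)) / 2)) := by
      rw [abs_mul, abs_of_pos (Real.rpow_pos_of_pos hh _),
        show (4 - (n + ε)) / 2 = 1 + (2 - (n + ε)) / 2 by ring, Real.rpow_add hh, Real.rpow_one]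
      ring
    rw [h2] at hC'
    set Z := ∑ m ∈ Finset.Icc 1 N, (rK K m : ℝ) * ∫ μ in (1 - h)..(1 + h), f (μ * (m / t))
    have hE : 0 ≤ h * (|C| * h ^ ((2 - (n + ε)) / 2)) := by positivity
    have ht0 : 0 ≤ t := by linarith
    calc _ = |(Z - κ * t * (∫ v, f v) * L) + κ * t * ((∫ v, f v) * L - 2 * h * I₀)| := by
          congr 1
          ring
      _ ≤ |Z - κ * t * (∫ v, f v) * L| + |κ| * t * |(∫ v, f v) * L - 2 * h * I₀| := by
          refine (abs_add_le _ _).trans_eq ?_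
          rw [abs_mul (κ * t), abs_mul κ t, abs_of_nonneg ht0]
      _ ≤ h * (|C| * h ^ ((2 - (n + ε)) / 2)) + |κ| * t * ((4 * M + 4 * |I₀|) * h ^ 3) := by
          gcongr
      _ ≤ _ := by
          refine (add_le_add_left (le_mul_of_one_le_left hE one_le_two) _).trans (le_of_eq ?_)
          ring
  refine ⟨κ, |κ| * (2 * M + 2 * |I₀|) + |C| * 100 ^ ((n + ε - 2) / 2), fun t ht N hN ↦ ?_⟩
  have ht0 : 0 < t := by linarith
  obtain ⟨N', hNN', hN'⟩ : ∃ N' : ℕ, N ≤ N' ∧ 4 * t ≤ N' :=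
    ⟨max N ⌈4 * t⌉₊, le_max_left _ _, (Nat.le_ceil _).trans (Nat.cast_le.mpr (le_max_right _ _))⟩
  have hsum : ∑ m ∈ Finset.Icc 1 N, (rK K m : ℝ) * tentSum a c (m / t) =
      ∑ m ∈ Finset.Icc 1 N', (rK K m : ℝ) * tentSum a c (m / t) := by
    refine Finset.sum_subset (Finset.Icc_subset_Icc_right hNN') fun m hm1 hm2 ↦ ?_
    rw [tentSum_eq_zero_of_one_le (fun i ↦ (ha i).2), mul_zero]
    rw [one_le_div ht0]
    have : N < m := by
      rw [Finset.mem_Icc] at hm1 hm2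
      omega
    exact hN.trans (Nat.cast_le.mpr this.le)
  rw [hsum]
  set h : ℝ := t ^ (-3 / (2 * n)) / 100 with hh_def
  have hh : 0 < h := by positivity
  have hh1 : h ≤ 1 / 100 := by
    rw [hh_def]
    gcongr
    refine Real.rpow_le_one_of_one_le_of_nonpos ht ?_
    exact div_nonpos_of_nonpos_of_nonneg (by norm_num) (by linarith)
  have hf1 := isSmoothedPiecewiseLinear_rampSum ha hc0 hc1 (D := D)
    (fun i j hj s ↦ (hD₁ i j hj s).trans (le_max_left _ _)) hh hh1
  have hf2 := isSmoothedPiecewiseLinear_rampSum (d := fun i ↦ -d i) ha hc0 hc1 (D := D)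
    (fun i j hj s ↦ (hD₂ i j hj s).trans (le_max_right _ _)) hh hh1
  simp_rw [abs_neg] at hf2
  have hI1 := abs_integral_rampSum_sub_sq_le ha hh hh1 hf1.support_subset
  have hI2 := abs_integral_rampSum_sub_sq_le ha hh hh1 hf2.support_subset
  simp_rw [abs_neg] at hI2
  have hk1 := key t ht N' hN' h hh hh1 _ hf1 hI1
  have hk2 := key t ht N' hN' h hh hh1 _ hf2 hI2
  set E := |κ| * (2 * M + 2 * |I₀|) * (t * h ^ 2) + |C| * h ^ ((2 - (n + ε)) / 2) with hE_def
  have hS1 : 2 * h * ∑ m ∈ Finset.Icc 1 N', (rK K m : ℝ) * tentSum a c (m / t) ≤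
      ∑ m ∈ Finset.Icc 1 N', (rK K m : ℝ) *
        ∫ μ in (1 - h)..(1 + h), rampSum a c d h (μ * (m / t)) := by
    rw [Finset.mul_sum]
    refine Finset.sum_le_sum fun m _ ↦ ?_
    rw [mul_left_comm]
    exact mul_le_mul_of_nonneg_left (tentSum_le_integral_rampSum hh (by linarith)
      (fun i ↦ (ha i).2) (by positivity) fun i ↦ rfl) (Nat.cast_nonneg _)
  have hS2 : ∑ m ∈ Finset.Icc 1 N', (rK K m : ℝ) *
      ∫ μ in (1 - h)..(1 + h), rampSum a c (fun i ↦ -d i) h (μ * (m / t)) ≤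
      2 * h * ∑ m ∈ Finset.Icc 1 N', (rK K m : ℝ) * tentSum a c (m / t) := by
    rw [Finset.mul_sum]
    refine Finset.sum_le_sum fun m _ ↦ ?_
    rw [mul_left_comm (2 * h)]
    exact mul_le_mul_of_nonneg_left (integral_rampSum_le_tentSum hh (by linarith)
      (fun i ↦ (ha i).2) (by positivity) fun i ↦ (neg_neg _).symm) (Nat.cast_nonneg _)
  have hE : |(∑ m ∈ Finset.Icc 1 N', (rK K m : ℝ) * tentSum a c (m / t)) - κ * t * I₀| ≤ E := by
    rw [abs_le] at hk1 hk2 ⊢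
    have h2h : 0 < 2 * h := by linarith
    constructor
    · refine le_of_mul_le_mul_left ?_ h2h
      linarith [hk2.1]
    · refine le_of_mul_le_mul_left ?_ h2h
      linarith [hk1.2]
  refine hE.trans ?_
  rw [hE_def, add_mul, mul_assoc |C|]
  have h5 : t * h ^ 2 ≤ t ^ (1 - 3 / n + ε) := by
    calc t * h ^ 2 = t ^ (1 - 3 / n) / 10000 := by
          rw [hh_def, div_pow, ← Real.rpow_natCast, ← Real.rpow_mul ht0.le, sub_eq_add_neg,
            Real.rpow_add ht0, Real.rpow_one, show -3 / (2 * n) * ((2 : ℕ) : ℝ) = -(3 / n) by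
              push_cast
              field_simp]
          norm_num
          ring
      _ ≤ t ^ (1 - 3 / n) := div_le_self (Real.rpow_nonneg ht0.le _) (by norm_num)
      _ ≤ _ := Real.rpow_le_rpow_of_exponent_le ht (by linarith)
  have h6 := rpow_scale_le hn6 hε rfl ht
  gcongr

end TentBound

section RieszSum

lemma exists_abs_le_of_abs_sub_mul_half_le {F : ℝ → ℝ} {q s C M : ℝ} (hq0 : 0 ≤ q) (hs : 0 ≤ s)
    (hq : q < 2 ^ s) (h1 : ∀ t, 1 ≤ t → |F t - q * F (t / 2)| ≤ C * t ^ s)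
    (h2 : ∀ t ∈ Icc (1 / 2 : ℝ) 1, |F t| ≤ M) :
    ∃ C', ∀ t, 1 / 2 ≤ t → |F t| ≤ C' * t ^ s := by
  have h2s : (0 : ℝ) < 2 ^ s := by positivity
  have hM : 0 ≤ M := (abs_nonneg _).trans (h2 1 ⟨by norm_num, le_rfl⟩)
  set w : ℝ := q / 2 ^ s with hw
  have hw1 : 0 < 1 - w := by
    rw [hw, sub_pos, div_lt_one h2s]
    exact hq
  set C' := max (M * 2 ^ s) (C / (1 - w)) with hC'
  have hC'0 : 0 ≤ C' := (by positivity : 0 ≤ M * 2 ^ s).trans (le_max_left _ _)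
  have hC'1 : C + C' * w ≤ C' := by
    have : C ≤ C' * (1 - w) := (div_le_iff₀ hw1).mp (le_max_right _ _)
    linarith
  refine ⟨C', ?_⟩
  have key : ∀ k : ℕ, ∀ t, 1 / 2 ≤ t → t ≤ 2 ^ k → |F t| ≤ C' * t ^ s := by
    intro k
    induction k with
    | zero =>
      intro t ht1 ht2
      rw [pow_zero] at ht2
      calc |F t| ≤ M := h2 t ⟨ht1, ht2⟩
        _ = M * 2 ^ s * (1 / 2) ^ s := by
            rw [mul_assoc, ← Real.mul_rpow (by norm_num) (by norm_num)]
            norm_num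
        _ ≤ C' * t ^ s := by
            gcongr
            exact le_max_left _ _
    | succ k ih =>
      intro t ht1 ht2
      rcases le_total t 1 with h | h
      · refine ih t ht1 (h.trans ?_)
        exact one_le_pow₀ one_le_two
      · have h3 := ih (t / 2) (by linarith) (by rw [pow_succ] at ht2; linarith)
        calc |F t| ≤ |F t - q * F (t / 2)| + |q * F (t / 2)| := by
              have := abs_add_le (F t - q * F (t / 2)) (q * F (t / 2))
              rwa [sub_add_cancel] at this
          _ ≤ C * t ^ s + q * (C' * (t / 2) ^ s) := by
              rw [abs_mul, abs_of_nonneg hq0]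
              gcongr
              exact h1 t h
          _ = (C + C' * w) * t ^ s := by
              rw [Real.div_rpow (by linarith) (by norm_num)]
              ring
          _ ≤ C' * t ^ s := by gcongr
  intro t ht
  obtain ⟨k, hk⟩ := pow_unbounded_of_one_lt t one_lt_two
  exact key k t ht hk.le

/-- The Riesz sum `∑_{1 ≤ m ≤ t} r m * (t - m)`. -/
noncomputable def rieszSum (r : ℕ → ℝ) (t : ℝ) : ℝ := ∑ m ∈ Finset.Icc 1 ⌊t⌋₊, r m * (t - m)

lemma rieszSum_eq_sum_max_of_floor_le (r : ℕ → ℝ) {t : ℝ} {N : ℕ} (ht : ⌊t⌋₊ ≤ N) :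
    rieszSum r t = ∑ m ∈ Finset.Icc 1 N, r m * max (t - m) 0 := by
  rw [← Finset.sum_subset (Finset.Icc_subset_Icc_right ht)]
  · refine Finset.sum_congr rfl fun m hm ↦ ?_
    rw [Finset.mem_Icc] at hm
    rw [max_eq_left]
    have := (Nat.le_floor_iff' (by omega)).mp hm.2
    linarith
  · intro m hm1 hm2
    rw [Finset.mem_Icc] at hm1 hm2
    have : ⌊t⌋₊ < m := by omega
    have := (Nat.floor_lt' (by omega)).mp this
    rw [max_eq_right (by linarith), mul_zero]

lemma rieszSum_eq_sum_max (r : ℕ → ℝ) {t : ℝ} {N : ℕ} (ht : t ≤ N) :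
    rieszSum r t = ∑ m ∈ Finset.Icc 1 N, r m * max (t - m) 0 :=
  rieszSum_eq_sum_max_of_floor_le r (Nat.floor_le_of_le ht)

lemma rieszSum_of_le_one (r : ℕ → ℝ) {t : ℝ} (ht : t ≤ 1) : rieszSum r t = 0 := by
  rw [rieszSum_eq_sum_max r (N := 1) (by simpa using ht)]
  simpa using Or.inr ht

theorem exists_abs_rieszSum_sub_le {r : ℕ → ℝ} {κ C θ : ℝ} (hθ : 0 < θ)
    (h : ∀ t : ℝ, 1 ≤ t → ∀ N : ℕ, t ≤ N →
      |(∑ m ∈ Finset.Icc 1 N, r m * tentSum ![1, 1 / 2, 1 / 4] ![1, -3, 2] (m / t)) -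
        κ * t * (3 / 16)| ≤ C * t ^ θ) :
    ∃ C', ∀ t, 1 ≤ t → |rieszSum r t - κ * t ^ 2 / 2| ≤ C' * t ^ (1 + θ) := by
  set D : ℝ → ℝ := fun t ↦ rieszSum r t - κ * t ^ 2 / 2 with hD
  have hDsmall : ∀ t, t ≤ 1 → D t = -(κ * t ^ 2 / 2) := fun t ht ↦ by
    simp only [hD, rieszSum_of_le_one r ht, zero_sub]
  have h1 : ∀ t, 1 ≤ t → |(D t - 2 * D (t / 2)) - 1 * (D (t / 2) - 2 * D (t / 2 / 2))| ≤
      C * t ^ (1 + θ) := fun t ht ↦ by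
    have ht0 : 0 < t := by linarith
    have h2 := h t ht ⌈t⌉₊ (Nat.le_ceil t)
    have hsum : ∑ m ∈ Finset.Icc 1 ⌈t⌉₊, r m * tentSum ![1, 1 / 2, 1 / 4] ![1, -3, 2] (m / t) =
        t⁻¹ * (rieszSum r t - 3 * rieszSum r (t / 2) + 2 * rieszSum r (t / 2 / 2)) := by
      have hc := Nat.le_ceil t
      rw [rieszSum_eq_sum_max r hc, rieszSum_eq_sum_max r (t := t / 2) (N := ⌈t⌉₊) (by linarith),
        rieszSum_eq_sum_max r (t := t / 2 / 2) (N := ⌈t⌉₊) (by linarith), Finset.mul_sum,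
        Finset.mul_sum, ← Finset.sum_sub_distrib, ← Finset.sum_add_distrib, Finset.mul_sum]
      refine Finset.sum_congr rfl fun m _ ↦ ?_
      have hmax : ∀ a : ℝ, max (a - m / t) 0 = t⁻¹ * max (a * t - m) 0 := fun a ↦ by
        rw [mul_max_of_nonneg _ _ (inv_nonneg.mpr ht0.le), mul_zero]
        congr 1
        field_simp
      simp only [tentSum, Fin.sum_univ_three, Matrix.cons_val_zero, Matrix.cons_val_one,
        Matrix.cons_val, hmax]
      ring_nf
    rw [hsum] at h2
    calc _ = t * |t⁻¹ * (rieszSum r t - 3 * rieszSum r (t / 2) + 2 * rieszSum r (t / 2 / 2)) -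
          κ * t * (3 / 16)| := by
          have : D t - 2 * D (t / 2) - 1 * (D (t / 2) - 2 * D (t / 2 / 2)) =
              t * (t⁻¹ * (rieszSum r t - 3 * rieszSum r (t / 2) + 2 * rieszSum r (t / 2 / 2)) -
                κ * t * (3 / 16)) := by
            simp only [hD]
            field_simp
            ring
          rw [this, abs_mul, abs_of_pos ht0]
      _ ≤ t * (C * t ^ θ) := by gcongr
      _ = _ := by
          rw [Real.rpow_add ht0, Real.rpow_one]
          ring
  have h2θ : (2 : ℝ) < 2 ^ (1 + θ) := by
    nth_rewrite 1 [← Real.rpow_one 2]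
    exact Real.rpow_lt_rpow_of_exponent_lt one_lt_two (by linarith)
  obtain ⟨C₁, hC₁⟩ := exists_abs_le_of_abs_sub_mul_half_le (F := fun t ↦ D t - 2 * D (t / 2))
    (M := |κ|) zero_le_one (by linarith) (one_lt_two.trans h2θ) h1 fun t ht ↦ by
      rw [hDsmall t ht.2, hDsmall (t / 2) (by linarith [ht.2]),
        show -(κ * t ^ 2 / 2) - 2 * -(κ * (t / 2) ^ 2 / 2) = κ * (-t ^ 2 / 4) by ring, abs_mul]
      refine mul_le_of_le_one_right (abs_nonneg κ) ?_
      rw [abs_le]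
      constructor <;> nlinarith [ht.1, ht.2]
  obtain ⟨C₂, hC₂⟩ := exists_abs_le_of_abs_sub_mul_half_le (F := D) (M := |κ|) zero_le_two
    (by linarith) h2θ (fun t ht ↦ hC₁ t (by linarith)) fun t ht ↦ by
      rw [hDsmall t ht.2, show -(κ * t ^ 2 / 2) = κ * (-t ^ 2 / 2) by ring, abs_mul]
      refine mul_le_of_le_one_right (abs_nonneg κ) ?_
      rw [abs_le]
      constructor <;> nlinarith [ht.1, ht.2]
  exact ⟨C₂, fun t ht ↦ hC₂ t (by linarith)⟩

end RieszSum

section Residue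

lemma rieszSum_natCast_succ (r : ℕ → ℝ) (N : ℕ) :
    rieszSum r ((N + 1 : ℕ) : ℝ) = rieszSum r N + ∑ m ∈ Finset.Icc 1 N, r m := by
  simp only [rieszSum, Nat.floor_natCast]
  rw [Finset.sum_Icc_succ_top (by omega), sub_self, mul_zero, add_zero, ← Finset.sum_add_distrib]
  refine Finset.sum_congr rfl fun m _ ↦ ?_
  push_cast
  ring

lemma rieszSum_natCast (r : ℕ → ℝ) (N : ℕ) :
    rieszSum r N = ∑ k ∈ Finset.range N, ∑ m ∈ Finset.Icc 1 k, r m := by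
  induction N with
  | zero => simp [rieszSum]
  | succ N ih => rw [rieszSum_natCast_succ, ih, Finset.sum_range_succ]

lemma sum_range_natCast_eq (N : ℕ) : ∑ k ∈ Finset.range N, (k : ℝ) = N * (N - 1) / 2 := by
  induction N with
  | zero => simp
  | succ N ih =>
    rw [Finset.sum_range_succ, ih]
    push_cast
    ring

lemma tendsto_rieszSum_div_sq {r : ℕ → ℝ} {ρ : ℝ}
    (h : Tendsto (fun n : ℕ ↦ (∑ m ∈ Finset.Icc 1 n, r m) / n) atTop (nhds ρ)) :
    Tendsto (fun N : ℕ ↦ rieszSum r N / (N : ℝ) ^ 2) atTop (nhds (ρ / 2)) := by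
  have h1 : (fun n : ℕ ↦ (∑ m ∈ Finset.Icc 1 n, r m) - ρ * n) =o[atTop] fun n : ℕ ↦ (n : ℝ) := by
    rw [isLittleO_iff_tendsto' (by
      filter_upwards [eventually_gt_atTop 0] with n hn h0
      exact absurd (Nat.cast_eq_zero.mp h0) hn.ne')]
    have := h.sub_const ρ
    rw [sub_self] at this
    refine this.congr' ?_
    filter_upwards [eventually_gt_atTop 0] with n hn
    have : (n : ℝ) ≠ 0 := by positivity
    field_simp
  have hsq : Tendsto (fun N : ℕ ↦ (N : ℝ) * (N - 1) / 2) atTop atTop := by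
    refine tendsto_atTop_mono' _ (f₁ := fun N : ℕ ↦ ((N : ℝ) - 1) / 2) ?_
      ((tendsto_atTop_add_const_right _ _ tendsto_natCast_atTop_atTop).atTop_div_const two_pos)
    filter_upwards [eventually_ge_atTop 1] with N hN
    have : (1 : ℝ) ≤ N := by exact_mod_cast hN
    nlinarith
  have h2 := h1.sum_range (fun n ↦ Nat.cast_nonneg n)
    (by simpa only [sum_range_natCast_eq] using hsq)
  simp only [Finset.sum_sub_distrib, ← Finset.mul_sum, sum_range_natCast_eq,
    ← rieszSum_natCast] at h2
  have h3 : (fun N : ℕ ↦ rieszSum r N - ρ * (N * (N - 1) / 2)) =o[atTop]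
      fun N : ℕ ↦ (N : ℝ) ^ 2 := by
    refine h2.trans_isBigO (IsBigO.of_bound 1 (Eventually.of_forall fun N ↦ ?_))
    have : (0 : ℝ) ≤ N := Nat.cast_nonneg N
    rw [Real.norm_eq_abs, Real.norm_eq_abs, abs_of_nonneg (sq_nonneg (N : ℝ)), abs_le]
    constructor
    · rcases Nat.eq_zero_or_pos N with h0 | h0
      · simp [h0]
      · have : (1 : ℝ) ≤ N := by exact_mod_cast h0
        nlinarith
    · nlinarith
  have h4 := h3.tendsto_div_nhds_zero
  have h5 : Tendsto (fun N : ℕ ↦ ρ / 2 - ρ / 2 * (N : ℝ)⁻¹) atTop (nhds (ρ / 2)) := by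
    simpa using (tendsto_natCast_atTop_atTop (R := ℝ)).inv_tendsto_atTop.const_mul (ρ / 2)
      |>.const_sub (ρ / 2)
  have h6 := h4.add h5
  rw [zero_add] at h6
  refine h6.congr' ?_
  filter_upwards [eventually_gt_atTop 0] with n hn
  have : (n : ℝ) ≠ 0 := by positivity
  field_simp
  ring

lemma eq_of_abs_rieszSum_sub_le {r : ℕ → ℝ} {ρ κ C θ : ℝ} (hθ : θ < 1)
    (h : Tendsto (fun n : ℕ ↦ (∑ m ∈ Finset.Icc 1 n, r m) / n) atTop (nhds ρ))
    (hκ : ∀ t, 1 ≤ t → |rieszSum r t - κ * t ^ 2 / 2| ≤ C * t ^ (1 + θ)) : κ = ρ := by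
  have h1 := (tendsto_rieszSum_div_sq h).sub_const (κ / 2)
  have h2 : Tendsto (fun N : ℕ ↦ C * (N : ℝ) ^ (-(1 - θ))) atTop (nhds 0) := by
    simpa using ((tendsto_rpow_neg_atTop (sub_pos.mpr hθ)).comp
      (tendsto_natCast_atTop_atTop (R := ℝ))).const_mul C
  have h3 : Tendsto (fun N : ℕ ↦ rieszSum r N / (N : ℝ) ^ 2 - κ / 2) atTop (nhds 0) := by
    refine squeeze_zero_norm' ?_ h2
    filter_upwards [eventually_ge_atTop 1] with N hN
    have hN1 : (1 : ℝ) ≤ N := by exact_mod_cast hN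
    have hN0 : (0 : ℝ) < N := by linarith
    have h4 := hκ N hN1
    rw [Real.norm_eq_abs, show rieszSum r N / (N : ℝ) ^ 2 - κ / 2 =
      (rieszSum r N - κ * (N : ℝ) ^ 2 / 2) / (N : ℝ) ^ 2 by field_simp, abs_div,
      abs_of_pos (by positivity : (0 : ℝ) < (N : ℝ) ^ 2), div_le_iff₀ (by positivity)]
    refine h4.trans_eq ?_
    rw [mul_assoc, ← Real.rpow_natCast, ← Real.rpow_add hN0]
    congr 2
    push_cast
    ring
  have := tendsto_nhds_unique h1 h3
  linarith

variable (K : Type*) [Field K] [NumberField K]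

lemma tendsto_sum_rK_div :
    Tendsto (fun n : ℕ ↦ (∑ m ∈ Finset.Icc 1 n, (rK K m : ℝ)) / n) atTop
      (nhds (dedekindZeta_residue K)) := by
  refine ((Ideal.tendsto_norm_le_div_atTop₀ K).comp tendsto_natCast_atTop_atTop).congr fun n ↦ ?_
  simp only [Function.comp_apply, Nat.cast_le, ← Nat.cast_sum, rK]
  congr
  rw [← add_left_inj 1, ← Ideal.card_norm_le_eq_card_norm_le_add_one,
    show Finset.Icc 1 n = Finset.Ioc 0 n from Finset.Icc_succ_left_eq_Ioc _ _,
    show 1 = Nat.card {I : Ideal (𝓞 K) // Ideal.absNorm I = 0} by simp [Ideal.absNorm_eq_zero_iff],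
    Finset.sum_Ioc_add_eq_sum_Icc (n.zero_le),
    ← Finset.card_preimage_eq_sum_card_image_eq (fun k _ ↦ Ideal.finite_setOfPred_absNorm_eq k)]
  simp [Set.coe_eq_subtype]

lemma dedekindZeta_ofReal {s : ℝ} (hs : 0 < s) :
    dedekindZeta K s = ((∑' m : ℕ, (rK K m : ℝ) / (m : ℝ) ^ s : ℝ) : ℂ) := by
  rw [dedekindZeta, LSeries, Complex.ofReal_tsum]
  refine tsum_congr fun m ↦ ?_
  rcases Nat.eq_zero_or_pos m with rfl | hm
  · simp [Real.zero_rpow hs.ne']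
  · rw [LSeries.term_of_ne_zero hm.ne', Complex.ofReal_div,
      Complex.ofReal_cpow (Nat.cast_nonneg m)]
    simp [rK]

lemma tendsto_sub_one_mul_tsum_rK :
    Tendsto (fun s : ℝ ↦ (s - 1) * ∑' m : ℕ, (rK K m : ℝ) / (m : ℝ) ^ s)
      (nhdsWithin 1 (Ioi 1)) (nhds (dedekindZeta_residue K)) := by
  have h := (Complex.continuous_re.tendsto _).comp (tendsto_sub_one_mul_dedekindZeta_nhdsGT K)
  rw [Complex.ofReal_re] at h
  refine h.congr' ?_
  filter_upwards [self_mem_nhdsWithin] with s hs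
  have : (0 : ℝ) < s := zero_lt_one.trans hs
  rw [Function.comp_apply, dedekindZeta_ofReal K this, ← Complex.ofReal_one, ← Complex.ofReal_sub,
    ← Complex.ofReal_mul, Complex.ofReal_re]

end Residue

section LogLog

lemma integrableOn_exp_neg_div {a : ℝ} (ha : 0 < a) :
    IntegrableOn (fun t : ℝ ↦ Real.exp (-t) / t) (Ioi a) := by
  refine Integrable.mono' ((integrableOn_exp_neg_Ioi a).const_mul a⁻¹) ?_ ?_
  · refine ContinuousOn.aestronglyMeasurable (fun t ht ↦ ?_) measurableSet_Ioi
    have : t ≠ 0 := (ha.trans ht).ne'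
    exact ContinuousAt.continuousWithinAt (by fun_prop (disch := assumption))
  · filter_upwards [ae_restrict_mem measurableSet_Ioi] with t ht
    have h0 : 0 < t := ha.trans ht
    rw [Real.norm_eq_abs, abs_of_nonneg (by positivity), div_eq_inv_mul]
    gcongr
    exact ht.le

lemma E1_sub_E1 {a b : ℝ} (ha : 0 < a) (hb : 0 < b) :
    E1 a - E1 b = ∫ t in a..b, Real.exp (-t) / t :=
  intervalIntegral.integral_Ioi_sub_Ioi' (integrableOn_exp_neg_div ha) (integrableOn_exp_neg_div hb)

lemma hasDerivAt_E1 {X : ℝ} (hX : 0 < X) : HasDerivAt E1 (-(Real.exp (-X) / X)) X := by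
  have hc : ∀ t : ℝ, 0 < t → ContinuousAt (fun t : ℝ ↦ Real.exp (-t) / t) t := fun t ht ↦ by
    have : t ≠ 0 := ht.ne'
    fun_prop (disch := assumption)
  have h1 : HasDerivAt (fun b ↦ ∫ t in (1 : ℝ)..b, Real.exp (-t) / t) (Real.exp (-X) / X) X := by
    refine intervalIntegral.integral_hasDerivAt_right ?_ ?_ (hc X hX)
    · refine ContinuousOn.intervalIntegrable fun t ht ↦ (hc t ?_).continuousWithinAt
      exact (lt_min one_pos hX).trans_le ht.1
    · exact ContinuousOn.stronglyMeasurableAtFilter isOpen_Ioi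
        (fun t ht ↦ (hc t ht).continuousWithinAt) X hX
  refine (h1.const_sub (E1 1)).congr_of_eventuallyEq ?_
  filter_upwards [lt_mem_nhds hX] with b hb
  linarith [E1_sub_E1 one_pos hb]

lemma E1_nonneg {X : ℝ} (hX : 0 < X) : 0 ≤ E1 X :=
  setIntegral_nonneg measurableSet_Ioi fun t ht ↦ by
    have : 0 < t := hX.trans ht
    positivity

lemma E1_le_exp_neg {X : ℝ} (hX : 1 ≤ X) : E1 X ≤ Real.exp (-X) := by
  rw [← integral_exp_neg_Ioi X]
  refine setIntegral_mono_on (integrableOn_exp_neg_div (by linarith)) (integrableOn_exp_neg_Ioi X)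
    measurableSet_Ioi fun t ht ↦ ?_
  exact div_le_self (Real.exp_pos _).le (hX.trans ht.le)

lemma hasDerivAt_sub_log {l t : ℝ} (ht : 0 < t) :
    HasDerivAt (fun t ↦ l - Real.log t) (-t⁻¹) t :=
  (Real.hasDerivAt_log ht.ne').const_sub l

lemma continuousOn_log_sub_one_div {l y : ℝ} (hy : ∀ t ∈ Icc 1 y, 0 < l - Real.log t) {p : ℝ}
    (hp : 1 ≤ p) :
    ContinuousOn (fun t ↦ (l - Real.log t - 1) / (t * (l - Real.log t)) ^ 2) (Icc p y) := by
  intro t ht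
  have h0 : t ≠ 0 := by linarith [ht.1]
  have h1 : (t * (l - Real.log t)) ^ 2 ≠ 0 :=
    pow_ne_zero _ (mul_ne_zero h0 (hy t ⟨hp.trans ht.1, ht.2⟩).ne')
  exact ContinuousAt.continuousWithinAt (by fun_prop (disch := assumption))

lemma integral_log_sub_one_div_mul_max {l y a : ℝ} (hly : l - Real.log y = 1)
    (hL : ∀ t ∈ Icc 1 y, 0 < l - Real.log t) (ha : 1 ≤ a) (hay : a ≤ y) :
    ∫ t in (1 : ℝ)..y, (l - Real.log t - 1) / (t * (l - Real.log t)) ^ 2 * max (t - a) 0 =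
      Real.log (l - Real.log a) - (y - a) / y := by
  have hc := continuousOn_log_sub_one_div hL le_rfl
  have hInt : ∀ p q, 1 ≤ p → p ≤ q → q ≤ y → IntervalIntegrable
      (fun t ↦ (l - Real.log t - 1) / (t * (l - Real.log t)) ^ 2 * max (t - a) 0) volume p q :=
    fun p q hp hpq hq ↦ ContinuousOn.intervalIntegrable <| by
      rw [uIcc_of_le hpq]
      exact (hc.mono (Icc_subset_Icc hp hq)).mul (by fun_prop)
  rw [← intervalIntegral.integral_add_adjacent_intervals (hInt 1 a le_rfl ha hay)
    (hInt a y ha hay le_rfl)]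
  have h1 : ∫ t in (1 : ℝ)..a, (l - Real.log t - 1) / (t * (l - Real.log t)) ^ 2 * max (t - a) 0 =
      0 := by
    rw [intervalIntegral.integral_congr (g := fun _ ↦ (0 : ℝ))]
    · simp
    · intro t ht
      rw [uIcc_of_le ha] at ht
      simp [max_eq_right (sub_nonpos.mpr ht.2)]
  have h2 : ∫ t in a..y, (l - Real.log t - 1) / (t * (l - Real.log t)) ^ 2 * max (t - a) 0 =
      ∫ t in a..y, (l - Real.log t - 1) / (t * (l - Real.log t)) ^ 2 * (t - a) := by
    refine intervalIntegral.integral_congr fun t ht ↦ ?_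
    rw [uIcc_of_le hay] at ht
    simp [max_eq_left (sub_nonneg.mpr ht.1)]
  have hderiv : ∀ t ∈ uIcc a y, HasDerivAt
      (fun t ↦ -(t * (l - Real.log t))⁻¹ * (t - a) - Real.log (l - Real.log t))
      ((l - Real.log t - 1) / (t * (l - Real.log t)) ^ 2 * (t - a)) t := fun t ht ↦ by
    rw [uIcc_of_le hay] at ht
    have h0 : 0 < t := by linarith [ht.1]
    have hl := hL t ⟨ha.trans ht.1, ht.2⟩
    have h3 := hasDerivAt_sub_log (l := l) h0
    convert! ((((hasDerivAt_id t).mul h3).inv (mul_pos h0 hl).ne').neg.mul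
      ((hasDerivAt_id t).sub_const a)).sub (h3.log hl.ne') using 1
    simp only [id, Pi.mul_apply, Pi.neg_apply, Pi.inv_apply]
    field_simp
    ring
  rw [h1, h2, zero_add, intervalIntegral.integral_eq_sub_of_hasDerivAt hderiv]
  · have : y ≠ 0 := by linarith
    rw [hly]
    simp
    field_simp
    ring
  · refine ContinuousOn.intervalIntegrable ?_
    rw [uIcc_of_le hay]
    exact (hc.mono (Icc_subset_Icc ha le_rfl)).mul (by fun_prop)

lemma integral_inv_log {l y : ℝ} (hy : 1 ≤ y) (hly : l - Real.log y = 1)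
    (hL : ∀ t ∈ Icc 1 y, 0 < l - Real.log t) :
    ∫ t in (1 : ℝ)..y, (l - Real.log t)⁻¹ = Real.exp l * (E1 1 - E1 l) := by
  have hderiv : ∀ t ∈ uIcc 1 y, HasDerivAt (fun t ↦ Real.exp l * E1 (l - Real.log t))
      (l - Real.log t)⁻¹ t := fun t ht ↦ by
    rw [uIcc_of_le hy] at ht
    have h0 : 0 < t := by linarith [ht.1]
    have hl := hL t ht
    convert! ((hasDerivAt_E1 hl).comp t (hasDerivAt_sub_log h0)).const_mul (Real.exp l) using 1
    rw [neg_sub, Real.exp_sub, Real.exp_log h0]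
    field_simp
  rw [intervalIntegral.integral_eq_sub_of_hasDerivAt hderiv, hly]
  · simp
    ring
  · refine ContinuousOn.intervalIntegrable fun t ht ↦ ?_
    rw [uIcc_of_le hy] at ht
    have h0 : t ≠ 0 := by linarith [ht.1]
    have hl := (hL t ht).ne'
    exact ContinuousAt.continuousWithinAt (by fun_prop (disch := assumption))

lemma integral_log_sub_one_div_mul_sq {l y : ℝ} (hy : 1 ≤ y) (hly : l - Real.log y = 1)
    (hL : ∀ t ∈ Icc 1 y, 0 < l - Real.log t) :
    ∫ t in (1 : ℝ)..y, (l - Real.log t - 1) / (t * (l - Real.log t)) ^ 2 * (t ^ 2 / 2) =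
      Real.exp l * (E1 1 - E1 l) + l⁻¹ / 2 - y / 2 := by
  have hl0 : 0 < l := by simpa using hL 1 ⟨le_rfl, hy⟩
  have hcinv : ContinuousOn (fun t ↦ (l - Real.log t)⁻¹) (uIcc 1 y) := fun t ht ↦ by
    rw [uIcc_of_le hy] at ht
    have h0 : t ≠ 0 := by linarith [ht.1]
    have hl := (hL t ht).ne'
    exact ContinuousAt.continuousWithinAt (by fun_prop (disch := assumption))
  have hderiv : ∀ t ∈ uIcc 1 y, HasDerivAt (fun t ↦ t * (l - Real.log t)⁻¹)
      ((l - Real.log t)⁻¹ + (l - Real.log t)⁻¹ ^ 2) t := fun t ht ↦ by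
    rw [uIcc_of_le hy] at ht
    have h0 : 0 < t := by linarith [ht.1]
    have hl := hL t ht
    convert! (hasDerivAt_id t).mul ((hasDerivAt_sub_log h0).inv hl.ne') using 1
    simp only [id, Pi.inv_apply]
    field_simp
  have hFTC := intervalIntegral.integral_eq_sub_of_hasDerivAt hderiv
    (hcinv.add (hcinv.pow 2)).intervalIntegrable
  rw [← integral_inv_log hy hly hL]
  rw [hly, Real.log_one, sub_zero] at hFTC
  rw [intervalIntegral.integral_congr (g := fun t ↦ (l - Real.log t)⁻¹ -
    2⁻¹ * ((l - Real.log t)⁻¹ + (l - Real.log t)⁻¹ ^ 2)), intervalIntegral.integral_sub,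
    intervalIntegral.integral_const_mul, hFTC]
  · ring
  · exact hcinv.intervalIntegrable
  · exact ((hcinv.add (hcinv.pow 2)).intervalIntegrable).const_mul _
  · intro t ht
    rw [uIcc_of_le hy] at ht
    have h0 : 0 < t := by linarith [ht.1]
    have hl := hL t ht
    beta_reduce
    field_simp
    ring

end LogLog

section LogLogSum

lemma sum_mul_log_log_eq (r : ℕ → ℝ) {l y : ℝ} (hy : 1 ≤ y) (hly : l - Real.log y = 1)
    (hL : ∀ t ∈ Icc 1 y, 0 < l - Real.log t) :
    ∑ m ∈ Finset.Icc 1 ⌊y⌋₊, r m * Real.log (l - Real.log m) =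
      rieszSum r y / y + ∫ t in (1 : ℝ)..y, (l - Real.log t - 1) / (t * (l - Real.log t)) ^ 2 *
        ∑ m ∈ Finset.Icc 1 ⌊y⌋₊, r m * max (t - m) 0 := by
  have hInt : ∀ m ∈ Finset.Icc 1 ⌊y⌋₊, IntervalIntegrable
      (fun t ↦ (l - Real.log t - 1) / (t * (l - Real.log t)) ^ 2 * (r m * max (t - m) 0))
      volume 1 y := fun m _ ↦ ContinuousOn.intervalIntegrable <| by
    rw [uIcc_of_le hy]
    exact (continuousOn_log_sub_one_div hL le_rfl).mul (by fun_prop)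
  simp only [Finset.mul_sum]
  rw [intervalIntegral.integral_finsetSum hInt, rieszSum, Finset.sum_div, ← Finset.sum_add_distrib]
  refine Finset.sum_congr rfl fun m hm ↦ ?_
  rw [Finset.mem_Icc] at hm
  have h1 : (1 : ℝ) ≤ m := by exact_mod_cast hm.1
  have h2 : (m : ℝ) ≤ y := (Nat.le_floor_iff' (by omega)).mp hm.2
  simp only [mul_left_comm _ (r m)]
  rw [intervalIntegral.integral_const_mul, integral_log_sub_one_div_mul_max hly hL h1 h2]
  ring

lemma abs_sum_mul_log_log_sub_le {r : ℕ → ℝ} {κ C θ : ℝ} (hθ : 0 < θ)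
    (h : ∀ t, 1 ≤ t → |rieszSum r t - κ * t ^ 2 / 2| ≤ C * t ^ (1 + θ)) {x : ℝ}
    (hx : Real.exp 1 ≤ x) :
    |(∑ m ∈ Finset.Icc 1 ⌊x / Real.exp 1⌋₊, r m * Real.log (Real.log (x / m))) - E1 1 * κ * x| ≤
      (C + C / θ + |κ|) * x ^ θ := by
  have hx0 : 0 < x := (Real.exp_pos 1).trans_le hx
  set y := x / Real.exp 1 with hydef
  set l := Real.log x with hl
  have hy : 1 ≤ y := (one_le_div (Real.exp_pos 1)).mpr hx
  have hy0 : 0 < y := by linarith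
  have hly : l - Real.log y = 1 := by
    rw [hydef, Real.log_div hx0.ne' (Real.exp_pos 1).ne', Real.log_exp, ← hl]
    ring
  have hexpl : Real.exp l = x := Real.exp_log hx0
  have hL1 : ∀ t ∈ Icc 1 y, 1 ≤ l - Real.log t := fun t ht ↦ by
    have := Real.log_le_log (by linarith [ht.1]) ht.2
    linarith
  have hL : ∀ t ∈ Icc 1 y, 0 < l - Real.log t := fun t ht ↦ one_pos.trans_le (hL1 t ht)
  have hl1 : 1 ≤ l := by simpa using hL1 1 ⟨le_rfl, hy⟩
  have hC : 0 ≤ C := by simpa using (abs_nonneg _).trans (h 1 le_rfl)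
  have hsum : ∑ m ∈ Finset.Icc 1 ⌊y⌋₊, r m * Real.log (Real.log (x / m)) =
      ∑ m ∈ Finset.Icc 1 ⌊y⌋₊, r m * Real.log (l - Real.log m) :=
    Finset.sum_congr rfl fun m hm ↦ by
      have : (m : ℝ) ≠ 0 := Nat.cast_ne_zero.mpr (by grind)
      rw [Real.log_div hx0.ne' this]
  have hriesz : ∀ t, t ≤ y →
      ∑ m ∈ Finset.Icc 1 ⌊y⌋₊, r m * max (t - m) 0 = rieszSum r t := fun t ht ↦
    (rieszSum_eq_sum_max_of_floor_le r (Nat.floor_le_floor ht)).symm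
  have hc := continuousOn_log_sub_one_div hL le_rfl
  have hcS : Continuous fun t : ℝ ↦ ∑ m ∈ Finset.Icc 1 ⌊y⌋₊, r m * max (t - m) 0 := by fun_prop
  set S : ℝ → ℝ := fun t ↦ ∑ m ∈ Finset.Icc 1 ⌊y⌋₊, r m * max (t - m) 0 with hS
  set w : ℝ → ℝ := fun t ↦ (l - Real.log t - 1) / (t * (l - Real.log t)) ^ 2 with hw
  have herr : |∫ t in (1 : ℝ)..y, w t * (S t - κ * (t ^ 2 / 2))| ≤ C / θ * y ^ θ := by
    calc _ ≤ ∫ t in (1 : ℝ)..y, C * t ^ (θ - 1) := by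
          rw [← Real.norm_eq_abs]
          refine intervalIntegral.norm_integral_le_of_norm_le hy (Eventually.of_forall fun t ht ↦ ?_)
            ?_
          · have ht0 : 0 < t := by linarith [ht.1]
            have hLt := hL1 t ⟨ht.1.le, ht.2⟩
            have hw0 : 0 ≤ w t := div_nonneg (by linarith) (sq_nonneg _)
            have hw1 : w t ≤ (t ^ 2)⁻¹ := by
              simp only [hw, ← one_div, mul_pow]
              rw [div_le_div_iff₀ (by positivity) (by positivity)]
              nlinarith [sq_nonneg (l - Real.log t), sq_nonneg t, mul_nonneg (sq_nonneg t)
                (by nlinarith : 0 ≤ (l - Real.log t) ^ 2 - (l - Real.log t - 1))]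
            rw [norm_mul, Real.norm_of_nonneg hw0, Real.norm_eq_abs,
              show S t = rieszSum r t from hriesz t ht.2, ← mul_div_assoc]
            calc _ ≤ (t ^ 2)⁻¹ * (C * t ^ (1 + θ)) :=
                  mul_le_mul hw1 (h t ht.1.le) (abs_nonneg _) (by positivity)
              _ = _ := by
                  rw [mul_left_comm, ← Real.rpow_natCast, ← Real.rpow_neg ht0.le,
                    ← Real.rpow_add ht0]
                  congr 2
                  push_cast
                  ring
          · exact (intervalIntegral.intervalIntegrable_rpow' (by linarith)).const_mul C
      _ = C / θ * (y ^ θ - 1) := by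
          rw [intervalIntegral.integral_const_mul, integral_rpow (Or.inl (by linarith)),
            sub_add_cancel, Real.one_rpow]
          ring
      _ ≤ _ := by
          gcongr
          linarith
  have hsplit : ∫ t in (1 : ℝ)..y, w t * S t = (∫ t in (1 : ℝ)..y, w t * (S t - κ * (t ^ 2 / 2))) +
      κ * (x * (E1 1 - E1 l) + l⁻¹ / 2 - y / 2) := by
    rw [← hexpl, ← integral_log_sub_one_div_mul_sq hy hly hL,
      ← intervalIntegral.integral_const_mul, ← intervalIntegral.integral_add]
    · congr 1
      ext t
      ring
    · refine ContinuousOn.intervalIntegrable ?_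
      rw [uIcc_of_le hy]
      exact hc.mul (by fun_prop)
    · refine ContinuousOn.intervalIntegrable ?_
      rw [uIcc_of_le hy]
      exact continuousOn_const.mul (hc.mul (by fun_prop))
  have hE : |l⁻¹ / 2 - x * E1 l| ≤ 1 := by
    have h1 := E1_nonneg (one_pos.trans_le hl1)
    have h2 := E1_le_exp_neg hl1
    rw [Real.exp_neg, hexpl] at h2
    have h3 : x * E1 l ≤ 1 := (mul_le_mul_of_nonneg_left h2 hx0.le).trans_eq
      (mul_inv_cancel₀ hx0.ne')
    have h4 : 0 ≤ x * E1 l := by positivity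
    have h5 : l⁻¹ ≤ 1 := inv_le_one_of_one_le₀ hl1
    have h6 : 0 ≤ l⁻¹ := by positivity
    rw [abs_le]
    constructor <;> linarith
  have hbd : |(rieszSum r y - κ * y ^ 2 / 2) / y| ≤ C * y ^ θ := by
    rw [abs_div, abs_of_pos hy0, div_le_iff₀ hy0]
    refine (h y hy).trans_eq ?_
    rw [Real.rpow_add hy0, Real.rpow_one]
    ring
  have hyx : y ≤ x := div_le_self hx0.le (Real.one_le_exp zero_le_one)
  have hyθ : y ^ θ ≤ x ^ θ := Real.rpow_le_rpow hy0.le hyx hθ.le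
  have hx1 : 1 ≤ x ^ θ := Real.one_le_rpow (hy.trans hyx) hθ.le
  rw [hsum, sum_mul_log_log_eq r hy hly hL, hsplit]
  have key : rieszSum r y / y + ((∫ t in (1 : ℝ)..y, w t * (S t - κ * (t ^ 2 / 2))) +
      κ * (x * (E1 1 - E1 l) + l⁻¹ / 2 - y / 2)) - E1 1 * κ * x =
      (rieszSum r y - κ * y ^ 2 / 2) / y + (∫ t in (1 : ℝ)..y, w t * (S t - κ * (t ^ 2 / 2))) +
        κ * (l⁻¹ / 2 - x * E1 l) := by
    generalize ∫ t in (1 : ℝ)..y, w t * (S t - κ * (t ^ 2 / 2)) = I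
    field_simp
    ring
  rw [key]
  calc _ ≤ C * y ^ θ + C / θ * y ^ θ + |κ| * 1 := by
        refine (abs_add_le _ _).trans (add_le_add ((abs_add_le _ _).trans (add_le_add hbd herr)) ?_)
        rw [abs_mul]
        gcongr
    _ ≤ C * x ^ θ + C / θ * x ^ θ + |κ| * x ^ θ := by gcongr
    _ = _ := by ring

end LogLogSum

/-- Weighted ideal theorem: for a number field of degree `n ≥ 6`,
`∑_{m ≤ x/e} r_K(m) log log (x/m) = E₁(1) κ_K x + O(x^{1-3/n+ε})`. -/
theorem stmt0 (K : Type*) [Field K] [NumberField K]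
    (hn : 6 ≤ Module.finrank ℚ K)
    (κ : ℝ)
    (hκ : Filter.Tendsto
      (fun s : ℝ => (s - 1) * ∑' m : ℕ, (rK K m : ℝ) / (m : ℝ) ^ s)
      (nhdsWithin 1 (Set.Ioi 1)) (nhds κ))
    (ε : ℝ) (hε : 0 < ε) :
    ∃ C > 0, ∀ᶠ x : ℝ in atTop,
      |(∑ m ∈ Finset.Icc 1 ⌊x / Real.exp 1⌋₊,
          (rK K m : ℝ) * Real.log (Real.log (x / m))) - E1 1 * κ * x|
        ≤ C * x ^ ((1 : ℝ) - 3 / (Module.finrank ℚ K : ℝ) + ε) := by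
  set n : ℝ := (Module.finrank ℚ K : ℝ) with hndef
  have hn6 : (6 : ℝ) ≤ n := by
    rw [hndef]
    exact_mod_cast hn
  have hn3 : 3 / n ≤ 1 / 2 := by
    rw [div_le_div_iff₀ (by linarith) two_pos]
    linarith
  have hn0 : 0 < 3 / n := by positivity
  set δ := min ε (3 / n / 2) with hδ
  have hδ0 : 0 < δ := lt_min hε (by positivity)
  have hδ1 : δ ≤ 3 / n / 2 := min_le_right _ _
  have ha : ∀ i : Fin 3, (![1, 1 / 2, 1 / 4] : Fin 3 → ℝ) i ∈ Icc (1 / 4) 1 := fun i ↦ by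
    fin_cases i <;> norm_num
  obtain ⟨c, C₁, hC₁⟩ := exists_abs_sum_rK_tentSum_sub_le K hn hδ0 ha (c := ![1, -3, 2])
    (by simp only [Fin.sum_univ_three, Matrix.cons_val]; norm_num)
    (by simp only [Fin.sum_univ_three, Matrix.cons_val]; norm_num)
  have hconst : ∑ i : Fin 3, (![1, -3, 2] : Fin 3 → ℝ) i *
      ((![1, 1 / 2, 1 / 4] : Fin 3 → ℝ) i ^ 2 / 2) = 3 / 16 := by
    simp only [Fin.sum_univ_three, Matrix.cons_val]
    norm_num
  rw [hconst] at hC₁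
  obtain ⟨C₂, hC₂⟩ := exists_abs_rieszSum_sub_le (by linarith : 0 < 1 - 3 / n + δ) hC₁
  have hcκ : c = κ := (eq_of_abs_rieszSum_sub_le (by linarith) (tendsto_sum_rK_div K) hC₂).trans
    (tendsto_nhds_unique (tendsto_sub_one_mul_tsum_rK K) hκ)
  subst hcκ
  set C := C₂ + C₂ / (1 - 3 / n + δ) + |c|
  refine ⟨max C 1, by positivity, ?_⟩
  filter_upwards [eventually_ge_atTop (Real.exp 1)] with x hx
  have hx1 : 1 ≤ x := (Real.one_le_exp zero_le_one).trans hx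
  refine (abs_sum_mul_log_log_sub_le (by linarith) hC₂ hx).trans ?_
  gcongr
  · exact le_max_left _ _
  · exact min_le_left _ _
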